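/- For every concave modulus of continuity ω and every r = 1, 2, ..., sup over f in the conjugate class W̃^r H_ω of ‖f‖_L equals 4 Σ_{i=0}^∞ (−1)^{i(r+1)} b_{2i+1}/(2i+1)^{r+1}, where b_m = (2/π) ∫₀^{π/2} ω(2t) sin(mt) dt and ‖f‖_L = ∫₀^{2π} |f(t)| dt. -/

import Mathlib

open MeasureTheory Real Filter Set

noncomputable section

/-- ω is a concave modulus of continuity. -/
def IsConcaveModulus (ω : ℝ → ℝ) : Prop :=
  Continuous ω ∧ MonotoneOn ω (Ici 0) ∧ ω 0 = 0 ∧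
    (∀ s t : ℝ, 0 ≤ s → 0 ≤ t → ω (s + t) ≤ ω s + ω t) ∧
    (∀ t : ℝ, 0 ≤ t → 0 ≤ ω t) ∧ ConcaveOn ℝ (Ici 0) ω

/-- The Dini condition: ∫₀^ε ω(t)/t dt < ∞ for some ε > 0. -/
def DiniCondition (ω : ℝ → ℝ) : Prop :=
  ∃ ε > 0, IntegrableOn (fun t => ω t / t) (Ioo 0 ε)

/-- f is 2π-periodic with modulus of continuity bounded by ω. -/
def MemH (ω f : ℝ → ℝ) : Prop :=
  Function.Periodic f (2 * π) ∧ ∀ x y : ℝ, |f x - f y| ≤ ω |x - y|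

/-- The principal value integral defining the conjugate function converges to L at x. -/
def ConjAt (f : ℝ → ℝ) (x L : ℝ) : Prop :=
  Tendsto (fun δ : ℝ =>
      -(1 / π) * ∫ t in {t : ℝ | δ ≤ |t - x| ∧ |t - x| ≤ π},
        f t / (2 * Real.tan ((t - x) / 2)))
    (nhdsWithin 0 (Ioi 0)) (nhds L)

/-- g is the trigonometric conjugate of f. -/
def ConjFn (f g : ℝ → ℝ) : Prop := ∀ x : ℝ, ConjAt f x (g x)

/-- f belongs to W^r H_ω. -/
def MemWrH (r : ℕ) (ω f : ℝ → ℝ) : Prop :=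
  Function.Periodic f (2 * π) ∧ ContDiff ℝ r f ∧
    ∀ x y : ℝ, |iteratedDeriv r f x - iteratedDeriv r f y| ≤ ω |x - y|

namespace ConjClass

/-- Green's function of `-d²/dt²` on `[0, π]` with Dirichlet boundary conditions. -/
def greenKer (t s : ℝ) : ℝ := min t s - t * s / π

/-- The solution `u` of `-u'' = S` on `[0, π]` with `u 0 = u π = 0`. -/
def green (S : ℝ → ℝ) (t : ℝ) : ℝ := ∫ s in Ioo 0 π, greenKer t s * S s

/-- Positive continuous kernels on `(0, π)` with at most a first order singularity at `0`. -/
structure IsKer (S : ℝ → ℝ) : Prop where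
  cont : ContinuousOn S (Ioo 0 π)
  pos : ∀ t ∈ Ioo 0 π, 0 < S t
  int : IntegrableOn (fun t => t * S t) (Ioo 0 π)

lemma continuous_greenKer : Continuous (fun p : ℝ × ℝ => greenKer p.1 p.2) := by
  unfold greenKer; fun_prop

lemma greenKer_comm (t s : ℝ) : greenKer t s = greenKer s t := by
  unfold greenKer; rw [min_comm, mul_comm]

lemma greenKer_of_le {t s : ℝ} (h : t ≤ s) : greenKer t s = t * (π - s) / π := by
  unfold greenKer; rw [min_eq_left h]; field_simp

lemma greenKer_of_ge {t s : ℝ} (h : s ≤ t) : greenKer t s = s * (π - t) / π := by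
  rw [greenKer_comm, greenKer_of_le h]

lemma greenKer_nonneg {t s : ℝ} (ht : t ∈ Icc 0 π) (hs : s ∈ Icc 0 π) : 0 ≤ greenKer t s := by
  rcases le_total t s with h | h
  · rw [greenKer_of_le h]
    exact div_nonneg (mul_nonneg ht.1 (by linarith [hs.2])) pi_pos.le
  · rw [greenKer_of_ge h]
    exact div_nonneg (mul_nonneg hs.1 (by linarith [ht.2])) pi_pos.le

lemma greenKer_pos {t s : ℝ} (ht : t ∈ Ioo 0 π) (hs : s ∈ Ioo 0 π) : 0 < greenKer t s := by
  rcases le_total t s with h | h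
  · rw [greenKer_of_le h]
    exact div_pos (mul_pos ht.1 (by linarith [hs.2])) pi_pos
  · rw [greenKer_of_ge h]
    exact div_pos (mul_pos hs.1 (by linarith [ht.2])) pi_pos

lemma greenKer_le {t s : ℝ} (ht : 0 ≤ t) (hs : 0 ≤ s) : greenKer t s ≤ s := by
  unfold greenKer
  have : 0 ≤ t * s / π := by positivity
  linarith [min_le_right t s]

lemma abs_greenKer_le {t s : ℝ} (ht : t ∈ Icc 0 π) (hs : s ∈ Icc 0 π) : |greenKer t s| ≤ s := by
  rw [abs_of_nonneg (greenKer_nonneg ht hs)]; exact greenKer_le ht.1 hs.1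

lemma greenKer_reflect (t s : ℝ) : greenKer (π - t) (π - s) = greenKer t s := by
  rcases le_total t s with h | h
  · rw [greenKer_of_le h, greenKer_of_ge (by linarith)]; ring
  · rw [greenKer_of_ge h, greenKer_of_le (by linarith)]; ring

lemma IsKer.aesm {S : ℝ → ℝ} (hS : IsKer S) :
    AEStronglyMeasurable S (volume.restrict (Ioo 0 π)) :=
  hS.cont.aestronglyMeasurable measurableSet_Ioo

lemma IsKer.integrable_mul {S q : ℝ → ℝ} (hS : IsKer S)
    (hq : AEStronglyMeasurable q (volume.restrict (Ioo 0 π))) (C : ℝ)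
    (hb : ∀ s ∈ Ioo 0 π, |q s| ≤ C * s) : IntegrableOn (fun s => q s * S s) (Ioo 0 π) := by
  refine Integrable.mono' (hS.int.const_mul C) (hq.mul hS.aesm) ?_
  filter_upwards [ae_restrict_mem measurableSet_Ioo] with s hs
  rw [Real.norm_eq_abs, abs_mul, abs_of_pos (hS.pos s hs), ← mul_assoc]
  exact mul_le_mul_of_nonneg_right (hb s hs) (hS.pos s hs).le

lemma IsKer.integrable_greenKer {S : ℝ → ℝ} (hS : IsKer S) {t : ℝ} (ht : t ∈ Icc 0 π) :
    IntegrableOn (fun s => greenKer t s * S s) (Ioo 0 π) := by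
  refine hS.integrable_mul (Continuous.aestronglyMeasurable (by unfold greenKer; fun_prop)) 1 ?_
  intro s hs
  rw [one_mul]; exact abs_greenKer_le ht (Ioo_subset_Icc_self hs)

lemma IsKer.green_nonneg {S : ℝ → ℝ} (hS : IsKer S) {t : ℝ} (ht : t ∈ Icc 0 π) :
    0 ≤ green S t :=
  setIntegral_nonneg measurableSet_Ioo fun s hs =>
    mul_nonneg (greenKer_nonneg ht (Ioo_subset_Icc_self hs)) (hS.pos s hs).le

lemma IsKer.green_pos {S : ℝ → ℝ} (hS : IsKer S) {t : ℝ} (ht : t ∈ Ioo 0 π) :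
    0 < green S t := by
  unfold green
  rw [← integral_Ioc_eq_integral_Ioo, ← intervalIntegral.integral_of_le pi_pos.le]
  refine intervalIntegral.intervalIntegral_pos_of_pos_on ?_ ?_ pi_pos
  · rw [intervalIntegrable_iff_integrableOn_Ioo_of_le pi_pos.le]
    exact hS.integrable_greenKer (Ioo_subset_Icc_self ht)
  · intro s hs
    exact mul_pos (greenKer_pos ht hs) (hS.pos s hs)

lemma IsKer.continuousOn_green {S : ℝ → ℝ} (hS : IsKer S) : ContinuousOn (green S) (Icc 0 π) := by
  unfold green
  refine continuousOn_of_dominated (bound := fun s => s * S s) ?_ ?_ hS.int ?_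
  · intro t ht; exact (hS.integrable_greenKer ht).aestronglyMeasurable
  · intro t ht
    filter_upwards [ae_restrict_mem measurableSet_Ioo] with s hs
    rw [Real.norm_eq_abs, abs_mul, abs_of_pos (hS.pos s hs)]
    exact mul_le_mul_of_nonneg_right (abs_greenKer_le ht (Ioo_subset_Icc_self hs)) (hS.pos s hs).le
  · refine Eventually.of_forall fun s => Continuous.continuousOn ?_
    unfold greenKer; fun_prop

lemma IsKer.concaveOn_green {S : ℝ → ℝ} (hS : IsKer S) : ConcaveOn ℝ (Icc 0 π) (green S) := by
  refine ⟨convex_Icc _ _, fun x hx y hy a b ha hb hab => ?_⟩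
  have hz : a • x + b • y ∈ Icc 0 π := (convex_Icc _ _) hx hy ha hb hab
  unfold green
  rw [smul_eq_mul, smul_eq_mul, ← integral_const_mul, ← integral_const_mul, ← integral_add
    ((hS.integrable_greenKer hx).const_mul a) ((hS.integrable_greenKer hy).const_mul b)]
  refine setIntegral_mono_on (((hS.integrable_greenKer hx).const_mul a).add
    ((hS.integrable_greenKer hy).const_mul b)) (hS.integrable_greenKer hz) measurableSet_Ioo ?_
  intro s hs
  have h1 : a * greenKer x s + b * greenKer y s ≤ greenKer (a • x + b • y) s := by
    unfold greenKer
    simp only [smul_eq_mul]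
    have : a * min x s + b * min y s ≤ min (a * x + b * y) s := by
      refine le_min ?_ ?_
      · gcongr <;> exact min_le_left _ _
      · calc _ ≤ a * s + b * s := by gcongr <;> exact min_le_right _ _
          _ = s := by rw [← add_mul, hab, one_mul]
    have e : (a * x + b * y) * s / π = a * (x * s / π) + b * (y * s / π) := by ring
    rw [e]; linarith
  have := mul_le_mul_of_nonneg_right h1 (hS.pos s hs).le
  linarith

lemma IsKer.green {S : ℝ → ℝ} (hS : IsKer S) : IsKer (green S) where
  cont := hS.continuousOn_green.mono Ioo_subset_Icc_self
  pos _ ht := hS.green_pos ht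
  int := ((continuousOn_id.mul hS.continuousOn_green).integrableOn_Icc).mono_set Ioo_subset_Icc_self

lemma IsKer.integral_green_mul {S w : ℝ → ℝ} (hS : IsKer S) (hw : IntegrableOn w (Ioo 0 π)) :
    ∫ t in Ioo 0 π, ConjClass.green S t * w t =
      ∫ s in Ioo 0 π, S s * ∫ t in Ioo 0 π, greenKer t s * w t := by
  have hInt : Integrable (fun p : ℝ × ℝ => greenKer p.1 p.2 * S p.2 * w p.1)
      ((volume.restrict (Ioo 0 π)).prod (volume.restrict (Ioo 0 π))) := by
    refine Integrable.mono' (hw.norm.mul_prod hS.int) ?_ ?_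
    · exact (continuous_greenKer.aestronglyMeasurable.mul hS.aesm.comp_snd).mul
        hw.aestronglyMeasurable.comp_fst
    · rw [Measure.prod_restrict]
      filter_upwards [ae_restrict_mem (measurableSet_Ioo.prod measurableSet_Ioo)] with p hp
      have h1 := abs_greenKer_le (Ioo_subset_Icc_self hp.1) (Ioo_subset_Icc_self hp.2)
      have h2 := hS.pos _ hp.2
      rw [Real.norm_eq_abs, abs_mul, abs_mul, abs_of_pos h2, mul_comm, Real.norm_eq_abs]
      gcongr
  calc _ = ∫ t in Ioo 0 π, ∫ s in Ioo 0 π, greenKer t s * S s * w t := by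
        congr 1; ext t; rw [integral_mul_const]; rfl
    _ = ∫ s in Ioo 0 π, ∫ t in Ioo 0 π, greenKer t s * S s * w t := integral_integral_swap hInt
    _ = _ := by
        congr 1; ext s; rw [← integral_const_mul]; congr 1; ext t; ring

lemma integral_greenKer_mul_deriv2 {D D' D'' : ℝ → ℝ} (h1 : ∀ t, HasDerivAt D (D' t) t)
    (h2 : ∀ t, HasDerivAt D' (D'' t) t) (hc : Continuous D'') (h0 : D 0 = 0) (hpi : D π = 0)
    {s : ℝ} (hs : s ∈ Icc 0 π) : ∫ t in Ioo 0 π, greenKer t s * D'' t = - D s := by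
  have hc' : Continuous D' := continuous_iff_continuousAt.2 fun t => (h2 t).continuousAt
  rw [← integral_Ioc_eq_integral_Ioo, ← intervalIntegral.integral_of_le pi_pos.le]
  have hci : ∀ a b, IntervalIntegrable (fun t => greenKer t s * D'' t) volume a b := fun a b =>
    Continuous.intervalIntegrable (by unfold greenKer; fun_prop) _ _
  rw [← intervalIntegral.integral_add_adjacent_intervals (hci 0 s) (hci s π)]
  have e1 : ∫ t in (0:ℝ)..s, greenKer t s * D'' t = (π - s) / π * ∫ t in (0:ℝ)..s, t * D'' t := by
    rw [← intervalIntegral.integral_const_mul]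
    refine intervalIntegral.integral_congr fun t ht => ?_
    rw [uIcc_of_le hs.1] at ht
    simp only [greenKer_of_le ht.2]; ring
  have e2 : ∫ t in s..π, greenKer t s * D'' t = s / π * ∫ t in s..π, (π - t) * D'' t := by
    rw [← intervalIntegral.integral_const_mul]
    refine intervalIntegral.integral_congr fun t ht => ?_
    rw [uIcc_of_le hs.2] at ht
    simp only [greenKer_of_ge ht.1]; ring
  have i1 := intervalIntegral.integral_mul_deriv_eq_deriv_mul (a := 0) (b := s)
    (u := fun t => t) (v := D') (u' := fun _ => 1) (v' := D'') (fun t _ => hasDerivAt_id t)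
    (fun t _ => h2 t) (by simp) (hc.intervalIntegrable _ _)
  have i2 := intervalIntegral.integral_mul_deriv_eq_deriv_mul (a := s) (b := π)
    (u := fun t => π - t) (v := D') (u' := fun _ => -1) (v' := D'')
    (fun t _ => by simpa using (hasDerivAt_id t).const_sub π)
    (fun t _ => h2 t) (by simp) (hc.intervalIntegrable _ _)
  have j1 := intervalIntegral.integral_eq_sub_of_hasDerivAt (a := 0) (b := s) (fun t _ => h1 t)
    (hc'.intervalIntegrable _ _)
  have j2 := intervalIntegral.integral_eq_sub_of_hasDerivAt (a := s) (b := π) (fun t _ => h1 t)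
    (hc'.intervalIntegrable _ _)
  simp only [one_mul, neg_mul, intervalIntegral.integral_neg] at i1 i2
  rw [e1, e2, i1, i2, j1, j2, h0, hpi]
  field_simp; ring

lemma IsKer.integral_green_mul_deriv2 {S : ℝ → ℝ} (hS : IsKer S) {D D' D'' : ℝ → ℝ}
    (h1 : ∀ t, HasDerivAt D (D' t) t)
    (h2 : ∀ t, HasDerivAt D' (D'' t) t) (hc : Continuous D'') (h0 : D 0 = 0) (hpi : D π = 0) :
    ∫ t in Ioo 0 π, ConjClass.green S t * D'' t = - ∫ t in Ioo 0 π, S t * D t := by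
  rw [hS.integral_green_mul ((hc.integrableOn_Icc).mono_set Ioo_subset_Icc_self), ← integral_neg]
  refine setIntegral_congr_fun measurableSet_Ioo fun s hs => ?_
  simp only [integral_greenKer_mul_deriv2 h1 h2 hc h0 hpi (Ioo_subset_Icc_self hs)]
  ring

/-- The conjugate-type singular integral with kernel `S`. -/
def conv (S χ : ℝ → ℝ) (x : ℝ) : ℝ := ∫ t in Ioo 0 π, S t * (χ (x + t) - χ (x - t))

/-- The conjugate kernel `½ cot (t / 2)`. -/
def cotKer (t : ℝ) : ℝ := 1 / (2 * tan (t / 2))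

lemma tan_half_pos {t : ℝ} (ht : t ∈ Ioo 0 π) : 0 < tan (t / 2) :=
  tan_pos_of_pos_of_lt_pi_div_two (by linarith [ht.1]) (by linarith [ht.2])

lemma isKer_cotKer : IsKer cotKer := by
  have hc : ContinuousOn cotKer (Ioo 0 π) := by
    unfold cotKer
    refine continuousOn_const.div (continuousOn_const.mul ?_) ?_
    · intro t ht
      have : cos (t / 2) ≠ 0 :=
        (cos_pos_of_mem_Ioo ⟨by linarith [ht.1, pi_pos], by linarith [ht.2]⟩).ne'
      exact (((continuousAt_tan.2 this).comp (f := fun t : ℝ => t / 2)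
        (by fun_prop))).continuousWithinAt
    · intro t ht
      have := tan_half_pos ht
      positivity
  refine ⟨hc, fun t ht => by have := tan_half_pos ht; unfold cotKer; positivity, ?_⟩
  refine Integrable.mono' (g := fun _ => (1 : ℝ)) (integrableOn_const (by simp))
    ((continuousOn_id.mul hc).aestronglyMeasurable measurableSet_Ioo) ?_
  filter_upwards [ae_restrict_mem measurableSet_Ioo] with t ht
  have h := tan_half_pos ht
  have h2 := lt_tan (x := t / 2) (by linarith [ht.1]) (by linarith [ht.2])
  simp only [cotKer]
  rw [Real.norm_eq_abs, abs_of_pos (by have := ht.1; positivity), mul_one_div,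
    div_le_one (by positivity)]
  linarith

lemma exists_bound_of_periodic {φ : ℝ → ℝ} (hc : Continuous φ) (hp : Function.Periodic φ (2 * π)) :
    ∃ C, 0 ≤ C ∧ ∀ x, |φ x| ≤ C := by
  obtain ⟨C, hC⟩ := (isCompact_Icc (a := 0) (b := 2 * π)).exists_bound_of_continuousOn
    hc.continuousOn
  refine ⟨C, (norm_nonneg _).trans (hC 0 ⟨le_rfl, two_pi_pos.le⟩), fun x => ?_⟩
  obtain ⟨y, hy, hxy⟩ := hp.exists_mem_Ico₀ two_pi_pos x
  rw [hxy]; exact hC y ⟨hy.1, hy.2.le⟩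

lemma exists_lipschitz_of_periodic {χ φ : ℝ → ℝ} (hd : ∀ x, HasDerivAt χ (φ x) x)
    (hc : Continuous φ) (hp : Function.Periodic φ (2 * π)) :
    ∃ C, 0 ≤ C ∧ ∀ x y, |χ x - χ y| ≤ C * |x - y| := by
  obtain ⟨C, h0, hC⟩ := exists_bound_of_periodic hc hp
  refine ⟨C, h0, fun x y => ?_⟩
  exact Convex.norm_image_sub_le_of_norm_hasDerivWithin_le (s := univ) (f := χ) (f' := φ)
    (fun z _ => (hd z).hasDerivWithinAt) (fun z _ => hC z) convex_univ (mem_univ y) (mem_univ x)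

lemma continuous_of_lip {χ : ℝ → ℝ} {C : ℝ} (hL : ∀ x y, |χ x - χ y| ≤ C * |x - y|) :
    Continuous χ := by
  have : LipschitzWith (Real.toNNReal C) χ := LipschitzWith.of_dist_le_mul fun x y => by
    rw [Real.dist_eq, Real.dist_eq]
    exact (hL x y).trans (mul_le_mul_of_nonneg_right (le_coe_toNNReal C) (abs_nonneg _))
  exact this.continuous

lemma abs_diff_le {χ : ℝ → ℝ} {C : ℝ} (hL : ∀ x y, |χ x - χ y| ≤ C * |x - y|) (x : ℝ) {t : ℝ}
    (ht : 0 ≤ t) : |χ (x + t) - χ (x - t)| ≤ 2 * C * t := by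
  refine (hL _ _).trans (le_of_eq ?_)
  rw [show x + t - (x - t) = 2 * t by ring, abs_of_nonneg (by positivity)]; ring

lemma IsKer.integrable_conv {S χ : ℝ → ℝ} (hS : IsKer S) {C : ℝ}
    (hL : ∀ x y, |χ x - χ y| ≤ C * |x - y|) (x : ℝ) :
    IntegrableOn (fun t => S t * (χ (x + t) - χ (x - t))) (Ioo 0 π) := by
  have hχ := continuous_of_lip hL
  have := hS.integrable_mul (q := fun t => χ (x + t) - χ (x - t))
    (Continuous.aestronglyMeasurable (by fun_prop)) (2 * C) (fun t ht => abs_diff_le hL x ht.1.le)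
  simpa only [mul_comm] using this

lemma IsKer.continuous_conv {S χ : ℝ → ℝ} (hS : IsKer S) {C : ℝ}
    (hL : ∀ x y, |χ x - χ y| ≤ C * |x - y|) : Continuous (conv S χ) := by
  have hχ := continuous_of_lip hL
  unfold conv
  refine continuous_of_dominated (bound := fun t => 2 * C * (t * S t)) ?_ ?_
    (hS.int.const_mul _) ?_
  · intro x; exact (hS.integrable_conv hL x).aestronglyMeasurable
  · intro x
    filter_upwards [ae_restrict_mem measurableSet_Ioo] with t ht
    rw [Real.norm_eq_abs, abs_mul, abs_of_pos (hS.pos t ht), mul_comm, ← mul_assoc]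
    exact mul_le_mul_of_nonneg_right (abs_diff_le hL x ht.1.le) (hS.pos t ht).le
  · exact Eventually.of_forall fun t => by fun_prop

lemma periodic_conv {S χ : ℝ → ℝ} (hp : Function.Periodic χ (2 * π)) :
    Function.Periodic (conv S χ) (2 * π) := by
  intro x
  unfold conv
  congr 1; ext t
  rw [show x + 2 * π + t = x + t + 2 * π by ring, show x + 2 * π - t = x - t + 2 * π by ring,
    hp, hp]

lemma IsKer.conv_eq_neg_conv_green {S ψ ψ' ψ'' : ℝ → ℝ} (hS : IsKer S)
    (hp : Function.Periodic ψ (2 * π)) (h1 : ∀ x, HasDerivAt ψ (ψ' x) x)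
    (h2 : ∀ x, HasDerivAt ψ' (ψ'' x) x) (hc : Continuous ψ'') (x : ℝ) :
    conv S ψ x = - conv (ConjClass.green S) ψ'' x := by
  have := hS.integral_green_mul_deriv2 (D := fun t => ψ (x + t) - ψ (x - t))
    (D' := fun t => ψ' (x + t) + ψ' (x - t)) (D'' := fun t => ψ'' (x + t) - ψ'' (x - t))
    (fun t => by
      have a := (h1 (x + t)).comp_const_add x t
      have b := (h1 (x - t)).comp_const_sub x t
      exact (a.sub b).congr_deriv (by ring))
    (fun t => by
      have a := (h2 (x + t)).comp_const_add x t
      have b := (h2 (x - t)).comp_const_sub x t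
      exact (a.add b).congr_deriv (by ring)) (by fun_prop) (by simp)
    (by rw [show x + π = x - π + 2 * π by ring, hp]; simp)
  unfold conv
  rw [this, neg_neg]

lemma IsKer.integral_mul_conv {S χ β : ℝ → ℝ} (hS : IsKer S) {C : ℝ}
    (hL : ∀ x y, |χ x - χ y| ≤ C * |x - y|) (hβ : Measurable β) {M : ℝ} (hM : ∀ x, |β x| ≤ M)
    (a b : ℝ) :
    ∫ x in Ioc a b, β x * conv S χ x =
      ∫ t in Ioo 0 π, S t * ∫ x in Ioc a b, β x * (χ (x + t) - χ (x - t)) := by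
  have hχ := continuous_of_lip hL
  have hM0 : 0 ≤ M := (abs_nonneg _).trans (hM 0)
  have hβi : IntegrableOn (fun _ : ℝ => M) (Ioc a b) := integrableOn_const (by simp)
  have hInt : Integrable (fun p : ℝ × ℝ => β p.1 * (S p.2 * (χ (p.1 + p.2) - χ (p.1 - p.2))))
      ((volume.restrict (Ioc a b)).prod (volume.restrict (Ioo 0 π))) := by
    refine Integrable.mono' ((hβi.mul_prod (hS.int.const_mul (2 * C)))) ?_ ?_
    · refine (hβ.comp measurable_fst).aestronglyMeasurable.mul (hS.aesm.comp_snd.mul ?_)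
      exact Continuous.aestronglyMeasurable (by fun_prop)
    · rw [Measure.prod_restrict]
      filter_upwards [ae_restrict_mem (measurableSet_Ioc.prod measurableSet_Ioo)] with p hp
      have h2 := hS.pos _ hp.2
      rw [Real.norm_eq_abs, abs_mul, abs_mul, abs_of_pos h2]
      have := abs_diff_le hL p.1 hp.2.1.le
      calc _ ≤ M * (S p.2 * (2 * C * p.2)) := by gcongr; exact hM _
        _ = _ := by ring
  calc _ = ∫ x in Ioc a b, ∫ t in Ioo 0 π, β x * (S t * (χ (x + t) - χ (x - t))) := by
        congr 1; ext x; rw [integral_const_mul]; rfl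
    _ = ∫ t in Ioo 0 π, ∫ x in Ioc a b, β x * (S t * (χ (x + t) - χ (x - t))) :=
        integral_integral_swap hInt
    _ = _ := by
        congr 1; ext s; rw [← integral_const_mul]; congr 1; ext t; ring

lemma integral_conj_eq {f : ℝ → ℝ} (hf : Continuous f) {x δ : ℝ} (h0 : 0 < δ) (hpi : δ < π) :
    ∫ t in {t : ℝ | δ ≤ |t - x| ∧ |t - x| ≤ π}, f t / (2 * Real.tan ((t - x) / 2)) =
      ∫ t in δ..π, cotKer t * (f (x + t) - f (x - t)) := by
  have hset : {u : ℝ | δ ≤ |u| ∧ |u| ≤ π} = Icc δ π ∪ Icc (-π) (-δ) := by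
    ext u
    simp only [mem_ofPred_eq, mem_union, mem_Icc, le_abs, abs_le]
    constructor
    · rintro ⟨h | h, h3, h4⟩
      · exact Or.inl ⟨h, h4⟩
      · exact Or.inr ⟨h3, by linarith⟩
    · rintro (⟨h, h'⟩ | ⟨h, h'⟩)
      · exact ⟨Or.inl h, by linarith, h'⟩
      · exact ⟨Or.inr (by linarith), h, by linarith⟩
  have hk : IntegrableOn cotKer (Icc δ π) := by
    rw [integrableOn_Icc_iff_integrableOn_Ioo]
    have := (isKer_cotKer.int.mono_set (Ioo_subset_Ioo_left h0.le : Ioo δ π ⊆ Ioo 0 π))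
    refine Integrable.mono' (this.const_mul (1 / δ))
      ((isKer_cotKer.cont.mono (Ioo_subset_Ioo_left h0.le)).aestronglyMeasurable
        measurableSet_Ioo) ?_
    filter_upwards [ae_restrict_mem measurableSet_Ioo] with t ht
    have hp := isKer_cotKer.pos t ⟨h0.trans ht.1, ht.2⟩
    rw [Real.norm_eq_abs, abs_of_pos hp, ← mul_assoc]
    refine le_mul_of_one_le_left hp.le ?_
    rw [one_div_mul_eq_div, one_le_div h0]; exact ht.1.le
  have hi1 : IntegrableOn (fun u => f (x + u) * cotKer u) (Icc δ π) := by
    exact hk.continuousOn_mul (by fun_prop) isCompact_Icc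
  have hi2 : IntegrableOn (fun u => f (x - u) * cotKer u) (Icc δ π) := by
    exact hk.continuousOn_mul (by fun_prop) isCompact_Icc
  have hodd : ∀ u, cotKer (-u) = - cotKer u := by
    intro u; unfold cotKer; rw [neg_div, tan_neg, mul_neg, div_neg]
  have hmp : MeasurePreserving (fun u : ℝ => -u) volume volume :=
    Measure.measurePreserving_neg volume
  have hme : MeasurableEmbedding (fun u : ℝ => -u) := (Homeomorph.neg ℝ).measurableEmbedding
  have hpre : (fun u : ℝ => -u) ⁻¹' (Icc (-π) (-δ)) = Icc δ π := by simp
  have e2 : ∫ u in Icc (-π) (-δ), f (x + u) * cotKer u =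
      - ∫ u in Icc δ π, f (x - u) * cotKer u := by
    rw [← hmp.setIntegral_preimage_emb hme (fun u => f (x + u) * cotKer u), hpre, ← integral_neg]
    congr 1; ext u; rw [hodd]; ring_nf
  have hi3 : IntegrableOn (fun u => f (x + u) * cotKer u) (Icc (-π) (-δ)) := by
    rw [← hmp.integrableOn_comp_preimage hme, hpre]
    refine hi2.neg.congr_fun ?_ measurableSet_Icc
    intro u _
    simp only [Function.comp, Pi.neg_apply, hodd]; ring_nf
  have e1 : ∫ t in {t : ℝ | δ ≤ |t - x| ∧ |t - x| ≤ π}, f t / (2 * Real.tan ((t - x) / 2)) =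
      ∫ u in {u : ℝ | δ ≤ |u| ∧ |u| ≤ π}, f (x + u) * cotKer u := by
    have hmp' : MeasurePreserving (fun u : ℝ => u - x) volume volume :=
      measurePreserving_sub_right volume x
    have hme' : MeasurableEmbedding (fun u : ℝ => u - x) :=
      (Homeomorph.subRight x).measurableEmbedding
    rw [← hmp'.setIntegral_preimage_emb hme' (fun u => f (x + u) * cotKer u)
      {u : ℝ | δ ≤ |u| ∧ |u| ≤ π}]
    refine integral_congr_ae (Eventually.of_forall fun t => ?_)
    simp only [cotKer]; rw [add_sub_cancel]; ring
  rw [e1, hset, setIntegral_union _ measurableSet_Icc hi1 hi3, e2, ← sub_eq_add_neg,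
    ← integral_sub hi1 hi2, integral_Icc_eq_integral_Ioc, ← intervalIntegral.integral_of_le hpi.le]
  · congr 1; ext u; ring
  · refine Set.disjoint_left.2 fun u h1 h2 => ?_
    linarith [h1.1, h2.2]

lemma conjAt_of_lip {f : ℝ → ℝ} {C : ℝ} (hL : ∀ x y, |f x - f y| ≤ C * |x - y|) (x : ℝ) :
    ConjAt f x (-(1 / π) * conv cotKer f x) := by
  unfold ConjAt
  refine Tendsto.const_mul _ ?_
  have hi := isKer_cotKer.integrable_conv hL x
  rw [← integrableOn_Icc_iff_integrableOn_Ioo] at hi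
  have hcont := intervalIntegral.continuousOn_primitive_interval_left
    (f := fun t => cotKer t * (f (x + t) - f (x - t))) (a := 0) (b := π) (μ := volume)
    (by rwa [uIcc_of_le pi_pos.le])
  have h0 := (hcont 0 (by simp)).mono_left
    (nhdsWithin_mono 0 (by rw [uIcc_of_le pi_pos.le]; exact Ioo_subset_Icc_self :
      Ioo 0 π ⊆ uIcc 0 π))
  have e : (nhdsWithin 0 (Ioo 0 π)) = nhdsWithin 0 (Ioi (0 : ℝ)) :=
    nhdsWithin_Ioo_eq_nhdsGT pi_pos
  have e0 : conv cotKer f x = ∫ t in (0:ℝ)..π, cotKer t * (f (x + t) - f (x - t)) := by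
    rw [intervalIntegral.integral_of_le pi_pos.le, integral_Ioc_eq_integral_Ioo]; rfl
  rw [e0, ← e]
  refine h0.congr' ?_
  filter_upwards [self_mem_nhdsWithin] with δ hδ
  exact (integral_conj_eq (continuous_of_lip hL) hδ.1 hδ.2).symm

lemma conjFn_eq {f g : ℝ → ℝ} {C : ℝ} (hL : ∀ x y, |f x - f y| ≤ C * |x - y|)
    (hg : ConjFn f g) (x : ℝ) : g x = -(1 / π) * conv cotKer f x :=
  tendsto_nhds_unique (hg x) (conjAt_of_lip hL x)

/-- The iterated kernels `∑ sin (k t) / k ^ (2 j)`. -/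
def ker (k : ℕ) : ℝ → ℝ := green^[k] cotKer

lemma ker_succ (k : ℕ) : ker (k + 1) = green (ker k) := Function.iterate_succ_apply' _ _ _

lemma isKer_ker (k : ℕ) : IsKer (ker k) := by
  induction k with
  | zero => exact isKer_cotKer
  | succ k ih => rw [ker_succ]; exact ih.green

lemma hasDerivAt_iteratedDeriv {f : ℝ → ℝ} {r n : ℕ} (hf : ContDiff ℝ r f) (h : n < r) (x : ℝ) :
    HasDerivAt (iteratedDeriv n f) (iteratedDeriv (n + 1) f x) x := by
  rw [iteratedDeriv_succ]
  exact ((hf.differentiable_iteratedDeriv n (by exact_mod_cast h)) x).hasDerivAt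

lemma periodic_iteratedDeriv {f : ℝ → ℝ} (hp : Function.Periodic f (2 * π)) (n : ℕ) :
    Function.Periodic (iteratedDeriv n f) (2 * π) := by
  intro x
  have := congrFun (iteratedDeriv_comp_add_const n f (2 * π)) x
  rw [← this]
  congr 1; ext y; exact hp y

lemma conv_cotKer_eq {f : ℝ → ℝ} {r : ℕ} (hf : ContDiff ℝ r f) (hp : Function.Periodic f (2 * π))
    (k : ℕ) (hk : 2 * k ≤ r) (x : ℝ) :
    conv cotKer f x = (-1) ^ k * conv (ker k) (iteratedDeriv (2 * k) f) x := by
  induction k with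
  | zero => simp [ker]
  | succ k ih =>
    rw [ih (by omega), (isKer_ker k).conv_eq_neg_conv_green (periodic_iteratedDeriv hp _)
      (hasDerivAt_iteratedDeriv hf (by omega)) (hasDerivAt_iteratedDeriv hf (by omega))
      (hf.continuous_iteratedDeriv _ (by exact_mod_cast (by omega : 2 * k + 1 + 1 ≤ r))) x,
      ← ker_succ, show 2 * (k + 1) = 2 * k + 1 + 1 by ring]
    ring

lemma tendsto_integral_cos_mul {g : ℝ → ℝ} (hg : Integrable g) :
    Tendsto (fun n : ℕ => ∫ s, g s * cos (2 * n * s)) atTop (nhds 0) := by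
  have h := Real.tendsto_integral_exp_smul_cocompact (fun s => (g s : ℂ))
  have hn : Tendsto (fun n : ℕ => (n : ℝ) / π) atTop (cocompact ℝ) :=
    (tendsto_natCast_atTop_atTop.atTop_div_const pi_pos).mono_right atTop_le_cocompact
  have h2 := (Complex.continuous_re.tendsto 0).comp (h.comp hn)
  rw [Complex.zero_re] at h2
  refine h2.congr fun n => ?_
  simp only [Function.comp]
  have hi : Integrable (fun v : ℝ => Real.fourierChar (-(v * ((n : ℝ) / π))) • (g v : ℂ)) := by
    have := (Real.fourierIntegral_convergent_iff (μ := volume) (f := fun s => (g s : ℂ))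
      ((n : ℝ) / π)).2 hg.ofReal
    simpa [mul_comm] using this
  have := integral_re hi
  simp only [RCLike.re_eq_complex_re] at this
  rw [← this]
  congr 1; ext s
  rw [Circle.smul_def, Real.fourierChar_apply, smul_eq_mul, mul_comm, Complex.re_ofReal_mul]
  congr 1
  rw [Complex.exp_ofReal_mul_I_re, show 2 * π * -(s * (n / π)) = -(2 * n * s) by field_simp, cos_neg]

lemma sum_sin_odd (s : ℝ) (n : ℕ) :
    2 * sin s * ∑ i ∈ Finset.range n, 2 * sin ((2 * i + 1) * s) = 2 - 2 * cos (2 * n * s) := by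
  induction n with
  | zero => simp
  | succ n ih =>
    rw [Finset.sum_range_succ, mul_add, ih]
    have h1 : cos (2 * n * s) - cos (2 * (n + 1 : ℕ) * s) =
        2 * sin s * sin ((2 * n + 1) * s) := by
      rw [cos_sub_cos]
      rw [show (2 * n * s + 2 * (n + 1 : ℕ) * s) / 2 = (2 * n + 1) * s by push_cast; ring,
        show (2 * n * s - 2 * (n + 1 : ℕ) * s) / 2 = -s by push_cast; ring, sin_neg]
      ring
    linarith

lemma cotKer_add_reflect {s : ℝ} (hs : s ∈ Ioo 0 π) : cotKer s + cotKer (π - s) = 1 / sin s := by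
  have h1 : 0 < sin (s / 2) := sin_pos_of_pos_of_lt_pi (by linarith [hs.1]) (by linarith [hs.2, pi_pos])
  have h2 : 0 < cos (s / 2) :=
    cos_pos_of_mem_Ioo ⟨by linarith [hs.1, pi_pos], by linarith [hs.2]⟩
  have e : sin s = 2 * sin (s / 2) * cos (s / 2) := by
    rw [← sin_two_mul]; ring_nf
  unfold cotKer
  rw [show (π - s) / 2 = π / 2 - s / 2 by ring, tan_pi_div_two_sub, tan_eq_sin_div_cos, e]
  field_simp
  linarith [sin_sq_add_cos_sq (s / 2)]

lemma integral_greenKer_mul_sin (t : ℝ) (ht : t ∈ Icc 0 π) (i : ℕ) :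
    ∫ s in Ioo 0 π, greenKer t s * sin ((2 * i + 1) * s) =
      sin ((2 * i + 1) * t) / (2 * i + 1) ^ 2 := by
  have hm : (0 : ℝ) < 2 * i + 1 := by positivity
  have := integral_greenKer_mul_deriv2 (D := fun s => - sin ((2 * i + 1) * s) / (2 * i + 1) ^ 2)
    (D' := fun s => - cos ((2 * i + 1) * s) / (2 * i + 1)) (D'' := fun s => sin ((2 * i + 1) * s))
    (fun s => by
      have := (((hasDerivAt_id s).const_mul (2 * (i : ℝ) + 1)).sin.neg).div_const
        ((2 * (i : ℝ) + 1) ^ 2)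
      refine this.congr_deriv ?_
      simp only [id]; field_simp)
    (fun s => by
      have := (((hasDerivAt_id s).const_mul (2 * (i : ℝ) + 1)).cos.neg).div_const
        ((2 * (i : ℝ) + 1))
      refine this.congr_deriv ?_
      simp only [id]; field_simp) (by fun_prop) (by simp)
    (by
      have : sin ((2 * i + 1) * π) = 0 := by
        have := sin_nat_mul_pi (2 * i + 1); push_cast at this; exact this
      rw [this]; simp) ht
  rw [← neg_neg (sin _ / _), ← neg_div, ← this]
  refine setIntegral_congr_fun measurableSet_Ioo fun s _ => ?_
  simp only [greenKer_comm]

lemma integral_reflect (g : ℝ → ℝ) : ∫ s in Ioo 0 π, g (π - s) = ∫ s in Ioo 0 π, g s := by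
  have hmp : MeasurePreserving (fun s : ℝ => π - s) volume volume :=
    Measure.measurePreserving_sub_left volume π
  have := hmp.setIntegral_preimage_emb (Homeomorph.subLeft π).measurableEmbedding g (Ioo 0 π)
  simpa using this

lemma integrableOn_reflect {g : ℝ → ℝ} (hg : IntegrableOn g (Ioo 0 π)) :
    IntegrableOn (fun s => g (π - s)) (Ioo 0 π) := by
  have hmp : MeasurePreserving (fun s : ℝ => π - s) volume volume :=
    Measure.measurePreserving_sub_left volume π
  have := (hmp.integrableOn_comp_preimage (Homeomorph.subLeft π).measurableEmbedding
    (f := g) (s := Ioo 0 π)).2 hg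
  simpa [Function.comp_def] using this

lemma green_reflect {S : ℝ → ℝ} (t : ℝ) :
    green S (π - t) = ∫ s in Ioo 0 π, greenKer t s * S (π - s) := by
  unfold green
  rw [← integral_reflect]
  simp only [greenKer_reflect]

lemma IsKer.integrable_reflect {S : ℝ → ℝ} (hS : IsKer S) {t : ℝ} (ht : t ∈ Icc 0 π) :
    IntegrableOn (fun s => greenKer t s * S (π - s)) (Ioo 0 π) := by
  have := integrableOn_reflect (hS.integrable_greenKer (t := π - t)
    ⟨by linarith [ht.2], by linarith [ht.1]⟩)
  simpa only [greenKer_reflect] using this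

lemma IsKer.green_add_reflect {S : ℝ → ℝ} (hS : IsKer S) {t : ℝ} (ht : t ∈ Icc 0 π) :
    ConjClass.green S t + ConjClass.green S (π - t) =
      ∫ s in Ioo 0 π, greenKer t s * (S s + S (π - s)) := by
  rw [green_reflect, ConjClass.green, ← integral_add (hS.integrable_greenKer ht)
    (hS.integrable_reflect ht)]
  simp only [mul_add]

lemma summable_inv_odd_pow {p : ℕ} (hp : 2 ≤ p) (C : ℝ) :
    Summable (fun i : ℕ => C / (2 * (i : ℝ) + 1) ^ p) := by
  have h : Summable (fun n : ℕ => 1 / (n : ℝ) ^ p) :=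
    Real.summable_one_div_nat_pow.2 (by omega)
  have h2 := (h.comp_injective (i := fun i : ℕ => 2 * i + 1) (fun a b h => by simpa using h)).mul_left C
  refine h2.congr fun i => ?_
  simp [div_eq_mul_inv]

lemma norm_sin_term_le (p i : ℕ) (c s : ℝ) (hc : |c| ≤ 2) :
    ‖c * sin ((2 * i + 1) * s) / (2 * (i : ℝ) + 1) ^ p‖ ≤ 2 / (2 * (i : ℝ) + 1) ^ p := by
  rw [norm_div, Real.norm_eq_abs, Real.norm_eq_abs, abs_mul,
    abs_of_nonneg (a := (2 * (i : ℝ) + 1) ^ p) (by positivity)]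
  gcongr
  have := abs_sin_le_one ((2 * i + 1) * s)
  nlinarith [abs_nonneg c]

lemma hasSum_ker_one {t : ℝ} (ht : t ∈ Icc 0 π) :
    HasSum (fun i : ℕ => 2 * sin ((2 * i + 1) * t) / (2 * (i : ℝ) + 1) ^ 2)
      (ker 1 t + ker 1 (π - t)) := by
  rw [hasSum_iff_tendsto_nat_of_summable_norm]
  swap
  · exact Summable.of_nonneg_of_le (fun _ => norm_nonneg _)
      (fun i => norm_sin_term_le 2 i 2 t (by norm_num)) (summable_inv_odd_pow le_rfl 2)
  have hk : ker 1 = green cotKer := rfl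
  have hInt : IntegrableOn (fun s => greenKer t s / sin s) (Ioo 0 π) := by
    refine (((isKer_cotKer.integrable_greenKer ht).add (isKer_cotKer.integrable_reflect ht))
      ).congr_fun ?_ measurableSet_Ioo
    intro s hs
    simp only [Pi.add_apply]
    rw [← mul_add, cotKer_add_reflect hs, mul_one_div]
  have hi2 : ∀ n : ℕ, IntegrableOn (fun s => greenKer t s / sin s * cos (2 * n * s)) (Ioo 0 π) := by
    intro n
    refine hInt.mul_bdd (c := 1) (Continuous.aestronglyMeasurable (by fun_prop))
      (Eventually.of_forall fun s => abs_cos_le_one _)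
  have hE : ker 1 t + ker 1 (π - t) = ∫ s in Ioo 0 π, greenKer t s / sin s := by
    rw [hk, isKer_cotKer.green_add_reflect ht]
    refine setIntegral_congr_fun measurableSet_Ioo fun s hs => ?_
    simp only [cotKer_add_reflect hs, mul_one_div]
  have hS : ∀ n : ℕ, ∑ i ∈ Finset.range n, 2 * sin ((2 * i + 1) * t) / (2 * (i : ℝ) + 1) ^ 2 =
      (ker 1 t + ker 1 (π - t)) - ∫ s, (Ioo 0 π).indicator (fun s => greenKer t s / sin s) s *
        cos (2 * n * s) := by
    intro n
    have e1 : (∫ s, (Ioo 0 π).indicator (fun s => greenKer t s / sin s) s * cos (2 * n * s)) =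
        ∫ s in Ioo 0 π, greenKer t s / sin s * cos (2 * n * s) := by
      rw [← integral_indicator measurableSet_Ioo]
      congr 1; ext s; by_cases h : s ∈ Ioo 0 π <;> simp [h]
    rw [e1, hE, ← integral_sub hInt (hi2 n)]
    have e2 : ∀ i ∈ Finset.range n, 2 * sin ((2 * i + 1) * t) / (2 * (i : ℝ) + 1) ^ 2 =
        ∫ s in Ioo 0 π, greenKer t s * (2 * sin ((2 * i + 1) * s)) := by
      intro i _
      rw [mul_div_assoc, ← integral_greenKer_mul_sin t ht, ← integral_const_mul]
      congr 1; ext s; ring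
    rw [Finset.sum_congr rfl e2, ← integral_finsetSum]
    · refine setIntegral_congr_fun measurableSet_Ioo fun s hs => ?_
      have hs0 := sin_pos_of_mem_Ioo hs
      have := sum_sin_odd s n
      rw [← Finset.mul_sum]
      rw [div_mul_eq_mul_div, ← sub_div, eq_div_iff hs0.ne']
      linear_combination (1 / 2) * greenKer t s * this
    · intro i _
      exact (Continuous.integrableOn_Icc (by unfold greenKer; fun_prop)).mono_set Ioo_subset_Icc_self
  simp only [hS]
  have := tendsto_integral_cos_mul ((integrable_indicator_iff measurableSet_Ioo).2 hInt)
  simpa using this.const_sub (ker 1 t + ker 1 (π - t))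

lemma hasSum_ker (k : ℕ) {t : ℝ} (ht : t ∈ Icc 0 π) :
    HasSum (fun i : ℕ => 2 * sin ((2 * i + 1) * t) / (2 * (i : ℝ) + 1) ^ (2 * (k + 1)))
      (ker (k + 1) t + ker (k + 1) (π - t)) := by
  induction k generalizing t with
  | zero => exact hasSum_ker_one ht
  | succ k ih =>
    rw [ker_succ (k + 1), (isKer_ker (k + 1)).green_add_reflect ht]
    have hb : ∀ i : ℕ, ∀ s ∈ Ioo (0:ℝ) π, ‖greenKer t s *
        (2 * sin ((2 * i + 1) * s) / (2 * (i : ℝ) + 1) ^ (2 * (k + 1)))‖ ≤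
        π * (2 / (2 * (i : ℝ) + 1) ^ (2 * (k + 1))) := by
      intro i s hs
      rw [norm_mul]
      have h1 := abs_greenKer_le ht (Ioo_subset_Icc_self hs)
      exact mul_le_mul (h1.trans hs.2.le) (norm_sin_term_le _ i 2 s (by norm_num))
        (norm_nonneg _) pi_pos.le
    have := hasSum_integral_of_dominated_convergence (μ := volume.restrict (Ioo 0 π))
      (F := fun (i : ℕ) s => greenKer t s *
        (2 * sin ((2 * i + 1) * s) / (2 * (i : ℝ) + 1) ^ (2 * (k + 1))))
      (f := fun s => greenKer t s * (ker (k + 1) s + ker (k + 1) (π - s)))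
      (fun i _ => π * (2 / (2 * (i : ℝ) + 1) ^ (2 * (k + 1))))
      (fun i => Continuous.aestronglyMeasurable (by unfold greenKer; fun_prop))
      (fun i => by
        filter_upwards [ae_restrict_mem measurableSet_Ioo] with s hs using hb i s hs)
      (Eventually.of_forall fun s => (summable_inv_odd_pow (by omega) 2).mul_left π)
      (integrableOn_const (by simp))
      (by
        filter_upwards [ae_restrict_mem measurableSet_Ioo] with s hs
        exact (ih (Ioo_subset_Icc_self hs)).mul_left _)
    refine this.congr_fun ?_
    intro i
    have e := integral_greenKer_mul_sin t ht i
    rw [show (fun s => greenKer t s *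
      (2 * sin ((2 * i + 1) * s) / (2 * (i : ℝ) + 1) ^ (2 * (k + 1)))) = fun s =>
      (2 / (2 * (i : ℝ) + 1) ^ (2 * (k + 1))) * (greenKer t s * sin ((2 * i + 1) * s)) by
        ext s; ring, integral_const_mul, e]
    field_simp
    ring

/-- The series in the odd case. -/
lemma tsum_odd {ω : ℝ → ℝ} (hω : Continuous ω) (k : ℕ) :
    4 * ∑' i : ℕ, (-1 : ℝ) ^ (i * ((2 * k + 1) + 1)) *
        ((2 / π) * ∫ t in (0:ℝ)..(π / 2), ω (2 * t) * sin ((2 * i + 1) * t)) /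
          (2 * (i : ℝ) + 1) ^ ((2 * k + 1) + 1) =
      (4 / π) * ∫ t in (0:ℝ)..(π / 2), ω (2 * t) * (ker (k + 1) t + ker (k + 1) (π - t)) := by
  obtain ⟨C, hC⟩ := (isCompact_Icc (a := (0:ℝ)) (b := π / 2)).exists_bound_of_continuousOn
    (f := fun t => ω (2 * t)) (by fun_prop)
  have hC0 : 0 ≤ C := (norm_nonneg _).trans (hC 0 ⟨le_rfl, by positivity⟩)
  have hs := intervalIntegral.hasSum_integral_of_dominated_convergence (μ := volume) (a := 0)
    (b := π / 2)
    (F := fun (i : ℕ) t => ω (2 * t) * (2 * sin ((2 * i + 1) * t) /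
      (2 * (i : ℝ) + 1) ^ (2 * (k + 1))))
    (f := fun t => ω (2 * t) * (ker (k + 1) t + ker (k + 1) (π - t)))
    (fun i _ => C * (2 / (2 * (i : ℝ) + 1) ^ (2 * (k + 1))))
    (fun i => Continuous.aestronglyMeasurable (by fun_prop))
    (fun i => Eventually.of_forall fun t ht => by
      rw [uIoc_of_le (by positivity)] at ht
      rw [norm_mul]
      exact mul_le_mul (hC t (Ioc_subset_Icc_self ht)) (norm_sin_term_le _ i 2 t (by norm_num))
        (norm_nonneg _) hC0)
    (Eventually.of_forall fun t _ => (summable_inv_odd_pow (by omega) 2).mul_left C)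
    (by simp)
    (Eventually.of_forall fun t ht => by
      rw [uIoc_of_le (by positivity)] at ht
      exact (hasSum_ker k ⟨ht.1.le, by linarith [ht.2, pi_pos]⟩).mul_left _)
  rw [← hs.tsum_eq, ← tsum_mul_left, ← tsum_mul_left]
  congr 1; ext i
  have e : ((-1 : ℝ)) ^ (i * ((2 * k + 1) + 1)) = 1 :=
    Even.neg_one_pow (by rw [show 2 * k + 1 + 1 = 2 * (k + 1) by ring]; exact (even_two_mul _).mul_left _)
  rw [e, show (fun t => ω (2 * t) * (2 * sin ((2 * i + 1) * t) /
      (2 * (i : ℝ) + 1) ^ (2 * (k + 1)))) = fun t => (2 / (2 * (i : ℝ) + 1) ^ (2 * (k + 1))) *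
      (ω (2 * t) * sin ((2 * i + 1) * t)) by ext t; ring, intervalIntegral.integral_const_mul,
    show 2 * k + 1 + 1 = 2 * (k + 1) by ring]
  ring

lemma hasSum_integral_ker (k : ℕ) {t : ℝ} (ht : t ∈ Icc 0 (π / 2)) :
    HasSum (fun i : ℕ => (2 * (-1) ^ i) * sin ((2 * i + 1) * t) / (2 * (i : ℝ) + 1) ^ (2 * k + 3))
      (∫ s in (π / 2 - t)..(π / 2 + t), ker (k + 1) s) := by
  have hle : π / 2 - t ≤ π / 2 + t := by linarith [ht.1]
  have hsub : uIcc (π / 2 - t) (π / 2 + t) ⊆ Icc 0 π := by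
    rw [uIcc_of_le hle]; exact Icc_subset_Icc (by linarith [ht.2]) (by linarith [ht.2])
  have hcont : ContinuousOn (ker (k + 1)) (Icc 0 π) := by
    rw [ker_succ]; exact (isKer_ker k).continuousOn_green
  have hi : IntervalIntegrable (ker (k + 1)) volume (π / 2 - t) (π / 2 + t) :=
    (hcont.mono hsub).intervalIntegrable
  have hrefl : ∫ s in (π / 2 - t)..(π / 2 + t), ker (k + 1) (π - s) =
      ∫ s in (π / 2 - t)..(π / 2 + t), ker (k + 1) s := by
    rw [intervalIntegral.integral_comp_sub_left]; congr 1 <;> ring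
  have hi2 : IntervalIntegrable (fun s => ker (k + 1) (π - s)) volume (π / 2 - t) (π / 2 + t) := by
    have := (hi.symm.comp_sub_left π)
    convert this using 1 <;> ring
  have e : ∫ s in (π / 2 - t)..(π / 2 + t), ker (k + 1) s =
      ∫ s in (π / 2 - t)..(π / 2 + t), (1 / 2) * (ker (k + 1) s + ker (k + 1) (π - s)) := by
    rw [intervalIntegral.integral_const_mul, intervalIntegral.integral_add hi hi2, hrefl]; ring
  rw [e]
  have hs := intervalIntegral.hasSum_integral_of_dominated_convergence (μ := volume)
    (a := π / 2 - t) (b := π / 2 + t)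
    (F := fun (i : ℕ) s => (1 / 2) * (2 * sin ((2 * i + 1) * s) /
      (2 * (i : ℝ) + 1) ^ (2 * (k + 1))))
    (f := fun s => (1 / 2) * (ker (k + 1) s + ker (k + 1) (π - s)))
    (fun i _ => (1 / 2) * (2 / (2 * (i : ℝ) + 1) ^ (2 * (k + 1))))
    (fun i => Continuous.aestronglyMeasurable (by fun_prop))
    (fun i => Eventually.of_forall fun s _ => by
      rw [norm_mul]
      exact mul_le_mul (by norm_num) (norm_sin_term_le _ i 2 s (by norm_num))
        (norm_nonneg _) (by norm_num))
    (Eventually.of_forall fun t _ => (summable_inv_odd_pow (by omega) 2).mul_left _)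
    (by simp)
    (Eventually.of_forall fun s hs => by
      exact (hasSum_ker k (hsub (uIoc_subset_uIcc hs))).mul_left _)
  refine hs.congr_fun fun i => ?_
  have hm : (2 * (i : ℝ) + 1) ≠ 0 := by positivity
  rw [show (fun s => (1 / 2) * (2 * sin ((2 * i + 1) * s) /
      (2 * (i : ℝ) + 1) ^ (2 * (k + 1)))) = fun s => (1 / (2 * (i : ℝ) + 1) ^ (2 * (k + 1))) *
      sin ((2 * i + 1) * s) by ext s; ring, intervalIntegral.integral_const_mul,
    intervalIntegral.integral_comp_mul_left _ hm, integral_sin, cos_sub_cos,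
    show ((2 * (i:ℝ) + 1) * (π / 2 - t) + (2 * i + 1) * (π / 2 + t)) / 2 = i * π + π / 2 by ring,
    show ((2 * (i:ℝ) + 1) * (π / 2 - t) - (2 * i + 1) * (π / 2 + t)) / 2 = - ((2 * i + 1) * t) by
      ring, sin_neg, sin_add_pi_div_two, cos_nat_mul_pi, smul_eq_mul]
  field_simp
  ring

/-- The series in the even case. -/
lemma tsum_even {ω : ℝ → ℝ} (hω : Continuous ω) (k : ℕ) :
    4 * ∑' i : ℕ, (-1 : ℝ) ^ (i * ((2 * k + 2) + 1)) *
        ((2 / π) * ∫ t in (0:ℝ)..(π / 2), ω (2 * t) * sin ((2 * i + 1) * t)) /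
          (2 * (i : ℝ) + 1) ^ ((2 * k + 2) + 1) =
      (4 / π) * ∫ t in (0:ℝ)..(π / 2), ω (2 * t) *
        ∫ s in (π / 2 - t)..(π / 2 + t), ker (k + 1) s := by
  obtain ⟨C, hC⟩ := (isCompact_Icc (a := (0:ℝ)) (b := π / 2)).exists_bound_of_continuousOn
    (f := fun t => ω (2 * t)) (by fun_prop)
  have hC0 : 0 ≤ C := (norm_nonneg _).trans (hC 0 ⟨le_rfl, by positivity⟩)
  have hs := intervalIntegral.hasSum_integral_of_dominated_convergence (μ := volume) (a := 0)
    (b := π / 2)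
    (F := fun (i : ℕ) t => ω (2 * t) * ((2 * (-1) ^ i) * sin ((2 * i + 1) * t) /
      (2 * (i : ℝ) + 1) ^ (2 * k + 3)))
    (f := fun t => ω (2 * t) * ∫ s in (π / 2 - t)..(π / 2 + t), ker (k + 1) s)
    (fun i _ => C * (2 / (2 * (i : ℝ) + 1) ^ (2 * k + 3)))
    (fun i => Continuous.aestronglyMeasurable (by fun_prop))
    (fun i => Eventually.of_forall fun t ht => by
      rw [uIoc_of_le (by positivity)] at ht
      rw [norm_mul]
      exact mul_le_mul (hC t (Ioc_subset_Icc_self ht))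
        (norm_sin_term_le _ i (2 * (-1) ^ i) t (by simp [abs_mul])) (norm_nonneg _) hC0)
    (Eventually.of_forall fun t _ => (summable_inv_odd_pow (by omega) 2).mul_left C)
    (by simp)
    (Eventually.of_forall fun t ht => by
      rw [uIoc_of_le (by positivity)] at ht
      exact (hasSum_integral_ker k (Ioc_subset_Icc_self ht)).mul_left _)
  rw [← hs.tsum_eq, ← tsum_mul_left, ← tsum_mul_left]
  congr 1; ext i
  have e : ((-1 : ℝ)) ^ (i * ((2 * k + 2) + 1)) = (-1) ^ i := by
    rw [mul_comm, pow_mul, Odd.neg_one_pow ⟨k + 1, by ring⟩]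
  rw [e, show (fun t => ω (2 * t) * ((2 * (-1) ^ i) * sin ((2 * i + 1) * t) /
      (2 * (i : ℝ) + 1) ^ (2 * k + 3))) = fun t => ((2 * (-1) ^ i) / (2 * (i : ℝ) + 1) ^ (2 * k + 3)) *
      (ω (2 * t) * sin ((2 * i + 1) * t)) by ext t; ring, intervalIntegral.integral_const_mul,
    show 2 * k + 2 + 1 = 2 * k + 3 by ring]
  ring

lemma integral_period {g : ℝ → ℝ} (hg : Function.Periodic g (2 * π)) (a : ℝ) :
    ∫ x in Ioc 0 (2 * π), g x = ∫ x in a..(a + 2 * π), g x := by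
  rw [hg.intervalIntegral_add_eq a 0, zero_add, intervalIntegral.integral_of_le two_pi_pos.le]

lemma integrableOn_of_abs_le {g : ℝ → ℝ} (hg : Measurable g) {C : ℝ} (hC : ∀ x, |g x| ≤ C)
    {s : Set ℝ} (hs : volume s < ⊤) : IntegrableOn g s :=
  Measure.integrableOn_of_bounded hs.ne hg.aestronglyMeasurable (Eventually.of_forall hC)

lemma intervalIntegrable_of_abs_le {g : ℝ → ℝ} (hg : Measurable g) {C : ℝ} (hC : ∀ x, |g x| ≤ C)
    (a b : ℝ) : IntervalIntegrable g volume a b :=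
  ⟨integrableOn_of_abs_le hg hC (by simp), integrableOn_of_abs_le hg hC (by simp)⟩

lemma exists_last_le {e : ℝ → ℝ} (he : Continuous e) {θ a p : ℝ} (hap : a ≤ p) (ha : e a ≤ θ) :
    ∃ α ∈ Icc a p, e α ≤ θ ∧ ∀ q ∈ Icc a p, e q ≤ θ → q ≤ α := by
  have hK : IsCompact (Icc a p ∩ {q | e q ≤ θ}) :=
    isCompact_Icc.inter_right (isClosed_le he continuous_const)
  obtain ⟨α, ⟨h1, h2⟩, h3⟩ := hK.exists_isGreatest ⟨a, ⟨le_rfl, hap⟩, ha⟩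
  exact ⟨α, h1, h2, fun q hq hq2 => h3 ⟨hq, hq2⟩⟩

lemma exists_first_le {e : ℝ → ℝ} (he : Continuous e) {θ a p : ℝ} (hap : p ≤ a) (ha : e a ≤ θ) :
    ∃ α ∈ Icc p a, e α ≤ θ ∧ ∀ q ∈ Icc p a, e q ≤ θ → α ≤ q := by
  have hK : IsCompact (Icc p a ∩ {q | e q ≤ θ}) :=
    isCompact_Icc.inter_right (isClosed_le he continuous_const)
  obtain ⟨α, ⟨h1, h2⟩, h3⟩ := hK.exists_isLeast ⟨a, ⟨hap, le_rfl⟩, ha⟩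
  exact ⟨α, h1, h2, fun q hq hq2 => h3 ⟨hq, hq2⟩⟩

/-- The hump of a `1`-Lipschitz periodic function above a level `θ` has small area. -/
lemma integral_hump_le {e : ℝ → ℝ} (hL : ∀ x y, |e x - e y| ≤ |x - y|)
    (hp : Function.Periodic e (2 * π)) {θ a p : ℝ} (ha : e a ≤ θ) (hM : ∀ x, e x ≤ e p)
    (hθ : θ ≤ e p) :
    ∫ x in Ioc 0 (2 * π), max (e x - θ) 0 ≤
      (e p - θ) * volume.real ({x | θ < e x} ∩ Ioc 0 (2 * π)) - (e p - θ) ^ 2 := by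
  have he : Continuous e := continuous_of_lip (C := 1) (by simpa using hL)
  obtain ⟨p', hp', hpe⟩ := hp.exists_mem_Ico two_pi_pos p a
  rw [hpe] at hM hθ ⊢
  set y := e p' - θ with hy
  have hy0 : 0 ≤ y := by linarith
  obtain ⟨C, hC0, hC⟩ := exists_bound_of_periodic he hp
  have hms : MeasurableSet {x | θ < e x} := measurableSet_lt measurable_const he.measurable
  set g : ℝ → ℝ := {x | θ < e x}.indicator (fun x => e p' - e x) with hg
  have hgm : Measurable g := (measurable_const.sub he.measurable).indicator hms
  have hgp : Function.Periodic g (2 * π) := by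
    intro x; simp only [hg, indicator, mem_ofPred_eq, hp x]
  have hg0 : ∀ x, 0 ≤ g x := fun x => indicator_nonneg (fun x _ => by linarith [hM x]) x
  have hgC : ∀ x, |g x| ≤ C + C := by
    intro x
    rw [abs_of_nonneg (hg0 x)]
    refine indicator_apply_le' (fun _ => ?_) (fun _ => by linarith)
    linarith [le_abs_self (e p'), neg_abs_le (e x), hC p', hC x]
  have hgi := intervalIntegrable_of_abs_le hgm hgC
  have key : y ^ 2 ≤ ∫ x in Ioc 0 (2 * π), g x := by
    rw [integral_period hgp a]
    obtain ⟨α, hα, hαθ, hαm⟩ := exists_last_le he hp'.1 ha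
    obtain ⟨α', hα', hαθ', hαm'⟩ := exists_first_le he (θ := θ) (a := a + 2 * π) (p := p') hp'.2.le
      (by rwa [hp a])
    have h1 : α + y ≤ p' := by
      have := (le_abs_self _).trans (hL p' α)
      rw [abs_of_nonneg (by linarith [hα.2])] at this
      linarith
    have h2 : p' ≤ α' - y := by
      have := (le_abs_self _).trans (hL p' α')
      rw [abs_of_nonpos (by linarith [hα'.1])] at this
      linarith
    have i1 : ∫ x in α..(α + y), (α + y - x) ≤ ∫ x in α..(α + y), g x := by
      refine intervalIntegral.integral_mono_on_of_le_Ioo (by linarith)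
        (Continuous.intervalIntegrable (by fun_prop) _ _) (hgi _ _) fun q hq => ?_
      have hqθ : θ < e q := by
        by_contra! h
        linarith [hαm q ⟨by linarith [hα.1, hq.1], by linarith [hq.2]⟩ h, hq.1]
      rw [hg, indicator_of_mem (show q ∈ {x | θ < e x} from hqθ)]
      have := (le_abs_self _).trans (hL q α)
      rw [abs_of_nonneg (by linarith [hq.1])] at this
      linarith
    have i2 : ∫ x in (α' - y)..α', (x - (α' - y)) ≤ ∫ x in (α' - y)..α', g x := by
      refine intervalIntegral.integral_mono_on_of_le_Ioo (by linarith)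
        (Continuous.intervalIntegrable (by fun_prop) _ _) (hgi _ _) fun q hq => ?_
      have hqθ : θ < e q := by
        by_contra! h
        linarith [hαm' q ⟨by linarith [hq.1], by linarith [hq.2, hα'.2]⟩ h, hq.2]
      rw [hg, indicator_of_mem (show q ∈ {x | θ < e x} from hqθ)]
      have := (le_abs_self _).trans (hL q α')
      rw [abs_of_nonpos (by linarith [hq.2])] at this
      linarith
    have c1 : ∫ x in α..(α + y), (α + y - x) = y ^ 2 / 2 := by
      rw [intervalIntegral.integral_comp_sub_left (fun x => x)]; simp
    have c2 : ∫ x in (α' - y)..α', (x - (α' - y)) = y ^ 2 / 2 := by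
      rw [intervalIntegral.integral_comp_sub_right (fun x => x)]; simp
    have n1 : 0 ≤ ∫ x in a..α, g x := intervalIntegral.integral_nonneg hα.1 fun x _ => hg0 x
    have n2 : 0 ≤ ∫ x in (α + y)..(α' - y), g x :=
      intervalIntegral.integral_nonneg (by linarith) fun x _ => hg0 x
    have n3 : 0 ≤ ∫ x in α'..(a + 2 * π), g x :=
      intervalIntegral.integral_nonneg hα'.2 fun x _ => hg0 x
    rw [← intervalIntegral.integral_add_adjacent_intervals (hgi a α) (hgi α _),
      ← intervalIntegral.integral_add_adjacent_intervals (hgi α (α + y)) (hgi (α + y) _),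
      ← intervalIntegral.integral_add_adjacent_intervals (hgi (α + y) (α' - y)) (hgi (α' - y) _),
      ← intervalIntegral.integral_add_adjacent_intervals (hgi (α' - y) α') (hgi α' _)]
    linarith
  have hind : IntegrableOn ({x | θ < e x}.indicator (fun _ => y)) (Ioc 0 (2 * π)) :=
    (integrableOn_const measure_Ioc_lt_top.ne).indicator hms
  have hsplit : ∫ x in Ioc 0 (2 * π), max (e x - θ) 0 =
      (∫ x in Ioc 0 (2 * π), {x | θ < e x}.indicator (fun _ => y) x) -
        ∫ x in Ioc 0 (2 * π), g x := by
    rw [← integral_sub hind (integrableOn_of_abs_le hgm hgC measure_Ioc_lt_top)]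
    congr 1; ext x
    by_cases h : θ < e x
    · rw [hg, indicator_of_mem (show x ∈ {x | θ < e x} from h),
        indicator_of_mem (show x ∈ {x | θ < e x} from h), max_eq_left (by linarith)]
      ring
    · rw [hg, indicator_of_notMem (show x ∉ {x | θ < e x} from h),
        indicator_of_notMem (show x ∉ {x | θ < e x} from h), max_eq_right (by linarith)]
      ring
  rw [hsplit, setIntegral_indicator hms, setIntegral_const, smul_eq_mul, inter_comm]
  linarith

/-- Sliding integrals over windows of half-length `t`. -/
def slide (β : ℝ → ℝ) (t y : ℝ) : ℝ := ∫ x in (y - t)..(y + t), β x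

/-- Measurable periodic functions with values in `[0, 1]` and integral `2 b` over a period. -/
structure IsDensity (β : ℝ → ℝ) (b : ℝ) : Prop where
  meas : Measurable β
  nonneg : ∀ x, 0 ≤ β x
  le_one : ∀ x, β x ≤ 1
  per : Function.Periodic β (2 * π)
  mass : ∫ x in Ioc 0 (2 * π), β x = 2 * b

namespace IsDensity

variable {β : ℝ → ℝ} {b : ℝ}

lemma abs_le (h : IsDensity β b) (x : ℝ) : |β x| ≤ 1 := by rw [abs_of_nonneg (h.nonneg x)]; exact h.le_one x

lemma intervalIntegrable (h : IsDensity β b) (a c : ℝ) : IntervalIntegrable β volume a c :=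
  intervalIntegrable_of_abs_le h.meas h.abs_le a c

lemma integral_nonneg (h : IsDensity β b) {a c : ℝ} (hac : a ≤ c) : 0 ≤ ∫ x in a..c, β x :=
  intervalIntegral.integral_nonneg hac fun x _ => h.nonneg x

lemma integral_le (h : IsDensity β b) {a c : ℝ} (hac : a ≤ c) : ∫ x in a..c, β x ≤ c - a := by
  have := intervalIntegral.integral_mono_on hac (h.intervalIntegrable a c)
    (intervalIntegrable_const (c := (1 : ℝ))) fun x _ => h.le_one x
  simpa using this

lemma compl (h : IsDensity β b) : IsDensity (fun x => 1 - β x) (π - b) where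
  meas := measurable_const.sub h.meas
  nonneg x := by linarith [h.le_one x]
  le_one x := by linarith [h.nonneg x]
  per x := by simp only [h.per x]
  mass := by
    have hc : IntegrableOn (fun _ : ℝ => (1 : ℝ)) (Ioc 0 (2 * π)) :=
      integrableOn_const measure_Ioc_lt_top.ne
    rw [integral_sub hc (integrableOn_of_abs_le h.meas h.abs_le measure_Ioc_lt_top), h.mass]
    simp [two_pi_pos.le]; ring

lemma slide_compl (h : IsDensity β b) (t y : ℝ) : slide (fun x => 1 - β x) t y = 2 * t - slide β t y := by
  unfold slide
  rw [intervalIntegral.integral_sub intervalIntegrable_const (h.intervalIntegrable _ _)]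
  simp; ring

lemma mass_nonneg (h : IsDensity β b) : 0 ≤ b := by
  have := setIntegral_nonneg (μ := volume) (measurableSet_Ioc (a := 0) (b := 2 * π))
    fun x _ => h.nonneg x
  rw [h.mass] at this; linarith

lemma mass_le (h : IsDensity β b) : b ≤ π := by linarith [h.compl.mass_nonneg]

lemma slide_nonneg (h : IsDensity β b) {t : ℝ} (ht : 0 ≤ t) (y : ℝ) : 0 ≤ slide β t y :=
  h.integral_nonneg (by linarith)

lemma slide_le (h : IsDensity β b) {t : ℝ} (ht : 0 ≤ t) (y : ℝ) : slide β t y ≤ 2 * t :=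
  (h.integral_le (by linarith)).trans (by linarith)

lemma slide_le_mass (h : IsDensity β b) {t : ℝ} (ht : t ≤ π) (y : ℝ) : slide β t y ≤ 2 * b := by
  unfold slide
  rw [← h.mass, integral_period h.per (y - t),
    ← intervalIntegral.integral_add_adjacent_intervals (h.intervalIntegrable (y - t) (y + t))
      (h.intervalIntegrable (y + t) (y - t + 2 * π))]
  linarith [h.integral_nonneg (show y + t ≤ y - t + 2 * π by linarith)]

lemma le_slide (h : IsDensity β b) {t : ℝ} (ht : t ≤ π) (y : ℝ) : 2 * b + 2 * t - 2 * π ≤ slide β t y := by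
  have := h.compl.slide_le_mass ht y
  rw [h.slide_compl] at this
  linarith

lemma slide_periodic (h : IsDensity β b) (t : ℝ) : Function.Periodic (slide β t) (2 * π) := by
  intro y
  unfold slide
  rw [show y + 2 * π - t = y - t + 2 * π by ring, show y + 2 * π + t = y + t + 2 * π by ring,
    ← intervalIntegral.integral_comp_add_right]
  simp only [h.per _]

lemma slide_lip (h : IsDensity β b) (t x y : ℝ) : |slide β t x - slide β t y| ≤ |x - y| := by
  wlog hxy : y ≤ x generalizing x y
  · rw [abs_sub_comm, abs_sub_comm x]; exact this y x (le_of_not_ge hxy)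
  have e : slide β t x - slide β t y =
      (∫ u in (y + t)..(x + t), β u) - ∫ u in (y - t)..(x - t), β u := by
    unfold slide
    rw [intervalIntegral.integral_interval_sub_interval_comm' (h.intervalIntegrable _ _)
      (h.intervalIntegrable _ _) (h.intervalIntegrable _ _)]
  rw [e, abs_of_nonneg (sub_nonneg.2 hxy), _root_.abs_le]
  have h1 := h.integral_nonneg (show y + t ≤ x + t by linarith)
  have h2 := h.integral_nonneg (show y - t ≤ x - t by linarith)
  have h3 := h.integral_le (show y + t ≤ x + t by linarith)
  have h4 := h.integral_le (show y - t ≤ x - t by linarith)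
  constructor <;> linarith

lemma continuous_slide (h : IsDensity β b) (t : ℝ) : Continuous (slide β t) :=
  continuous_of_lip (C := 1) (by simpa using h.slide_lip t)

end IsDensity

/-- Fubini for sliding integrals. -/
lemma integral_mul_slide {φ β : ℝ → ℝ} {M C : ℝ} (hφ : Measurable φ) (hφC : ∀ x, |φ x| ≤ C)
    (hφp : Function.Periodic φ (2 * π)) (hβ : Measurable β)
    (hβM : ∀ x, |β x| ≤ M) (hβp : Function.Periodic β (2 * π)) {t : ℝ} (ht : 0 ≤ t) :
    ∫ x in Ioc 0 (2 * π), φ x * slide β t x = ∫ x in Ioc 0 (2 * π), slide φ t x * β x := by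
  have hM0 : 0 ≤ M := (abs_nonneg _).trans (hβM 0)
  have hC0 : 0 ≤ C := (abs_nonneg _).trans (hφC 0)
  have e1 : ∀ ψ : ℝ → ℝ, ∀ x, slide ψ t x = ∫ s in Ioc (-t) t, ψ (x + s) := by
    intro ψ x
    unfold slide
    rw [← intervalIntegral.integral_of_le (by linarith), intervalIntegral.integral_comp_add_left]
    rfl
  have e2 : ∀ ψ : ℝ → ℝ, ∀ x, slide ψ t x = ∫ s in Ioc (-t) t, ψ (x - s) := by
    intro ψ x
    unfold slide
    rw [← intervalIntegral.integral_of_le (by linarith), intervalIntegral.integral_comp_sub_left]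
    simp
  have hi1 : Integrable (fun p : ℝ × ℝ => φ p.1 * β (p.1 + p.2))
      ((volume.restrict (Ioc 0 (2 * π))).prod (volume.restrict (Ioc (-t) t))) := by
    refine Integrable.of_bound (C := C * M) ?_ (Eventually.of_forall fun p => ?_)
    · exact Measurable.aestronglyMeasurable (by fun_prop)
    · rw [norm_mul]; exact mul_le_mul (hφC _) (hβM _) (norm_nonneg _) hC0
  have hi2 : Integrable (fun p : ℝ × ℝ => φ (p.1 - p.2) * β p.1)
      ((volume.restrict (Ioc 0 (2 * π))).prod (volume.restrict (Ioc (-t) t))) := by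
    refine Integrable.of_bound (C := C * M) ?_ (Eventually.of_forall fun p => ?_)
    · exact Measurable.aestronglyMeasurable (by fun_prop)
    · rw [norm_mul]; exact mul_le_mul (hφC _) (hβM _) (norm_nonneg _) hC0
  calc _ = ∫ x in Ioc 0 (2 * π), ∫ s in Ioc (-t) t, φ x * β (x + s) := by
        congr 1; ext x; rw [e1, integral_const_mul]
    _ = ∫ s in Ioc (-t) t, ∫ x in Ioc 0 (2 * π), φ x * β (x + s) := integral_integral_swap hi1
    _ = ∫ s in Ioc (-t) t, ∫ x in Ioc 0 (2 * π), φ (x - s) * β x := by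
        congr 1; ext s
        have hper : Function.Periodic (fun x => φ (x - s) * β x) (2 * π) := by
          intro x
          simp only
          rw [show x + 2 * π - s = x - s + 2 * π by ring, hφp, hβp]
        rw [integral_period hper s, ← intervalIntegral.integral_of_le two_pi_pos.le]
        have := intervalIntegral.integral_comp_add_right (a := 0) (b := 2 * π)
          (fun x => φ (x - s) * β x) s
        simp only [add_sub_cancel_right] at this
        rw [this]; congr 1 <;> ring
    _ = ∫ x in Ioc 0 (2 * π), ∫ s in Ioc (-t) t, φ (x - s) * β x :=
        (integral_integral_swap hi2).symm
    _ = _ := by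
        congr 1; ext x; rw [e2, integral_mul_const]

lemma IsDensity.integral_slide {β : ℝ → ℝ} {b : ℝ} (h : IsDensity β b) {t : ℝ} (ht : 0 ≤ t) :
    ∫ x in Ioc 0 (2 * π), slide β t x = 4 * t * b := by
  have := integral_mul_slide (φ := fun _ => 1) (C := 1) measurable_const (by simp)
    (fun _ => rfl) h.meas h.abs_le h.per ht
  simp only [one_mul] at this
  rw [this]
  have e : ∀ x, slide (fun _ => (1 : ℝ)) t x = 2 * t := by intro x; simp [slide]; ring
  simp only [e]
  rw [integral_const_mul, h.mass]; ring

/-- The lengths `s` that form a spherical triangle with sides `x` and `b`. -/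
def tri (x b : ℝ) : Set ℝ := Ioo |x - b| (min (x + b) (2 * π - x - b))

lemma tri_subset (x b : ℝ) : tri x b ⊆ Ioo 0 π := by
  rintro s ⟨h1, h2⟩
  rw [lt_min_iff] at h2
  exact ⟨(abs_nonneg _).trans_lt h1, by linarith⟩

lemma measurableSet_tri (x b : ℝ) : MeasurableSet (tri x b) := measurableSet_Ioo

lemma tri_reflect (x b : ℝ) : tri (π - x) (π - b) = tri x b := by
  unfold tri
  rw [show π - x - (π - b) = -(x - b) by ring, abs_neg,
    show π - x + (π - b) = 2 * π - x - b by ring,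
    show 2 * π - (π - x) - (π - b) = x + b by ring, min_comm]

/-- The Green potential of a spherical triangle. -/
def triGreen (x b t : ℝ) : ℝ := 2 * ∫ s in tri x b, greenKer s t

/-- Normalized integral of `κ` over a spherical triangle. -/
def triInt (κ : ℝ → ℝ) (x b : ℝ) : ℝ := (2 / π) * ∫ s in tri x b, κ s

lemma IsKer.integral_mul_triGreen {S : ℝ → ℝ} (hS : IsKer S) (x b : ℝ) :
    (1 / π) * ∫ t in Ioo 0 π, S t * triGreen x b t = triInt (ConjClass.green S) x b := by
  have h := hS.integral_green_mul (w := (tri x b).indicator fun _ => 1)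
    ((integrableOn_const (by simp)).indicator (measurableSet_tri x b))
  have e1 : ∀ f : ℝ → ℝ, ∫ t in Ioo 0 π, f t * (tri x b).indicator (fun _ => 1) t =
      ∫ t in tri x b, f t := by
    intro f
    have : ∀ t, f t * (tri x b).indicator (fun _ => (1:ℝ)) t = (tri x b).indicator f t := by
      intro t; by_cases ht : t ∈ tri x b <;> simp [ht]
    simp only [this]
    rw [setIntegral_indicator (measurableSet_tri x b), inter_eq_self_of_subset_right (tri_subset x b)]
  rw [e1] at h
  simp only [e1] at h
  unfold triInt triGreen
  rw [h, ← integral_const_mul, ← integral_const_mul]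
  congr 1; ext t; ring

lemma integral_greenKer_Ioo {p T t : ℝ} (hpT : p ≤ T) :
    ∫ s in Ioo p T, greenKer s t = (∫ s in p..T, min s t) - t / π * ((T ^ 2 - p ^ 2) / 2) := by
  rw [← integral_Ioc_eq_integral_Ioo, ← intervalIntegral.integral_of_le hpT]
  unfold greenKer
  rw [intervalIntegral.integral_sub (Continuous.intervalIntegrable (by fun_prop) _ _)
    (Continuous.intervalIntegrable (by fun_prop) _ _), ← integral_id,
    ← intervalIntegral.integral_const_mul]
  congr 2; ext s; ring

lemma integral_min_of_le {p T t : ℝ} (hpT : p ≤ T) (h : t ≤ p) :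
    ∫ s in p..T, min s t = t * (T - p) := by
  rw [intervalIntegral.integral_congr (g := fun _ => t)]
  · simp; ring
  · intro s hs
    rw [uIcc_of_le hpT] at hs
    exact min_eq_right (h.trans hs.1)

lemma integral_min_of_ge {p T t : ℝ} (hpT : p ≤ T) (h : T ≤ t) :
    ∫ s in p..T, min s t = (T ^ 2 - p ^ 2) / 2 := by
  rw [← integral_id]
  refine intervalIntegral.integral_congr fun s hs => ?_
  rw [uIcc_of_le hpT] at hs
  exact min_eq_left (hs.2.trans h)

lemma integral_min {p T t : ℝ} (h1 : p ≤ t) (h2 : t ≤ T) :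
    ∫ s in p..T, min s t = (t ^ 2 - p ^ 2) / 2 + t * (T - t) := by
  rw [← intervalIntegral.integral_add_adjacent_intervals (b := t)
    (Continuous.intervalIntegrable (by fun_prop) _ _)
    (Continuous.intervalIntegrable (by fun_prop) _ _), integral_min_of_ge h1 le_rfl,
    integral_min_of_le h2 le_rfl]

lemma abs_sub_le_add {x b : ℝ} (hx : 0 ≤ x) (hb : 0 ≤ b) : |x - b| ≤ x + b := by
  rw [abs_le]; constructor <;> linarith

lemma integral_pos_part_slide_le {β : ℝ → ℝ} {b x t θ : ℝ} (h : IsDensity β b) (hx0 : 0 ≤ x)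
    (hxb : x + b ≤ π) (ht0 : 0 ≤ t) (htp : t ≤ π) (h1 : |x - b| ≤ t) (h2 : t ≤ x + b)
    (hθ : θ = b + t - x) :
    ∫ y in Ioc 0 (2 * π), max (slide β t y - θ) 0 ≤ x ^ 2 - (t - b) ^ 2 := by
  have hb0 := h.mass_nonneg
  rw [abs_le] at h1
  have habs : |t - b| ≤ x := abs_le.2 ⟨by linarith, by linarith⟩
  have hn : 0 ≤ x ^ 2 - (t - b) ^ 2 := by
    rw [← sq_abs (t - b)]; nlinarith [abs_nonneg (t - b)]
  set e := slide β t with he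
  have hec : Continuous e := h.continuous_slide t
  have hep : Function.Periodic e (2 * π) := h.slide_periodic t
  have heL : ∀ u v, |e u - e v| ≤ |u - v| := h.slide_lip t
  obtain ⟨pM, -, hpM⟩ := (isCompact_Icc (a := 0) (b := 2 * π)).exists_isMaxOn
    ⟨0, le_rfl, two_pi_pos.le⟩ hec.continuousOn
  obtain ⟨pm, -, hpm⟩ := (isCompact_Icc (a := 0) (b := 2 * π)).exists_isMinOn
    ⟨0, le_rfl, two_pi_pos.le⟩ hec.continuousOn
  have hM : ∀ y, e y ≤ e pM := by
    intro y
    obtain ⟨z, hz, hyz⟩ := hep.exists_mem_Ico₀ two_pi_pos y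
    rw [hyz]; exact hpM (Ico_subset_Icc_self hz)
  have hm : ∀ y, e pm ≤ e y := by
    intro y
    obtain ⟨z, hz, hyz⟩ := hep.exists_mem_Ico₀ two_pi_pos y
    rw [hyz]; exact hpm (Ico_subset_Icc_self hz)
  by_cases hθM : e pM ≤ θ
  · have : ∀ y, max (e y - θ) 0 = 0 := fun y => max_eq_right (by linarith [hM y])
    simp only [this]; simpa using hn
  push Not at hθM
  set D := volume.real ({y | θ < e y} ∩ Ioc 0 (2 * π)) with hD
  have hms : MeasurableSet {y | θ < e y} := measurableSet_lt measurable_const hec.measurable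
  have hInt : ∀ f : ℝ → ℝ, Continuous f → IntegrableOn f (Ioc 0 (2 * π)) := fun f hf =>
    (hf.integrableOn_Icc).mono_set Ioc_subset_Icc_self
  by_cases hDx : D ≤ 2 * x ∧ e pm ≤ θ
  · have key := integral_hump_le heL hep hDx.2 hM hθM.le
    rw [← hD] at key
    have hy : e pM - θ ≤ x - |t - b| := by
      have c1 := h.slide_le ht0 pM
      have c2 := h.slide_le_mass htp pM
      rw [← he] at c1 c2
      rcases abs_cases (t - b) with ⟨h, _⟩ | ⟨h, _⟩ <;> rw [h] <;> linarith
    have hy0 : 0 < e pM - θ := by linarith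
    rw [← sq_abs (t - b)]
    nlinarith [abs_nonneg (t - b), mul_le_mul_of_nonneg_left hDx.1 hy0.le]
  · have hmean : ∫ y in Ioc 0 (2 * π), (e y - θ) = 4 * t * b - 2 * π * θ := by
      rw [integral_sub (hInt _ hec) (hInt _ continuous_const), he, h.integral_slide ht0]
      simp [two_pi_pos.le]
    have hsplit : ∫ y in Ioc 0 (2 * π), max (e y - θ) 0 =
        (∫ y in Ioc 0 (2 * π), (e y - θ)) + ∫ y in Ioc 0 (2 * π), max (-e y - -θ) 0 := by
      rw [← integral_add (hInt _ (by fun_prop)) (hInt _ (by fun_prop))]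
      congr 1; ext y
      rcases le_total (e y) θ with h | h
      · rw [max_eq_right (by linarith), max_eq_left (by linarith)]; ring
      · rw [max_eq_left (by linarith), max_eq_right (by linarith)]; ring
    have hX : |π - t - b| ≤ π - x := abs_le.2 ⟨by linarith, by linarith⟩
    have hn' : 0 ≤ (π - x) ^ 2 - (π - t - b) ^ 2 := by
      rw [← sq_abs (π - t - b)]; nlinarith [abs_nonneg (π - t - b)]
    have hneg : ∫ y in Ioc 0 (2 * π), max (-e y - -θ) 0 ≤ (π - x) ^ 2 - (π - t - b) ^ 2 := by
      by_cases hmθ : θ < e pm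
      · have : ∀ y, max (-e y - -θ) 0 = 0 := fun y => max_eq_right (by linarith [hm y])
        simp only [this]; simpa using hn'
      push Not at hmθ
      have hD2 : 2 * x < D := by
        by_contra! hc; exact hDx ⟨hc, hmθ⟩
      have key := integral_hump_le (e := fun y => -e y) (θ := -θ) (a := pM) (p := pm)
        (fun u v => by rw [neg_sub_neg, abs_sub_comm]; exact heL u v)
        (fun u => by simp only [hep u]) (by linarith) (fun u => by linarith [hm u]) (by linarith)
      have hD' : volume.real ({y | -θ < -e y} ∩ Ioc 0 (2 * π)) ≤ 2 * (π - x) := by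
        have hsum : D + volume.real ({y | -θ < -e y} ∩ Ioc 0 (2 * π)) ≤ 2 * π := by
          have hfin : ∀ s : Set ℝ, volume (s ∩ Ioc 0 (2 * π)) ≠ ⊤ := fun s =>
            ((measure_mono inter_subset_right).trans_lt measure_Ioc_lt_top).ne
          rw [hD, ← measureReal_union _ _ (hfin _) (hfin _)]
          · refine (measureReal_mono (s₂ := Ioc 0 (2 * π)) (union_subset inter_subset_right
              inter_subset_right) measure_Ioc_lt_top.ne).trans ?_
            rw [Real.volume_real_Ioc_of_le two_pi_pos.le]; linarith
          · refine Set.disjoint_left.2 fun y hy1 hy2 => ?_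
            have a1 : θ < e y := hy1.1
            have a2 : -θ < -e y := hy2.1
            linarith
          · exact (measurableSet_lt measurable_const hec.measurable.neg).inter measurableSet_Ioc
        linarith
      have hy : -e pm - -θ ≤ π - x - |π - t - b| := by
        have c1 := h.slide_nonneg ht0 pm
        have c2 := h.le_slide htp pm
        rw [← he] at c1 c2
        rcases abs_cases (π - t - b) with ⟨h, _⟩ | ⟨h, _⟩ <;> rw [h] <;> linarith
      have hy0 : 0 ≤ -e pm - -θ := by linarith
      refine key.trans ?_
      rw [← sq_abs (π - t - b)]
      nlinarith [abs_nonneg (π - t - b), mul_le_mul_of_nonneg_left hD' hy0]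
    rw [hsplit, hmean]
    subst hθ
    nlinarith

lemma setIntegral_slide_le_aux {β : ℝ → ℝ} {b x t : ℝ} (h : IsDensity β b) {E : Set ℝ}
    (hEx : volume.real (E ∩ Ioc 0 (2 * π)) = 2 * x) (hxb : x + b ≤ π)
    (ht0 : 0 ≤ t) (htp : t ≤ π) :
    ∫ y in E ∩ Ioc 0 (2 * π), slide β t y ≤ triGreen x b t + 4 * t * b * x / π := by
  have hb0 := h.mass_nonneg
  have hx0 : 0 ≤ x := by linarith [measureReal_nonneg (μ := volume) (s := E ∩ Ioc 0 (2 * π))]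
  have hec : Continuous (slide β t) := h.continuous_slide t
  have hInt : ∀ f : ℝ → ℝ, Continuous f → IntegrableOn f (Ioc 0 (2 * π)) := fun f hf =>
    (hf.integrableOn_Icc).mono_set Ioc_subset_Icc_self
  have hintE : ∀ f : ℝ → ℝ, Continuous f → IntegrableOn f (E ∩ Ioc 0 (2 * π)) := fun f hf =>
    (hInt f hf).mono_set inter_subset_right
  have hconst : ∀ c : ℝ, ∫ y in E ∩ Ioc 0 (2 * π), c = 2 * x * c := by
    intro c; rw [setIntegral_const, hEx, smul_eq_mul]
  have hle : ∀ c : ℝ, (∀ y, slide β t y ≤ c) → ∫ y in E ∩ Ioc 0 (2 * π), slide β t y ≤ 2 * x * c := by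
    intro c hc
    rw [← hconst]
    exact setIntegral_mono (hintE _ hec) (hintE _ continuous_const) hc
  have hpT := abs_sub_le_add hx0 hb0
  have hR : triGreen x b t + 4 * t * b * x / π = 2 * ∫ s in |x - b|..(x + b), min s t := by
    unfold triGreen tri
    rw [min_eq_left (by linarith), integral_greenKer_Ioo hpT, sq_abs]
    field_simp; ring
  rw [hR]
  rcases le_total t |x - b| with h1 | h1
  · rw [integral_min_of_le hpT h1]
    have c1 := hle _ (h.slide_le ht0)
    have c2 : ∫ y in E ∩ Ioc 0 (2 * π), slide β t y ≤ 4 * t * b := by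
      rw [← h.integral_slide ht0]
      exact setIntegral_mono_set (hInt _ hec)
        (Eventually.of_forall fun y => h.slide_nonneg ht0 y)
        (Eventually.of_forall inter_subset_right)
    rcases abs_cases (x - b) with ⟨h, _⟩ | ⟨h, _⟩ <;> rw [h] <;> nlinarith
  rcases le_total (x + b) t with h2 | h2
  · rw [integral_min_of_ge hpT h2, sq_abs]
    have := hle _ (h.slide_le_mass htp)
    nlinarith
  rw [integral_min h1 h2, sq_abs]
  have key := integral_pos_part_slide_le h hx0 hxb ht0 htp h1 h2 rfl
  have c1 : ∫ y in E ∩ Ioc 0 (2 * π), slide β t y ≤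
      (∫ y in E ∩ Ioc 0 (2 * π), (b + t - x)) +
        ∫ y in E ∩ Ioc 0 (2 * π), max (slide β t y - (b + t - x)) 0 := by
    rw [← integral_add (hintE _ continuous_const) (hintE _ (by fun_prop))]
    refine setIntegral_mono (hintE _ hec) (hintE _ (by fun_prop)) fun y => ?_
    linarith [le_max_left (slide β t y - (b + t - x)) 0]
  have c2 : ∫ y in E ∩ Ioc 0 (2 * π), max (slide β t y - (b + t - x)) 0 ≤
      ∫ y in Ioc 0 (2 * π), max (slide β t y - (b + t - x)) 0 :=
    setIntegral_mono_set (hInt _ (by fun_prop))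
        (Eventually.of_forall fun y => le_max_right _ _)
        (Eventually.of_forall inter_subset_right)
  rw [hconst] at c1
  nlinarith

/-- Rearrangement inequality for sliding integrals of densities over sets of given measure. -/
lemma setIntegral_slide_le {β : ℝ → ℝ} {b x t : ℝ} (h : IsDensity β b) {E : Set ℝ}
    (hE : MeasurableSet E) (hEx : volume.real (E ∩ Ioc 0 (2 * π)) = 2 * x)
    (ht0 : 0 ≤ t) (htp : t ≤ π) :
    ∫ y in E ∩ Ioc 0 (2 * π), slide β t y ≤ triGreen x b t + 4 * t * b * x / π := by
  rcases le_total (x + b) π with hxb | hxb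
  · exact setIntegral_slide_le_aux h hEx hxb ht0 htp
  have hec : Continuous (slide β t) := h.continuous_slide t
  have hInt : IntegrableOn (slide β t) (Ioc 0 (2 * π)) :=
    (hec.integrableOn_Icc).mono_set Ioc_subset_Icc_self
  have hfin : ∀ s : Set ℝ, volume (s ∩ Ioc 0 (2 * π)) ≠ ⊤ := fun s =>
    ((measure_mono inter_subset_right).trans_lt measure_Ioc_lt_top).ne
  have hEc : volume.real (Eᶜ ∩ Ioc 0 (2 * π)) = 2 * (π - x) := by
    have := measureReal_inter_add_sdiff (μ := volume) (s := Ioc 0 (2 * π)) (t := E) hE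
      measure_Ioc_lt_top.ne
    rw [inter_comm, hEx, Real.volume_real_Ioc_of_le two_pi_pos.le, sdiff_eq, inter_comm] at this
    linarith
  have key := setIntegral_slide_le_aux h.compl hEc (by linarith) ht0 htp
  simp only [h.slide_compl] at key
  have hc : IntegrableOn (fun _ : ℝ => 2 * t) (Eᶜ ∩ Ioc 0 (2 * π)) := integrableOn_const (hfin _)
  rw [integral_sub hc (hInt.mono_set inter_subset_right),
    setIntegral_const, hEc, smul_eq_mul] at key
  have hadd : (∫ y in E ∩ Ioc 0 (2 * π), slide β t y) + ∫ y in Eᶜ ∩ Ioc 0 (2 * π), slide β t y =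
      4 * t * b := by
    rw [← h.integral_slide ht0, ← integral_inter_add_sdiff hE hInt, sdiff_eq, inter_comm E,
      inter_comm Eᶜ]
  have e : triGreen (π - x) (π - b) t = triGreen x b t := by unfold triGreen; rw [tri_reflect]
  rw [e] at key
  have e2 : 4 * t * (π - b) * (π - x) / π = 4 * t * (π - b) - 4 * t * x + 4 * t * b * x / π := by
    field_simp; ring
  rw [e2] at key
  linarith

lemma measureReal_period {s : Set ℝ} (hm : MeasurableSet s) (hs : ∀ x, x + 2 * π ∈ s ↔ x ∈ s)
    (a : ℝ) : volume.real (s ∩ Ioc 0 (2 * π)) = volume.real (s ∩ Ioc a (a + 2 * π)) := by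
  have h := integral_period (g := s.indicator fun _ => (1 : ℝ))
    (fun x => by by_cases h : x ∈ s <;> simp [h, hs]) a
  rw [intervalIntegral.integral_of_le (by linarith [two_pi_pos]), setIntegral_indicator hm,
    setIntegral_indicator hm, setIntegral_const, setIntegral_const] at h
  simpa [inter_comm] using h

/-- Half the measure of a superlevel set within a period. -/
def level (ψ : ℝ → ℝ) (c : ℝ) : ℝ := volume.real ({x | c < ψ x} ∩ Ioc 0 (2 * π)) / 2

lemma measure_inter_period_ne_top (s : Set ℝ) (a b : ℝ) : volume (s ∩ Ioc a b) ≠ ⊤ :=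
  ((measure_mono inter_subset_right).trans_lt measure_Ioc_lt_top).ne

lemma level_antitone (ψ : ℝ → ℝ) : Antitone (level ψ) := by
  intro c c' h
  unfold level
  gcongr
  · exact measure_inter_period_ne_top _ _ _

lemma level_mem (ψ : ℝ → ℝ) (c : ℝ) : level ψ c ∈ Icc 0 π := by
  refine ⟨by unfold level; positivity, ?_⟩
  have := measureReal_mono (μ := volume) (inter_subset_right (s := {x | c < ψ x})
    (t := Ioc 0 (2 * π))) measure_Ioc_lt_top.ne
  rw [Real.volume_real_Ioc_of_le two_pi_pos.le] at this
  unfold level; linarith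

lemma level_sub_level {ψ : ℝ → ℝ} (hψ : Measurable ψ) {c c' : ℝ} (h : c ≤ c') :
    2 * (level ψ c - level ψ c') =
      volume.real ({x | c < ψ x ∧ ψ x ≤ c'} ∩ Ioc 0 (2 * π)) := by
  have e : {x | c < ψ x} ∩ Ioc 0 (2 * π) = ({x | c < ψ x ∧ ψ x ≤ c'} ∩ Ioc 0 (2 * π)) ∪
      ({x | c' < ψ x} ∩ Ioc 0 (2 * π)) := by
    rw [← union_inter_distrib_right]
    congr 1; ext x
    simp only [mem_ofPred_eq, mem_union]
    constructor
    · intro hx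
      rcases le_or_gt (ψ x) c' with h | h
      · exact Or.inl ⟨hx, h⟩
      · exact Or.inr h
    · rintro (h | h')
      · exact h.1
      · exact h.trans_lt h'
  unfold level
  rw [e, measureReal_union _ ((measurableSet_lt measurable_const hψ).inter measurableSet_Ioc)
    (measure_inter_period_ne_top _ _ _) (measure_inter_period_ne_top _ _ _)]
  · ring
  · refine Set.disjoint_left.2 fun x h1 h2 => ?_
    have a1 : ψ x ≤ c' := h1.1.2
    have a2 : c' < ψ x := h2.1
    linarith

/-- A continuous periodic function crosses a band of values at least twice in a period. -/
lemma exists_crossings {ψ : ℝ → ℝ} (hψ : Continuous ψ) (hp : Function.Periodic ψ (2 * π))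
    {c c' a p : ℝ} (hcc : c < c') (ha : ψ a ≤ c) (hpp : c' ≤ ψ p) :
    ∃ α α' γ' γ : ℝ, α ≤ α' ∧ γ' ≤ γ ∧ ψ α ≤ c ∧ c' ≤ ψ α' ∧ c' ≤ ψ γ' ∧ ψ γ ≤ c ∧
      (α' - α) + (γ - γ') ≤ 2 * (level ψ c - level ψ c') := by
  obtain ⟨q, hq, hpq⟩ := hp.exists_mem_Ico two_pi_pos p a
  rw [hpq] at hpp
  obtain ⟨α', hα', hα'1, hα'2⟩ := exists_first_le (e := fun x => - ψ x) hψ.neg (θ := -c') hq.1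
    (by linarith)
  obtain ⟨α, hα, hα1, hα2⟩ := exists_last_le hψ hα'.1 ha
  obtain ⟨γ', hγ', hγ'1, hγ'2⟩ := exists_last_le (e := fun x => - ψ x) hψ.neg (θ := -c') hq.2.le
    (by linarith)
  obtain ⟨γ, hγ, hγ1, hγ2⟩ := exists_first_le hψ (θ := c) hγ'.2 (by rwa [hp a])
  refine ⟨α, α', γ', γ, hα.2, hγ.1, hα1, by linarith, by linarith, hγ1, ?_⟩
  have hms : MeasurableSet {x | c < ψ x ∧ ψ x ≤ c'} :=
    (measurableSet_lt measurable_const hψ.measurable).inter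
      (measurableSet_le hψ.measurable measurable_const)
  rw [level_sub_level hψ.measurable hcc.le, measureReal_period hms (fun x => by simp [hp x]) a]
  have hd : Disjoint (Ioo α α') (Ioo γ' γ) := by
    refine Set.disjoint_left.2 fun x h1 h2 => ?_
    linarith [h1.2, h2.1, hα'.2, hγ'.1]
  have hsub : Ioo α α' ∪ Ioo γ' γ ⊆ {x | c < ψ x ∧ ψ x ≤ c'} ∩ Ioc a (a + 2 * π) := by
    rintro x (hx | hx)
    · refine ⟨⟨?_, ?_⟩, by linarith [hα.1, hx.1], by linarith [hx.2, hα'.2, hq.2]⟩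
      · by_contra! h
        linarith [hα2 x ⟨by linarith [hα.1, hx.1], hx.2.le⟩ h, hx.1]
      · by_contra! h
        linarith [hα'2 x ⟨by linarith [hα.1, hx.1], by linarith [hx.2, hα'.2]⟩ (by linarith), hx.2]
    · refine ⟨⟨?_, ?_⟩, by linarith [hq.1, hx.1, hγ'.1], by linarith [hx.2, hγ.2]⟩
      · by_contra! h
        linarith [hγ2 x ⟨hx.1.le, by linarith [hγ.2, hx.2]⟩ h, hx.2]
      · by_contra! h
        linarith [hγ'2 x ⟨by linarith [hx.1, hγ'.1], by linarith [hx.2, hγ.2]⟩ (by linarith), hx.1]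
  have := measureReal_mono (μ := volume) hsub (measure_inter_period_ne_top _ _ _)
  rw [measureReal_union hd measurableSet_Ioo measure_Ioo_lt_top.ne measure_Ioo_lt_top.ne,
    Real.volume_real_Ioo_of_le hα.2, Real.volume_real_Ioo_of_le hγ.1] at this
  exact this

lemma sub_le_modulus_level {ω φ : ℝ → ℝ} (hω : MonotoneOn ω (Ici 0)) (hω0 : ω 0 = 0)
    (hφ : Continuous φ) (hp : Function.Periodic φ (2 * π)) (hφω : ∀ x y, |φ x - φ y| ≤ ω |x - y|)
    {c c' a p : ℝ} (hcc : c ≤ c') (ha : φ a ≤ c) (hpp : c' ≤ φ p) :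
    c' - c ≤ ω (level φ c - level φ c') := by
  rcases hcc.eq_or_lt with rfl | hcc
  · simp [hω0]
  obtain ⟨α, α', γ', γ, h1, h2, h3, h4, h5, h6, h7⟩ := exists_crossings hφ hp hcc ha hpp
  have hd : 0 ≤ level φ c - level φ c' := by linarith
  rcases le_total (α' - α) (γ - γ') with h | h
  · have := (le_abs_self _).trans (hφω α' α)
    rw [abs_of_nonneg (by linarith : 0 ≤ α' - α)] at this
    have := hω (show α' - α ∈ Ici 0 by simpa using h1) (show _ ∈ Ici 0 from hd) (by linarith)
    linarith
  · have := (le_abs_self _).trans (hφω γ' γ)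
    rw [abs_of_nonpos (by linarith : γ' - γ ≤ 0)] at this
    have := hω (show -(γ' - γ) ∈ Ici 0 by simpa using h2) (show _ ∈ Ici 0 from hd) (by linarith)
    linarith

lemma sub_le_level {H h : ℝ → ℝ} {m : ℝ} (hm : |m| ≤ 1) (hh : ∀ x, |h x| ≤ 1)
    (hH : ∀ x, HasDerivAt H (h x - m) x) (hp : Function.Periodic H (2 * π))
    {c c' a p : ℝ} (hcc : c ≤ c') (ha : H a ≤ c) (hpp : c' ≤ H p) :
    c' - c ≤ level H c - level H c' := by
  rcases hcc.eq_or_lt with rfl | hcc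
  · simp
  have hd : Differentiable ℝ H := fun x => (hH x).differentiableAt
  obtain ⟨α, α', γ', γ, h1, h2, h3, h4, h5, h6, h7⟩ := exists_crossings hd.continuous hp hcc ha hpp
  have b1 := image_sub_le_mul_sub_of_deriv_le hd (C := 1 - m)
    (fun x => by rw [(hH x).deriv]; linarith [(abs_le.1 (hh x)).2]) h1
  have b2 := mul_sub_le_image_sub_of_le_deriv hd (C := -1 - m)
    (fun x => by rw [(hH x).deriv]; linarith [(abs_le.1 (hh x)).1]) h2
  rw [abs_le] at hm
  have e1 : c' - c ≤ (1 - m) * (α' - α) := by linarith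
  have e2 : c' - c ≤ (1 + m) * (γ - γ') := by linarith
  have f1 := mul_le_mul_of_nonneg_left e1 (by linarith : 0 ≤ 1 + m)
  have f2 := mul_le_mul_of_nonneg_left e2 (by linarith : 0 ≤ 1 - m)
  nlinarith [mul_nonneg (sq_nonneg m) (by linarith : 0 ≤ (α' - α) + (γ - γ'))]

lemma volume_le_of_sub_le {s : Set ℝ} {R : ℝ} (h : ∀ c ∈ s, ∀ c' ∈ s, c ≤ c' → c' - c ≤ R) :
    volume s ≤ ENNReal.ofReal R := by
  refine (Real.volume_le_diam s).trans (Metric.ediam_le fun c hc c' hc' => ?_)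
  rw [edist_dist, Real.dist_eq]
  refine ENNReal.ofReal_le_ofReal ?_
  rcases le_total c c' with hcc | hcc
  · rw [abs_of_nonpos (by linarith)]; linarith [h c hc c' hc' hcc]
  · rw [abs_of_nonneg (by linarith)]; exact h c' hc' c hc hcc

lemma le_integral_sublevel {w : ℝ → ℝ} (hw : Continuous w) (hw0 : ∀ x, 0 ≤ w x) {v A : ℝ}
    (hA : 0 ≤ A) (hv : v ≤ ∫ x in (0:ℝ)..A, w x) :
    v ≤ ∫ x in Ioc 0 A, w x * {x | ∫ u in (0:ℝ)..x, w u < v}.indicator 1 x := by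
  have hc : Continuous fun x => ∫ u in (0:ℝ)..x, w u :=
    intervalIntegral.continuous_primitive (fun a b => hw.intervalIntegrable a b) 0
  have hms : MeasurableSet {x | ∫ u in (0:ℝ)..x, w u < v} :=
    measurableSet_lt hc.measurable measurable_const
  obtain ⟨x, hx, hx1, hx2⟩ := exists_first_le (e := fun x => - ∫ u in (0:ℝ)..x, w u) hc.neg
    (θ := -v) hA (by linarith)
  have e : ∀ x, w x * {x | ∫ u in (0:ℝ)..x, w u < v}.indicator 1 x =
      {x | ∫ u in (0:ℝ)..x, w u < v}.indicator w x := by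
    intro x; by_cases h : x ∈ {x | ∫ u in (0:ℝ)..x, w u < v} <;> simp [h]
  simp only [e]
  rw [setIntegral_indicator hms]
  have hsub : Ioo 0 x ⊆ Ioc 0 A ∩ {x | ∫ u in (0:ℝ)..x, w u < v} := by
    intro y hy
    refine ⟨⟨hy.1, by linarith [hy.2, hx.2]⟩, ?_⟩
    by_contra! h
    have h' : v ≤ ∫ u in (0:ℝ)..y, w u := not_lt.1 h
    linarith [hx2 y ⟨hy.1.le, by linarith [hy.2, hx.2]⟩ (by linarith), hy.2]
  calc v ≤ ∫ u in (0:ℝ)..x, w u := by linarith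
    _ = ∫ u in Ioo 0 x, w u := by
      rw [intervalIntegral.integral_of_le hx.1, integral_Ioc_eq_integral_Ioo]
    _ ≤ _ := setIntegral_mono_set
      ((hw.integrableOn_Icc (a := 0) (b := A)).mono_set
        (inter_subset_left.trans Ioc_subset_Icc_self))
      (Eventually.of_forall hw0) (Eventually.of_forall hsub)

/-- Comparison of a functional of the levels with its extremal value. -/
lemma integral_level_le {F w ω μ : ℝ → ℝ} {c0 c1 : ℝ} (hF : Measurable F)
    (hF0 : ∀ x ∈ Icc 0 π, 0 ≤ F x) (hw : Continuous w) (hw0 : ∀ x, 0 ≤ w x)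
    (hcond : ∀ x1 x2, 0 ≤ x1 → x1 ≤ x2 → x2 ≤ π →
      min (F x1) (F x2) ≤ ∫ x in (0:ℝ)..((π - (x2 - x1)) / 2), w x)
    (hμ : Antitone μ) (hμr : ∀ c, μ c ∈ Icc 0 π) (hω : MonotoneOn ω (Ici 0)) (hωc : Continuous ω)
    (hω0 : ∀ t, 0 ≤ t → 0 ≤ ω t)
    (hμω : ∀ c c', c0 ≤ c → c ≤ c' → c' ≤ c1 → c' - c ≤ ω (μ c - μ c')) :
    ∫ c in Ioc c0 c1, F (μ c) ≤ ∫ x in (0:ℝ)..(π / 2), ω (π - 2 * x) * w x := by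
  have hc : Continuous fun x => ∫ u in (0:ℝ)..x, w u :=
    intervalIntegral.continuous_primitive (fun a b => hw.intervalIntegrable a b) 0
  have hmono : Monotone fun x => ∫ u in (0:ℝ)..x, w u := by
    intro x y hxy
    have := intervalIntegral.integral_add_adjacent_intervals (hw.intervalIntegrable 0 x)
      (hw.intervalIntegrable (μ := volume) x y)
    simp only
    linarith [intervalIntegral.integral_nonneg (μ := volume) hxy fun u _ => hw0 u]
  have hFb : ∀ x ∈ Icc 0 π, F x ≤ ∫ u in (0:ℝ)..(π / 2), w u := by
    intro x hx
    have := hcond x x hx.1 le_rfl hx.2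
    simpa using this
  have hFm : Measurable fun c => F (μ c) := hF.comp hμ.measurable
  have hFi : IntegrableOn (fun c => F (μ c)) (Ioc c0 c1) :=
    integrableOn_of_abs_le hFm (fun c => by
      rw [abs_of_nonneg (hF0 _ (hμr c))]; exact hFb _ (hμr c)) measure_Ioc_lt_top
  set T : Set (ℝ × ℝ) := {p | ∫ u in (0:ℝ)..p.2, w u < F (μ p.1)} with hT
  have hTm : MeasurableSet T :=
    measurableSet_lt (hc.measurable.comp measurable_snd) (hFm.comp measurable_fst)
  have hwi : IntegrableOn w (Ioc 0 (π / 2)) := (hw.integrableOn_Icc).mono_set Ioc_subset_Icc_self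
  have hInt : Integrable (fun p : ℝ × ℝ => w p.2 * T.indicator 1 p)
      ((volume.restrict (Ioc c0 c1)).prod (volume.restrict (Ioc 0 (π / 2)))) := by
    have h1 : Integrable (fun p : ℝ × ℝ => (1 : ℝ) * w p.2)
        ((volume.restrict (Ioc c0 c1)).prod (volume.restrict (Ioc 0 (π / 2)))) :=
      (integrable_const (μ := volume.restrict (Ioc c0 c1)) (1 : ℝ)).mul_prod hwi
    refine (h1.indicator hTm).congr (Eventually.of_forall fun p => ?_)
    by_cases h : p ∈ T <;> simp [h]
  have e1 : ∀ c x, T.indicator (1 : ℝ × ℝ → ℝ) (c, x) =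
      {x | ∫ u in (0:ℝ)..x, w u < F (μ c)}.indicator 1 x := fun c x => by
    simp [hT, indicator]
  calc _ ≤ ∫ c in Ioc c0 c1, ∫ x in Ioc 0 (π / 2), w x * T.indicator 1 (c, x) := by
        refine integral_mono hFi hInt.integral_prod_left fun c => ?_
        simp only [e1]
        exact le_integral_sublevel hw hw0 (by positivity) (hFb _ (hμr c))
    _ = ∫ x in Ioc 0 (π / 2), ∫ c in Ioc c0 c1, w x * T.indicator 1 (c, x) :=
        integral_integral_swap hInt
    _ ≤ ∫ x in Ioc 0 (π / 2), ω (π - 2 * x) * w x := by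
        refine setIntegral_mono_on hInt.integral_prod_right
          ((Continuous.integrableOn_Icc (by fun_prop)).mono_set Ioc_subset_Icc_self)
          measurableSet_Ioc fun x hx => ?_
        rw [integral_const_mul, mul_comm]
        refine mul_le_mul_of_nonneg_right ?_ (hw0 x)
        have e2 : ∀ c, T.indicator (1 : ℝ × ℝ → ℝ) (c, x) =
            {c | ∫ u in (0:ℝ)..x, w u < F (μ c)}.indicator (fun _ => 1) c := fun c => by
          simp [hT, indicator]
        simp only [e2]
        have hRω : 0 ≤ ω (π - 2 * x) := hω0 _ (by linarith [hx.2])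
        rw [setIntegral_indicator (measurableSet_lt measurable_const hFm), setIntegral_const,
          smul_eq_mul, mul_one, measureReal_def]
        refine ENNReal.toReal_le_of_le_ofReal hRω (volume_le_of_sub_le fun c hc' c' hc'' hcc => ?_)
        have a1 : ∫ u in (0:ℝ)..x, w u < F (μ c) := hc'.2
        have a2 : ∫ u in (0:ℝ)..x, w u < F (μ c') := hc''.2
        have a3 := hcond (μ c') (μ c) (hμr c').1 (hμ hcc) (hμr c).2
        have a4 : x < (π - (μ c - μ c')) / 2 := by
          by_contra! h
          have : (∫ u in (0:ℝ)..((π - (μ c - μ c')) / 2), w u) ≤ ∫ u in (0:ℝ)..x, w u := hmono h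
          have := (lt_min a2 a1).trans_le a3
          linarith
        refine (hμω c c' hc'.1.1.le hcc hc''.1.2).trans ?_
        exact hω (show _ ∈ Ici (0:ℝ) from sub_nonneg.2 (hμ hcc))
          (show π - 2 * x ∈ Ici (0:ℝ) from by simp only [mem_Ici]; linarith [hx.2]) (by linarith)
    _ = _ := by rw [intervalIntegral.integral_of_le (by positivity)]

lemma setIntegral_tri {g : ℝ → ℝ} (hg : Continuous g) (x b : ℝ) :
    ∫ s in tri x b, g s =
      (∫ s in (0:ℝ)..(max |x - b| (min (x + b) (2 * π - x - b))), g s) - ∫ s in (0:ℝ)..|x - b|, g s := by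
  rw [intervalIntegral.integral_interval_sub_left (hg.intervalIntegrable _ _)
    (hg.intervalIntegrable _ _), intervalIntegral.integral_of_le (le_max_left _ _),
    integral_Ioc_eq_integral_Ioo]
  unfold tri
  rcases le_total |x - b| (min (x + b) (2 * π - x - b)) with h | h
  · rw [max_eq_right h]
  · rw [max_eq_left h, Ioo_eq_empty_of_le h, Ioo_self]

lemma continuous_triGreen (b : ℝ) : Continuous fun p : ℝ × ℝ => triGreen p.1 b p.2 := by
  unfold triGreen
  have hg : Continuous (fun q : (ℝ × ℝ) × ℝ => greenKer q.2 q.1.2) :=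
    continuous_greenKer.comp (by fun_prop : Continuous fun q : (ℝ × ℝ) × ℝ => (q.2, q.1.2))
  have e : ∀ p : ℝ × ℝ, Continuous fun s => greenKer s p.2 := fun p =>
    continuous_greenKer.comp (by fun_prop : Continuous fun s : ℝ => (s, p.2))
  simp only [fun p : ℝ × ℝ => setIntegral_tri (e p) p.1 b]
  refine continuous_const.mul (Continuous.sub ?_ ?_)
  · exact intervalIntegral.continuous_parametric_intervalIntegral_of_continuous hg (by fun_prop)
  · exact intervalIntegral.continuous_parametric_intervalIntegral_of_continuous hg (by fun_prop)

lemma continuous_triInt {κ : ℝ → ℝ} (hκ : Continuous κ) :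
    Continuous fun p : ℝ × ℝ => triInt κ p.1 p.2 := by
  unfold triInt
  simp only [setIntegral_tri hκ]
  have h : Continuous fun y => ∫ s in (0:ℝ)..y, κ s :=
    intervalIntegral.continuous_primitive (fun a b => hκ.intervalIntegrable a b) 0
  exact continuous_const.mul ((h.comp (by fun_prop)).sub (h.comp (by fun_prop)))

lemma abs_triGreen_le (x b : ℝ) {t : ℝ} (ht : t ∈ Icc 0 π) : |triGreen x b t| ≤ 2 * π * t := by
  unfold triGreen
  rw [abs_mul, abs_two, mul_assoc]
  refine mul_le_mul_of_nonneg_left ?_ two_pos.le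
  have h := norm_setIntegral_le_of_norm_le_const (μ := volume) (s := tri x b) (C := t)
    (f := fun s => greenKer s t) ((measure_mono (tri_subset x b)).trans_lt measure_Ioo_lt_top)
    fun s hs => abs_greenKer_le (Ioo_subset_Icc_self (tri_subset x b hs)) ht
  refine h.trans ?_
  rw [mul_comm]
  refine mul_le_mul_of_nonneg_right ?_ ht.1
  have := measureReal_mono (μ := volume) (tri_subset x b) measure_Ioo_lt_top.ne
  rwa [Real.volume_real_Ioo_of_le pi_pos.le, sub_zero] at this

/-- Layer cake formula against a bounded weight. -/
lemma layer_cake {φ σ : ℝ → ℝ} {c0 c1 C : ℝ} (hφ : Measurable φ) (h0 : ∀ x, c0 ≤ φ x)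
    (h1 : ∀ x, φ x ≤ c1) (hσ : Measurable σ) (hσC : ∀ x, |σ x| ≤ C) :
    IntegrableOn (fun c => ∫ x in {x | c < φ x} ∩ Ioc 0 (2 * π), σ x) (Ioc c0 c1) ∧
    ∫ x in Ioc 0 (2 * π), φ x * σ x = c0 * (∫ x in Ioc 0 (2 * π), σ x) +
      ∫ c in Ioc c0 c1, ∫ x in {x | c < φ x} ∩ Ioc 0 (2 * π), σ x := by
  set T : Set (ℝ × ℝ) := {p | p.1 < φ p.2} with hT
  have hTm : MeasurableSet T := measurableSet_lt measurable_fst (hφ.comp measurable_snd)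
  have hσi : IntegrableOn σ (Ioc 0 (2 * π)) := integrableOn_of_abs_le hσ hσC measure_Ioc_lt_top
  have hInt : Integrable (fun p : ℝ × ℝ => T.indicator 1 p * σ p.2)
      ((volume.restrict (Ioc c0 c1)).prod (volume.restrict (Ioc 0 (2 * π)))) := by
    have h1 : Integrable (fun p : ℝ × ℝ => (1 : ℝ) * σ p.2)
        ((volume.restrict (Ioc c0 c1)).prod (volume.restrict (Ioc 0 (2 * π)))) :=
      (integrable_const (μ := volume.restrict (Ioc c0 c1)) (1 : ℝ)).mul_prod hσi
    refine (h1.indicator hTm).congr (Eventually.of_forall fun p => ?_)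
    by_cases h : p ∈ T <;> simp [h]
  have e1 : ∀ c, ∫ x in Ioc 0 (2 * π), T.indicator (1 : ℝ × ℝ → ℝ) (c, x) * σ x =
      ∫ x in {x | c < φ x} ∩ Ioc 0 (2 * π), σ x := fun c => by
    rw [inter_comm, ← setIntegral_indicator (measurableSet_lt measurable_const hφ)]
    congr 1; ext x
    by_cases h : c < φ x <;> simp [hT, h]
  have e2 : ∀ x, ∫ c in Ioc c0 c1, T.indicator (1 : ℝ × ℝ → ℝ) (c, x) * σ x =
      (φ x - c0) * σ x := fun x => by
    rw [integral_mul_const]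
    congr 1
    have : ∀ c, T.indicator (1 : ℝ × ℝ → ℝ) (c, x) = (Iio (φ x)).indicator (fun _ => 1) c :=
      fun c => by simp [hT, indicator]
    simp only [this]
    rw [setIntegral_indicator measurableSet_Iio, setIntegral_const, smul_eq_mul, mul_one]
    have e : Ioc c0 c1 ∩ Iio (φ x) = Ioo c0 (φ x) := by
      ext c; simp only [mem_inter_iff, mem_Ioc, mem_Iio, mem_Ioo]
      have := h1 x
      constructor
      · rintro ⟨⟨a, b⟩, c⟩; exact ⟨a, c⟩
      · rintro ⟨a, c⟩; exact ⟨⟨a, by linarith⟩, c⟩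
    rw [e, Real.volume_real_Ioo_of_le (h0 x)]
  have hl := hInt.integral_prod_left
  simp only [e1] at hl
  refine ⟨hl, ?_⟩
  have hs := integral_integral_swap (f := fun c x => T.indicator (1 : ℝ × ℝ → ℝ) (c, x) * σ x) hInt
  simp only [e1, e2] at hs
  rw [hs, ← integral_const_mul, ← integral_add (hσi.const_mul _)]
  · congr 1; ext x; ring
  · have := hInt.integral_prod_right
    simpa only [e2] using this

lemma slide_eq_sub {χ φ : ℝ → ℝ} (hd : ∀ x, HasDerivAt χ (φ x) x) (hc : Continuous φ) (t x : ℝ) :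
    slide φ t x = χ (x + t) - χ (x - t) :=
  intervalIntegral.integral_eq_sub_of_hasDerivAt (fun y _ => hd y) (hc.intervalIntegrable _ _)

lemma integral_deriv_period {χ φ : ℝ → ℝ} (hd : ∀ x, HasDerivAt χ (φ x) x) (hc : Continuous φ)
    (hp : Function.Periodic χ (2 * π)) : ∫ x in Ioc 0 (2 * π), φ x = 0 := by
  rw [← intervalIntegral.integral_of_le two_pi_pos.le,
    intervalIntegral.integral_eq_sub_of_hasDerivAt (fun y _ => hd y) (hc.intervalIntegrable _ _),
    ← zero_add (2 * π), hp 0, sub_self]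

lemma periodic_deriv {χ φ : ℝ → ℝ} (hd : ∀ x, HasDerivAt χ (φ x) x)
    (hp : Function.Periodic χ (2 * π)) : Function.Periodic φ (2 * π) := fun x => by
  refine ((hd (x + 2 * π)).comp_add_const x (2 * π)).unique ?_
  simpa only [hp _] using hd x

lemma integral_mul_diff_le {χ φ β : ℝ → ℝ} {b c0 c1 : ℝ} (hd : ∀ x, HasDerivAt χ (φ x) x)
    (hc : Continuous φ) (hp : Function.Periodic χ (2 * π)) (hβ : IsDensity β b)
    (h0 : ∀ x, c0 ≤ φ x) (h1 : ∀ x, φ x ≤ c1) {t : ℝ} (ht : t ∈ Ioo 0 π) :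
    ∫ x in Ioc 0 (2 * π), β x * (χ (x + t) - χ (x - t)) ≤
      ∫ c in Ioc c0 c1, triGreen (level φ c) b t := by
  have hpφ := periodic_deriv hd hp
  obtain ⟨C, -, hC⟩ := exists_bound_of_periodic hc hpφ
  obtain ⟨i1, e1⟩ := layer_cake hc.measurable h0 h1 (hβ.continuous_slide t).measurable (C := 2 * π)
    (fun x => by
      rw [abs_of_nonneg (hβ.slide_nonneg ht.1.le x)]
      linarith [hβ.slide_le ht.1.le x, ht.2])
  obtain ⟨i2, e2⟩ := layer_cake hc.measurable h0 h1 (σ := fun _ => 1) measurable_const (C := 1)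
    (by simp)
  simp only [mul_one, setIntegral_const, smul_eq_mul, integral_deriv_period hd hc hp,
    Real.volume_real_Ioc_of_le two_pi_pos.le] at e2 i2
  have hl : ∀ c, volume.real ({x | c < φ x} ∩ Ioc 0 (2 * π)) = 2 * level φ c := fun c => by
    unfold level; ring
  simp only [hl] at e2 i2
  rw [integral_const_mul] at e2
  have hlev : ∫ c in Ioc c0 c1, level φ c = - (π * c0) := by linarith
  calc _ = ∫ x in Ioc 0 (2 * π), φ x * slide β t x := by
        rw [integral_mul_slide hc.measurable hC hpφ hβ.meas hβ.abs_le hβ.per ht.1.le]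
        simp only [slide_eq_sub hd hc, mul_comm]
    _ ≤ c0 * (4 * t * b) + ∫ c in Ioc c0 c1,
          (triGreen (level φ c) b t + 4 * t * b / π * level φ c) := by
        rw [e1, hβ.integral_slide ht.1.le]
        gcongr 1
        have hm : Measurable (level φ) := (level_antitone φ).measurable
        refine integral_mono i1 (Integrable.add ?_ ?_) fun c => ?_
        · refine Measure.integrableOn_of_bounded (M := 2 * π * t) measure_Ioc_lt_top.ne
            (((continuous_triGreen b).measurable.comp
              (hm.prodMk measurable_const)).aestronglyMeasurable)
            (Eventually.of_forall fun c => abs_triGreen_le _ _ (Ioo_subset_Icc_self ht))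
        · refine ((i2.const_mul (1 / 2)).const_mul (4 * t * b / π)).congr
            (Eventually.of_forall fun c => ?_)
          simp only; ring
        · refine (setIntegral_slide_le hβ (measurableSet_lt measurable_const hc.measurable)
            (hl c) ht.1.le ht.2.le).trans (le_of_eq ?_)
          ring
    _ = _ := by
        have hm : Measurable (level φ) := (level_antitone φ).measurable
        rw [integral_add, integral_const_mul, hlev]
        · field_simp; ring
        · exact Measure.integrableOn_of_bounded (M := 2 * π * t) measure_Ioc_lt_top.ne
            (((continuous_triGreen b).measurable.comp
              (hm.prodMk measurable_const)).aestronglyMeasurable)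
            (Eventually.of_forall fun c => abs_triGreen_le _ _ (Ioo_subset_Icc_self ht))
        · refine ((i2.const_mul (1 / 2)).const_mul (4 * t * b / π)).congr
            (Eventually.of_forall fun c => ?_)
          simp only; ring

/-- Rearrangement estimate for a convolution tested against a density. -/
lemma IsKer.integral_mul_conv_le {S χ φ β : ℝ → ℝ} {b c0 c1 : ℝ} (hS : IsKer S)
    (hd : ∀ x, HasDerivAt χ (φ x) x) (hc : Continuous φ) (hp : Function.Periodic χ (2 * π))
    (hβ : IsDensity β b) (h0 : ∀ x, c0 ≤ φ x) (h1 : ∀ x, φ x ≤ c1) :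
    (1 / π) * ∫ x in Ioc 0 (2 * π), β x * conv S χ x ≤
      ∫ c in Ioc c0 c1, triInt (ConjClass.green S) (level φ c) b := by
  obtain ⟨C, hC0, hL⟩ := exists_lipschitz_of_periodic hd hc (periodic_deriv hd hp)
  have hm : Measurable (level φ) := (level_antitone φ).measurable
  have hInt : Integrable (fun p : ℝ × ℝ => S p.2 * triGreen (level φ p.1) b p.2)
      ((volume.restrict (Ioc c0 c1)).prod (volume.restrict (Ioo 0 π))) := by
    have hb : Integrable (fun p : ℝ × ℝ => (2 * π) * (p.2 * S p.2))
        ((volume.restrict (Ioc c0 c1)).prod (volume.restrict (Ioo 0 π))) :=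
      (integrable_const (μ := volume.restrict (Ioc c0 c1)) (2 * π)).mul_prod hS.int
    refine hb.mono' ?_ ?_
    · refine (hS.aesm.comp_snd).mul ?_
      exact ((continuous_triGreen b).measurable.comp
        ((hm.comp measurable_fst).prodMk measurable_snd)).aestronglyMeasurable
    · rw [Measure.prod_restrict]
      filter_upwards [ae_restrict_mem (measurableSet_Ioc.prod measurableSet_Ioo)] with p hp
      have hp2 : p.2 ∈ Ioo 0 π := hp.2
      rw [norm_mul, Real.norm_eq_abs, abs_of_pos (hS.pos _ hp2)]
      have := mul_le_mul_of_nonneg_left (abs_triGreen_le (level φ p.1) b (Ioo_subset_Icc_self hp2))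
        (hS.pos _ hp2).le
      refine this.trans (le_of_eq ?_)
      ring
  have e : ∀ c, ∫ t in Ioo 0 π, S t * triGreen (level φ c) b t =
      π * triInt (ConjClass.green S) (level φ c) b := fun c => by
    rw [← hS.integral_mul_triGreen]; field_simp
  have hsw := integral_integral_swap (f := fun c t => S t * triGreen (level φ c) b t) hInt
  simp only [e, integral_const_mul] at hsw
  have key : ∫ x in Ioc 0 (2 * π), β x * conv S χ x ≤
      ∫ t in Ioo 0 π, S t * ∫ c in Ioc c0 c1, triGreen (level φ c) b t := by
    rw [hS.integral_mul_conv hL hβ.meas hβ.abs_le]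
    have hi := hInt.integral_prod_right
    simp only [integral_const_mul] at hi
    refine setIntegral_mono_on ?_ hi measurableSet_Ioo fun t ht =>
      mul_le_mul_of_nonneg_left (integral_mul_diff_le hd hc hp hβ h0 h1 ht) (hS.pos t ht).le
    have := hS.integrable_mul (q := fun t => ∫ x in Ioc 0 (2 * π), β x * (χ (x + t) - χ (x - t)))
      ?_ (2 * C * (2 * π)) ?_
    · simpa only [mul_comm] using this
    · refine (StronglyMeasurable.integral_prod_right (f := fun t x => β x * (χ (x + t) - χ (x - t)))
        (Measurable.stronglyMeasurable ?_)).aestronglyMeasurable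
      have hχ : Measurable χ := (continuous_of_lip hL).measurable
      have := hβ.meas
      unfold Function.uncurry
      fun_prop
    · intro t ht
      have := norm_setIntegral_le_of_norm_le_const (μ := volume) (s := Ioc 0 (2 * π))
        (C := 2 * C * t) (f := fun x => β x * (χ (x + t) - χ (x - t))) measure_Ioc_lt_top
        fun x _ => by
          rw [norm_mul]
          have a1 := hβ.abs_le x
          have a2 := abs_diff_le hL x ht.1.le
          calc _ ≤ 1 * (2 * C * t) := mul_le_mul a1 a2 (abs_nonneg _) zero_le_one
            _ = _ := one_mul _
      rw [Real.volume_real_Ioc_of_le two_pi_pos.le, sub_zero] at this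
      refine this.trans (le_of_eq ?_)
      ring
  rw [one_div, inv_mul_le_iff₀ pi_pos, hsw]
  exact key

lemma exists_forall_le_of_periodic {φ : ℝ → ℝ} (hc : Continuous φ)
    (hp : Function.Periodic φ (2 * π)) : ∃ a, ∀ x, φ a ≤ φ x := by
  obtain ⟨a, -, ha⟩ := isCompact_Icc.exists_isMinOn (nonempty_Icc.2 two_pi_pos.le) hc.continuousOn
  refine ⟨a, fun x => ?_⟩
  obtain ⟨y, hy, hxy⟩ := hp.exists_mem_Ico₀ two_pi_pos x
  rw [hxy]
  exact ha (Ico_subset_Icc_self hy)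

lemma exists_continuous_extension {κ : ℝ → ℝ} (hκ : ContinuousOn κ (Icc 0 π))
    (h0 : ∀ t ∈ Icc 0 π, 0 ≤ κ t) :
    ∃ k : ℝ → ℝ, Continuous k ∧ (∀ t, 0 ≤ k t) ∧ EqOn k κ (Icc 0 π) := by
  have hm : ∀ t : ℝ, max 0 (min t π) ∈ Icc 0 π := fun t =>
    ⟨le_max_left _ _, max_le pi_pos.le (min_le_right _ _)⟩
  refine ⟨fun t => κ (max 0 (min t π)), hκ.comp_continuous (by fun_prop) hm, fun t => h0 _ (hm t),
    fun t ht => ?_⟩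
  simp only
  rw [min_eq_left ht.2, max_eq_right ht.1]

lemma min_mul_le {a b c d : ℝ} (ha : 0 ≤ a) (hb : 0 ≤ b) (hc : 0 ≤ c) (hd : 0 ≤ d) :
    min (a * b) (c * d) ≤ (a + c) / 2 * ((b + d) / 2) := by
  have h1 : 0 ≤ min (a * b) (c * d) := le_min (by positivity) (by positivity)
  refine abs_le_of_sq_le_sq' ?_ (by positivity) |>.2
  have h2 : min (a * b) (c * d) ^ 2 ≤ (a * b) * (c * d) := by
    rw [sq]; exact mul_le_mul (min_le_left _ _) (min_le_right _ _) h1 (by positivity)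
  have h3 : a * c ≤ ((a + c) / 2) ^ 2 := by nlinarith [sq_nonneg (a - c)]
  have h4 : b * d ≤ ((b + d) / 2) ^ 2 := by nlinarith [sq_nonneg (b - d)]
  have := mul_le_mul h3 h4 (by positivity) (by positivity)
  nlinarith

/-- The mean of two intervals carries at least the smaller of their masses. -/
lemma min_integral_le {κ : ℝ → ℝ} (hκ : Continuous κ) (h0 : ∀ t, 0 ≤ κ t)
    (hcc : ConcaveOn ℝ (Icc 0 π) κ) {p₁ q₁ p₂ q₂ : ℝ} (hp₁ : 0 ≤ p₁) (h₁ : p₁ ≤ q₁) (hq₁ : q₁ ≤ π)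
    (hp₂ : 0 ≤ p₂) (h₂ : p₂ ≤ q₂) (hq₂ : q₂ ≤ π) :
    min (∫ s in p₁..q₁, κ s) (∫ s in p₂..q₂, κ s) ≤
      ∫ s in ((p₁ + p₂) / 2)..((q₁ + q₂) / 2), κ s := by
  have e : ∀ p q : ℝ, ∫ s in p..q, κ s = (q - p) * ∫ u in (0:ℝ)..1, κ ((q - p) * u + p) := by
    intro p q
    rw [intervalIntegral.mul_integral_comp_mul_add]; simp
  have hnn : ∀ p q : ℝ, 0 ≤ ∫ u in (0:ℝ)..1, κ ((q - p) * u + p) := fun p q =>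
    intervalIntegral.integral_nonneg zero_le_one fun u _ => h0 _
  have hi : ∀ p q : ℝ, IntervalIntegrable (fun u => κ ((q - p) * u + p)) volume 0 1 := fun p q =>
    (hκ.comp (by fun_prop)).intervalIntegrable _ _
  rw [e p₁ q₁, e p₂ q₂, e _ ((q₁ + q₂) / 2)]
  refine (min_mul_le (by linarith) (hnn _ _) (by linarith) (hnn _ _)).trans ?_
  rw [show (q₁ + q₂) / 2 - (p₁ + p₂) / 2 = (q₁ - p₁ + (q₂ - p₂)) / 2 by ring]
  refine mul_le_mul_of_nonneg_left ?_ (by linarith)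
  rw [← intervalIntegral.integral_add (hi _ _) (hi _ _), ← intervalIntegral.integral_div]
  refine intervalIntegral.integral_mono_on zero_le_one (((hi _ _).add (hi _ _)).div_const _)
    ((hκ.comp (by fun_prop)).intervalIntegrable _ _) fun u hu => ?_
  have m : ∀ p q, 0 ≤ p → p ≤ q → q ≤ π → (q - p) * u + p ∈ Icc 0 π := fun p q a b c =>
    ⟨by nlinarith [mul_nonneg (sub_nonneg.2 b) hu.1],
     by nlinarith [mul_nonneg (sub_nonneg.2 b) (sub_nonneg.2 hu.2)]⟩
  have := hcc.2 (m _ _ hp₁ h₁ hq₁) (m _ _ hp₂ h₂ hq₂) (show (0:ℝ) ≤ 1 / 2 by norm_num)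
    (show (0:ℝ) ≤ 1 / 2 by norm_num) (by norm_num)
  simp only [smul_eq_mul] at this
  refine le_trans (by linarith) (this.trans (le_of_eq ?_))
  congr 1; ring

lemma triInt_eq {κ : ℝ → ℝ} {x b : ℝ} (hx : x ∈ Icc 0 π) (hb : b ∈ Icc 0 π) :
    |x - b| ≤ min (x + b) (2 * π - x - b) ∧
    triInt κ x b = (2 / π) * ∫ s in |x - b|..(min (x + b) (2 * π - x - b)), κ s := by
  have h : |x - b| ≤ min (x + b) (2 * π - x - b) := by
    rw [abs_le]
    obtain ⟨h1, h2⟩ := hx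
    obtain ⟨h3, h4⟩ := hb
    have : |x - b| ≤ min (x + b) (2 * π - x - b) :=
      le_min (abs_le.2 ⟨by linarith, by linarith⟩) (abs_le.2 ⟨by linarith, by linarith⟩)
    exact abs_le.1 this
  refine ⟨h, ?_⟩
  unfold triInt tri
  rw [intervalIntegral.integral_of_le h, integral_Ioc_eq_integral_Ioo]

lemma min_triInt_le {κ : ℝ → ℝ} (hκ : Continuous κ) (h0 : ∀ t, 0 ≤ κ t)
    (hcc : ConcaveOn ℝ (Icc 0 π) κ) {b : ℝ} (hb : b ∈ Icc 0 π) (x₁ x₂ : ℝ) (h1 : 0 ≤ x₁)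
    (h2 : x₁ ≤ x₂) (h3 : x₂ ≤ π) :
    min (triInt κ x₁ b) (triInt κ x₂ b) ≤ ∫ x in (0:ℝ)..((π - (x₂ - x₁)) / 2),
      (2 / π) * (κ (π / 2 + x) + κ (π / 2 - x)) := by
  obtain ⟨i1, e1⟩ := triInt_eq (κ := κ) (x := x₁) ⟨h1, by linarith⟩ hb
  obtain ⟨i2, e2⟩ := triInt_eq (κ := κ) (x := x₂) ⟨by linarith, h3⟩ hb
  have j1 := (le_abs_self (b - x₁)).trans_eq (abs_sub_comm _ _)
  have j2 := le_abs_self (x₂ - b)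
  have l1 := min_le_left (x₁ + b) (2 * π - x₁ - b)
  have l1' := min_le_right (x₁ + b) (2 * π - x₁ - b)
  have l2 := min_le_right (x₂ + b) (2 * π - x₂ - b)
  have l2' := min_le_left (x₂ + b) (2 * π - x₂ - b)
  rw [e1, e2, ← mul_min_of_nonneg _ _ (by positivity), intervalIntegral.integral_const_mul]
  refine mul_le_mul_of_nonneg_left ?_ (by positivity)
  rw [intervalIntegral.integral_add (Continuous.intervalIntegrable (by fun_prop) _ _)
      (Continuous.intervalIntegrable (by fun_prop) _ _), intervalIntegral.integral_comp_add_left,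
    intervalIntegral.integral_comp_sub_left, add_zero, sub_zero,
    add_comm (∫ x in (π / 2)..(π / 2 + (π - (x₂ - x₁)) / 2), κ x),
    intervalIntegral.integral_add_adjacent_intervals (hκ.intervalIntegrable _ _)
      (hκ.intervalIntegrable _ _)]
  refine (min_integral_le hκ h0 hcc (abs_nonneg _) i1 (by linarith) (abs_nonneg _) i2
    (by linarith)).trans ?_
  refine intervalIntegral.integral_mono_interval (by linarith) (by linarith) (by linarith)
    (Eventually.of_forall h0) (hκ.intervalIntegrable _ _)

lemma integral_conv_eq_zero {S χ : ℝ → ℝ} {C : ℝ} (hS : IsKer S)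
    (hL : ∀ x y, |χ x - χ y| ≤ C * |x - y|) (hp : Function.Periodic χ (2 * π)) :
    ∫ x in Ioc 0 (2 * π), conv S χ x = 0 := by
  have h := hS.integral_mul_conv hL (β := fun _ => 1) measurable_const (M := 1) (by simp) 0 (2 * π)
  simp only [one_mul] at h
  rw [h]
  refine integral_eq_zero_of_ae (Eventually.of_forall fun t => ?_)
  have hc : Continuous χ := continuous_of_lip hL
  have e : ∀ t, ∫ x in Ioc 0 (2 * π), χ (x + t) = ∫ x in Ioc 0 (2 * π), χ x := fun t => by
    rw [← intervalIntegral.integral_of_le two_pi_pos.le,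
      intervalIntegral.integral_comp_add_right (f := χ), integral_period hp t, zero_add,
      add_comm (2 * π)]
  simp only [Pi.zero_apply]
  rw [integral_sub ((Continuous.integrableOn_Icc (by fun_prop)).mono_set Ioc_subset_Icc_self)
    ((Continuous.integrableOn_Icc (by fun_prop)).mono_set Ioc_subset_Icc_self)]
  simp only [sub_eq_add_neg, e]
  simp

lemma isDensity_indicator {s : Set ℝ} (hs : MeasurableSet s) (hp : ∀ x, x + 2 * π ∈ s ↔ x ∈ s) :
    IsDensity (s.indicator 1) (volume.real (s ∩ Ioc 0 (2 * π)) / 2) where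
  meas := measurable_one.indicator hs
  nonneg x := indicator_nonneg (by simp) x
  le_one x := indicator_le_self' (by simp) x
  per x := by by_cases h : x ∈ s <;> simp [h, hp]
  mass := by
    rw [setIntegral_indicator hs, inter_comm]
    simp
    ring

lemma IsKer.integral_abs_conv_le {S χ φ ω : ℝ → ℝ} (hS : IsKer S) (hω : IsConcaveModulus ω)
    (hd : ∀ x, HasDerivAt χ (φ x) x) (hc : Continuous φ) (hp : Function.Periodic χ (2 * π))
    (hφ : ∀ x y, |φ x - φ y| ≤ ω |x - y|) :
    (1 / π) * ∫ x in Ioc 0 (2 * π), |conv S χ x| ≤ (4 / π) * ∫ t in (0:ℝ)..(π / 2),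
      ω (2 * t) * (ConjClass.green S t + ConjClass.green S (π - t)) := by
  have hpφ := periodic_deriv hd hp
  obtain ⟨C, hC0, hL⟩ := exists_lipschitz_of_periodic hd hc hpφ
  obtain ⟨ωc, ωm, ω0, -, ωn, -⟩ := hω
  have hgc := hS.continuous_conv hL
  have hgp := periodic_conv (S := S) hp
  obtain ⟨a, ha⟩ := exists_forall_le_of_periodic hc hpφ
  obtain ⟨p, hpp⟩ := exists_forall_le_of_periodic hc.neg (fun x => by simp [hpφ x])
  have hpp : ∀ x, φ x ≤ φ p := fun x => neg_le_neg_iff.1 (hpp x)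
  obtain ⟨k, kc, k0, ke⟩ := exists_continuous_extension hS.continuousOn_green
    fun t ht => hS.green_nonneg ht
  have kcc : ConcaveOn ℝ (Icc 0 π) k := hS.concaveOn_green.congr ke.symm
  have hBm : MeasurableSet {x | 0 < conv S χ x} := measurableSet_lt measurable_const hgc.measurable
  have hβ := isDensity_indicator hBm (fun x => by simp [hgp x])
  set b := volume.real ({x | 0 < conv S χ x} ∩ Ioc 0 (2 * π)) / 2 with hb
  have hbm : b ∈ Icc 0 π := ⟨hβ.mass_nonneg, hβ.mass_le⟩
  have hgi : IntegrableOn (conv S χ) (Ioc 0 (2 * π)) :=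
    hgc.integrableOn_Icc.mono_set Ioc_subset_Icc_self
  have e1 : ∫ x in Ioc 0 (2 * π), |conv S χ x| =
      2 * ∫ x in Ioc 0 (2 * π), {x | 0 < conv S χ x}.indicator 1 x * conv S χ x := by
    have : ∀ x, |conv S χ x| =
        2 * ({x | 0 < conv S χ x}.indicator 1 x * conv S χ x) - conv S χ x := fun x => by
      by_cases h : 0 < conv S χ x
      · simp [h, abs_of_pos h]; ring
      · simp [h, abs_of_nonpos (not_lt.1 h)]
    simp only [this]
    rw [integral_sub _ hgi, integral_const_mul, integral_conv_eq_zero hS hL hp, sub_zero]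
    refine Integrable.const_mul ((hgi.indicator hBm).congr (Eventually.of_forall fun x => ?_)) _
    by_cases h : 0 < conv S χ x <;> simp [h]
  have e2 : ∀ x, triInt (ConjClass.green S) x b = triInt k x b := fun x => by
    unfold triInt
    congr 1
    exact setIntegral_congr_fun (measurableSet_tri x b) fun s hs =>
      (ke (Ioo_subset_Icc_self (tri_subset x b hs))).symm
  have h1 := hS.integral_mul_conv_le hd hc hp hβ ha hpp
  simp only [e2] at h1
  have h2 := integral_level_le (F := fun x => triInt k x b)
    (w := fun x => (2 / π) * (k (π / 2 + x) + k (π / 2 - x))) (ω := ω) (μ := level φ)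
    (c0 := φ a) (c1 := φ p)
    ((continuous_triInt kc).comp (by fun_prop : Continuous fun x => (x, b))).measurable
    (fun x _ => mul_nonneg (by positivity) (setIntegral_nonneg (measurableSet_tri x b)
      fun s _ => k0 s)) (by fun_prop) (fun x => mul_nonneg (by positivity)
        (add_nonneg (k0 _) (k0 _))) (min_triInt_le kc k0 kcc hbm) (level_antitone φ) (level_mem φ)
    ωm ωc ωn (fun c c' h3 h4 h5 => sub_le_modulus_level ωm ω0 hc hpφ hφ h4 h3 h5)
  rw [e1, mul_left_comm]
  refine (mul_le_mul_of_nonneg_left (h1.trans h2) two_pos.le).trans (le_of_eq ?_)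
  have h3 := intervalIntegral.integral_comp_sub_left (a := 0) (b := π / 2)
    (fun t => ω (2 * t) * ((2 / π) * (k (π - t) + k t))) (π / 2)
  rw [sub_self, sub_zero] at h3
  have h4 : ∫ t in (0:ℝ)..(π / 2), ω (2 * t) * ((2 / π) * (k (π - t) + k t)) =
      (2 / π) * ∫ t in (0:ℝ)..(π / 2),
        ω (2 * t) * (ConjClass.green S t + ConjClass.green S (π - t)) := by
    rw [← intervalIntegral.integral_const_mul]
    refine intervalIntegral.integral_congr fun t ht => ?_
    rw [uIcc_of_le (by positivity)] at ht
    rw [ke ⟨ht.1, by linarith [ht.2, pi_pos]⟩, ke ⟨by linarith [ht.2, pi_pos], by linarith [ht.1]⟩]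
    ring
  rw [h4] at h3
  rw [show 4 / π = 2 * (2 / π) by ring, mul_assoc, ← h3]
  congr 1
  refine intervalIntegral.integral_congr fun x _ => ?_
  rw [show 2 * (π / 2 - x) = π - 2 * x by ring, show π - (π / 2 - x) = π / 2 + x by ring]

lemma triInt_congr {κ k : ℝ → ℝ} (h : EqOn k κ (Icc 0 π)) (x b : ℝ) :
    triInt κ x b = triInt k x b := by
  unfold triInt
  congr 1
  exact setIntegral_congr_fun (measurableSet_tri x b) fun s hs =>
    (h (Ioo_subset_Icc_self (tri_subset x b hs))).symm

lemma triInt_nonneg {k : ℝ → ℝ} (h0 : ∀ t, 0 ≤ k t) (x b : ℝ) : 0 ≤ triInt k x b :=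
  mul_nonneg (by positivity) (setIntegral_nonneg (measurableSet_tri x b) fun s _ => h0 s)

lemma triInt_le {k : ℝ → ℝ} (hk : Continuous k) (h0 : ∀ t, 0 ≤ k t) (x b : ℝ) :
    triInt k x b ≤ (2 / π) * ∫ s in Ioo 0 π, k s :=
  mul_le_mul_of_nonneg_left (setIntegral_mono_set
    (hk.integrableOn_Icc.mono_set Ioo_subset_Icc_self) (Eventually.of_forall h0)
    (tri_subset x b).eventuallyLE) (by positivity)

/-- Integral of `k` over `[y, π - y]`, extended by zero beyond `π / 2`. -/
def core (k : ℝ → ℝ) (y : ℝ) : ℝ := ∫ s in (min y (π / 2))..(π - min y (π / 2)), k s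

lemma continuous_core {k : ℝ → ℝ} (hk : Continuous k) : Continuous (core k) := by
  have h : Continuous fun y => ∫ s in (0:ℝ)..y, k s :=
    intervalIntegral.continuous_primitive (fun a b => hk.intervalIntegrable a b) 0
  have e : core k = fun y => (∫ s in (0:ℝ)..(π - min y (π / 2)), k s) -
      ∫ s in (0:ℝ)..(min y (π / 2)), k s := by
    ext y
    rw [intervalIntegral.integral_interval_sub_left (hk.intervalIntegrable _ _)
      (hk.intervalIntegrable _ _)]
    rfl
  rw [e]
  exact (h.comp (by fun_prop)).sub (h.comp (by fun_prop))

lemma core_nonneg {k : ℝ → ℝ} (h0 : ∀ t, 0 ≤ k t) (y : ℝ) : 0 ≤ core k y :=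
  intervalIntegral.integral_nonneg (by linarith [min_le_right y (π / 2)]) fun s _ => h0 s

lemma integral_min_mul {k : ℝ → ℝ} (hk : Continuous k) {v : ℝ} (hv0 : 0 ≤ v) (hv : v ≤ π / 2) :
    ∫ s in Ioo 0 π, min v (min s (π - s)) * k s = ∫ y in (0:ℝ)..v, core k y := by
  set T : Set (ℝ × ℝ) := {p | p.1 < min p.2 (π - p.2)} with hT
  have hTm : MeasurableSet T := measurableSet_lt measurable_fst (by fun_prop)
  have hki : IntegrableOn k (Ioo 0 π) := hk.integrableOn_Icc.mono_set Ioo_subset_Icc_self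
  have hInt : Integrable (fun p : ℝ × ℝ => T.indicator 1 p * k p.2)
      ((volume.restrict (Ioc 0 v)).prod (volume.restrict (Ioo 0 π))) := by
    have h1 : Integrable (fun p : ℝ × ℝ => (1 : ℝ) * k p.2)
        ((volume.restrict (Ioc 0 v)).prod (volume.restrict (Ioo 0 π))) :=
      (integrable_const (μ := volume.restrict (Ioc 0 v)) (1 : ℝ)).mul_prod hki
    refine (h1.indicator hTm).congr (Eventually.of_forall fun p => ?_)
    by_cases h : p ∈ T <;> simp [h]
  have hs := integral_integral_swap (f := fun y s => T.indicator (1 : ℝ × ℝ → ℝ) (y, s) * k s) hInt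
  rw [intervalIntegral.integral_of_le hv0]
  convert hs.symm using 1
  · refine setIntegral_congr_fun measurableSet_Ioo fun s hs => ?_
    rw [integral_mul_const]
    congr 1
    have : ∀ c, T.indicator (1 : ℝ × ℝ → ℝ) (c, s) =
        (Iio (min s (π - s))).indicator (fun _ => 1) c := fun c => by simp [hT, indicator]
    simp only [this]
    have hms : 0 ≤ min s (π - s) := le_min hs.1.le (by linarith [hs.2])
    rw [setIntegral_indicator measurableSet_Iio, setIntegral_const, smul_eq_mul, mul_one,
      measureReal_congr (Ioo_ae_eq_Ioc.symm.inter (ae_eq_refl (Iio (min s (π - s))))),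
      Ioo_inter_Iio, Real.volume_real_Ioo_of_le (le_min hv0 hms), sub_zero]
  · refine setIntegral_congr_fun measurableSet_Ioc fun y hy => ?_
    have hy' : y ≤ π / 2 := hy.2.trans hv
    have : ∀ s, T.indicator (1 : ℝ × ℝ → ℝ) (y, s) * k s = (Ioo y (π - y)).indicator k s := by
      intro s
      by_cases h : y < s <;> by_cases h' : s < π - y
      · have : y < π - s := by linarith
        simp [hT, h, h', this]
      · have : ¬ y < π - s := by linarith
        simp [hT, h', this]
      · simp [hT, h]
      · simp [hT, h]
    simp only [this]
    rw [setIntegral_indicator measurableSet_Ioo, core, min_eq_left hy',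
      intervalIntegral.integral_of_le (by linarith), integral_Ioc_eq_integral_Ioo,
      Ioo_inter_Ioo, sup_eq_right.2 hy.1.le, inf_eq_right.2 (by linarith [hy.1])]

lemma volume_tri_le {H h : ℝ → ℝ} {m d0 d1 a p : ℝ} (hm : |m| ≤ 1) (hh : ∀ x, |h x| ≤ 1)
    (hH : ∀ x, HasDerivAt H (h x - m) x) (hp : Function.Periodic H (2 * π))
    (ha : H a ≤ d0) (hpp : d1 ≤ H p) {x s : ℝ} (hx : x ∈ Icc 0 π) (hs : s ∈ Ioo 0 π) :
    volume.real ({c | s ∈ tri x (level H c)} ∩ Ioc d0 d1) ≤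
      2 * min (min x (π - x)) (min s (π - s)) := by
  have hmn : 0 ≤ min (min x (π - x)) (min s (π - s)) :=
    le_min (le_min hx.1 (by linarith [hx.2])) (le_min hs.1.le (by linarith [hs.2]))
  refine ENNReal.toReal_le_of_le_ofReal (by linarith) (volume_le_of_sub_le
    fun c hc c' hc' hcc => ?_)
  obtain ⟨⟨h1, h2⟩, h3⟩ := hc
  obtain ⟨⟨h1', h2'⟩, h3'⟩ := hc'
  have key := sub_le_level hm hh hH hp hcc (ha.trans h3.1.le) (h3'.2.trans hpp)
  obtain ⟨a1, a2⟩ := abs_lt.1 h1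
  obtain ⟨b1, b2⟩ := abs_lt.1 h1'
  obtain ⟨a3, a4⟩ := lt_min_iff.1 h2
  obtain ⟨b3, b4⟩ := lt_min_iff.1 h2'
  refine key.trans ?_
  have : (level H c - level H c') / 2 ≤ min (min x (π - x)) (min s (π - s)) :=
    le_min (le_min (by linarith) (by linarith)) (le_min (by linarith) (by linarith))
  linarith

lemma integral_triInt_level_le {k H h : ℝ → ℝ} {m d0 d1 a p : ℝ} (hk : Continuous k)
    (h0 : ∀ t, 0 ≤ k t) (hm : |m| ≤ 1) (hh : ∀ x, |h x| ≤ 1)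
    (hH : ∀ x, HasDerivAt H (h x - m) x) (hp : Function.Periodic H (2 * π))
    (ha : H a ≤ d0) (hpp : d1 ≤ H p) {x : ℝ} (hx : x ∈ Icc 0 π) :
    ∫ c in Ioc d0 d1, triInt k x (level H c) ≤
      ∫ y in (0:ℝ)..(min x (π - x)), (4 / π) * core k y := by
  have hlm : Measurable (level H) := (level_antitone H).measurable
  set T : Set (ℝ × ℝ) := {p | p.2 ∈ tri x (level H p.1)} with hT
  have hTm : MeasurableSet T := by
    have : T = {p | |x - level H p.1| < p.2} ∩
      {p | p.2 < min (x + level H p.1) (2 * π - x - level H p.1)} := rfl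
    rw [this]
    exact (measurableSet_lt (by fun_prop) (by fun_prop)).inter
      (measurableSet_lt (by fun_prop) (by fun_prop))
  have hki : IntegrableOn k (Ioo 0 π) := hk.integrableOn_Icc.mono_set Ioo_subset_Icc_self
  have hInt : Integrable (fun p : ℝ × ℝ => T.indicator 1 p * k p.2)
      ((volume.restrict (Ioc d0 d1)).prod (volume.restrict (Ioo 0 π))) := by
    have h1 : Integrable (fun p : ℝ × ℝ => (1 : ℝ) * k p.2)
        ((volume.restrict (Ioc d0 d1)).prod (volume.restrict (Ioo 0 π))) :=
      (integrable_const (μ := volume.restrict (Ioc d0 d1)) (1 : ℝ)).mul_prod hki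
    refine (h1.indicator hTm).congr (Eventually.of_forall fun p => ?_)
    by_cases h : p ∈ T <;> simp [h]
  have hs := integral_integral_swap (f := fun c s => T.indicator (1 : ℝ × ℝ → ℝ) (c, s) * k s) hInt
  have e1 : ∀ c, triInt k x (level H c) =
      (2 / π) * ∫ s in Ioo 0 π, T.indicator (1 : ℝ × ℝ → ℝ) (c, s) * k s := fun c => by
    unfold triInt
    congr 1
    rw [← inter_eq_right.2 (tri_subset x (level H c)),
      ← setIntegral_indicator (measurableSet_tri _ _)]
    congr 1; ext s
    by_cases h : s ∈ tri x (level H c) <;> simp [hT, h]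
  have e2 : ∀ s, ∫ c in Ioc d0 d1, T.indicator (1 : ℝ × ℝ → ℝ) (c, s) * k s =
      volume.real ({c | s ∈ tri x (level H c)} ∩ Ioc d0 d1) * k s := fun s => by
    rw [integral_mul_const]
    congr 1
    have hms : MeasurableSet {c | s ∈ tri x (level H c)} := by
      have : {c | s ∈ tri x (level H c)} = (fun c => (c, s)) ⁻¹' T := rfl
      rw [this]
      exact hTm.preimage (by fun_prop)
    have : ∀ c, T.indicator (1 : ℝ × ℝ → ℝ) (c, s) =
        {c | s ∈ tri x (level H c)}.indicator (fun _ => 1) c := fun c => by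
      by_cases h : s ∈ tri x (level H c) <;> simp [hT, h]
    simp only [this]
    rw [setIntegral_indicator hms, setIntegral_const, smul_eq_mul, mul_one, inter_comm]
  have hri := hInt.integral_prod_right
  simp only [e2] at hs hri
  have hv0 : 0 ≤ min x (π - x) := le_min hx.1 (by linarith [hx.2])
  have hv : min x (π - x) ≤ π / 2 := by
    linarith [min_le_left x (π - x), min_le_right x (π - x)]
  simp only [e1]
  rw [integral_const_mul, hs, intervalIntegral.integral_const_mul, ← integral_min_mul hk hv0 hv,
    show 4 / π = 2 / π * 2 by ring, mul_assoc]
  refine mul_le_mul_of_nonneg_left ?_ (by positivity)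
  rw [← integral_const_mul]
  refine setIntegral_mono_on hri ?_ measurableSet_Ioo fun s hs => ?_
  · exact (Continuous.integrableOn_Icc (by fun_prop)).mono_set Ioo_subset_Icc_self
  · rw [← mul_assoc]
    exact mul_le_mul_of_nonneg_right (volume_tri_le hm hh hH hp ha hpp hx hs) (h0 s)

lemma IsKer.integral_primitive_mul_conv_le {S χ φ ω H h : ℝ → ℝ} {m : ℝ} (hS : IsKer S)
    (hω : IsConcaveModulus ω)
    (hd : ∀ x, HasDerivAt χ (φ x) x) (hc : Continuous φ) (hp : Function.Periodic χ (2 * π))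
    (hφ : ∀ x y, |φ x - φ y| ≤ ω |x - y|) (hm : |m| ≤ 1) (hh : ∀ x, |h x| ≤ 1)
    (hH : ∀ x, HasDerivAt H (h x - m) x) (hpH : Function.Periodic H (2 * π)) :
    (1 / π) * ∫ x in Ioc 0 (2 * π), H x * conv S χ x ≤ (4 / π) * ∫ t in (0:ℝ)..(π / 2),
      ω (2 * t) * ∫ s in (π / 2 - t)..(π / 2 + t), ConjClass.green S s := by
  have hpφ := periodic_deriv hd hp
  obtain ⟨C, hC0, hL⟩ := exists_lipschitz_of_periodic hd hc hpφ
  obtain ⟨ωc, ωm, ω0, -, ωn, -⟩ := hω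
  have hgc := hS.continuous_conv hL
  have hgp := periodic_conv (S := S) hp
  obtain ⟨D, -, hD⟩ := exists_bound_of_periodic hgc hgp
  have hHc : Continuous H :=
    (show Differentiable ℝ H from fun x => (hH x).differentiableAt).continuous
  obtain ⟨a, ha⟩ := exists_forall_le_of_periodic hc hpφ
  obtain ⟨p, hpp⟩ := exists_forall_le_of_periodic hc.neg (fun x => by simp [hpφ x])
  have hpp : ∀ x, φ x ≤ φ p := fun x => neg_le_neg_iff.1 (hpp x)
  obtain ⟨a', ha'⟩ := exists_forall_le_of_periodic hHc hpH
  obtain ⟨p', hpp'⟩ := exists_forall_le_of_periodic hHc.neg (fun x => by simp [hpH x])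
  have hpp' : ∀ x, H x ≤ H p' := fun x => neg_le_neg_iff.1 (hpp' x)
  obtain ⟨k, kc, k0, ke⟩ := exists_continuous_extension hS.continuousOn_green
    fun t ht => hS.green_nonneg ht
  have hmφ : Measurable (level φ) := (level_antitone φ).measurable
  have hmH : Measurable (level H) := (level_antitone H).measurable
  obtain ⟨i1, e1⟩ := layer_cake hHc.measurable ha' hpp' hgc.measurable hD
  rw [integral_conv_eq_zero hS hL hp, mul_zero, zero_add] at e1
  have hInt : Integrable (fun q : ℝ × ℝ => triInt k (level φ q.2) (level H q.1))
      ((volume.restrict (Ioc (H a') (H p'))).prod (volume.restrict (Ioc (φ a) (φ p)))) := by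
    refine Integrable.of_bound ((continuous_triInt kc).measurable.comp
      ((hmφ.comp measurable_snd).prodMk (hmH.comp measurable_fst))).aestronglyMeasurable
      ((2 / π) * ∫ s in Ioo 0 π, k s) (Eventually.of_forall fun q => ?_)
    rw [Real.norm_eq_abs, abs_of_nonneg (triInt_nonneg k0 _ _)]
    exact triInt_le kc k0 _ _
  have hsw := integral_integral_swap (f := fun d c => triInt k (level φ c) (level H d)) hInt
  have hli := hInt.integral_prod_left
  have hri := hInt.integral_prod_right
  simp only at hli hri
  set W : ℝ → ℝ := fun x => ∫ y in (0:ℝ)..(min x (π - x)), (4 / π) * core k y with hW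
  have hcore := continuous_core kc
  have hWp : Continuous fun x => ∫ y in (0:ℝ)..x, (4 / π) * core k y :=
    intervalIntegral.continuous_primitive
      (fun a b => (hcore.const_mul _).intervalIntegrable a b) 0
  have hWc : Continuous W := hWp.comp (by fun_prop : Continuous fun x => min x (π - x))
  have hw0 : ∀ y, 0 ≤ (4 / π) * core k y := fun y => mul_nonneg (by positivity) (core_nonneg k0 y)
  have hmono : ∀ x y, x ≤ y → ∫ y in (0:ℝ)..x, (4 / π) * core k y ≤
      ∫ y in (0:ℝ)..y, (4 / π) * core k y := fun x y hxy => by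
    have := intervalIntegral.integral_add_adjacent_intervals
      ((hcore.const_mul (4 / π)).intervalIntegrable (μ := volume) 0 x)
      ((hcore.const_mul (4 / π)).intervalIntegrable (μ := volume) x y)
    linarith [intervalIntegral.integral_nonneg (μ := volume) hxy fun u _ => hw0 u]
  have step1 : (1 / π) * ∫ x in Ioc 0 (2 * π), H x * conv S χ x ≤
      ∫ d in Ioc (H a') (H p'), ∫ c in Ioc (φ a) (φ p), triInt k (level φ c) (level H d) := by
    rw [e1, ← integral_const_mul]
    refine integral_mono (i1.const_mul _) hli fun d => ?_
    have hBm : MeasurableSet {x | d < H x} := measurableSet_lt measurable_const hHc.measurable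
    have hβ := isDensity_indicator hBm (fun x => by simp [hpH x])
    have h1 := hS.integral_mul_conv_le hd hc hp hβ ha hpp
    simp only [triInt_congr ke] at h1
    refine le_trans (le_of_eq ?_) h1
    congr 1
    rw [inter_comm, ← setIntegral_indicator hBm]
    congr 1; ext x
    by_cases h : d < H x <;> simp [h]
  have step2 : ∫ c in Ioc (φ a) (φ p), ∫ d in Ioc (H a') (H p'),
      triInt k (level φ c) (level H d) ≤ ∫ c in Ioc (φ a) (φ p), W (level φ c) := by
    refine integral_mono hri ?_ fun c =>
      integral_triInt_level_le kc k0 hm hh hH hpH le_rfl le_rfl (level_mem φ c)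
    obtain ⟨M, hM⟩ := isCompact_Icc.exists_bound_of_continuousOn (s := Icc 0 π) hWc.continuousOn
    exact Integrable.of_bound (hWc.measurable.comp hmφ).aestronglyMeasurable M
      (Eventually.of_forall fun c => hM _ (level_mem φ c))
  have step3 := integral_level_le (F := W) (w := fun y => (4 / π) * core k y) (ω := ω)
    (μ := level φ) (c0 := φ a) (c1 := φ p) hWc.measurable
    (fun x hx => intervalIntegral.integral_nonneg (le_min hx.1 (by linarith [hx.2]))
      fun y _ => hw0 y) (hcore.const_mul _) hw0
    (fun x1 x2 h1 h2 h3 => by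
      rcases le_total x1 (π - x2) with h | h
      · refine (min_le_left _ _).trans (hmono _ _ ((min_le_left _ _).trans ?_)); linarith
      · refine (min_le_right _ _).trans (hmono _ _ ((min_le_right _ _).trans ?_)); linarith)
    (level_antitone φ) (level_mem φ)
    ωm ωc ωn (fun c c' h3 h4 h5 => sub_le_modulus_level ωm ω0 hc hpφ hφ h4 h3 h5)
  rw [hsw] at step1
  refine (step1.trans (step2.trans step3)).trans (le_of_eq ?_)
  have h3 := intervalIntegral.integral_comp_sub_left (a := 0) (b := π / 2)
    (fun x => ω (π - 2 * x) * (4 / π * core k x)) (π / 2)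
  rw [sub_self, sub_zero] at h3
  rw [← h3, ← intervalIntegral.integral_const_mul]
  refine intervalIntegral.integral_congr fun t ht => ?_
  rw [uIcc_of_le (by positivity)] at ht
  have e2 : core k (π / 2 - t) = ∫ s in (π / 2 - t)..(π / 2 + t), ConjClass.green S s := by
    unfold core
    rw [min_eq_left (by linarith [ht.1]), show π - (π / 2 - t) = π / 2 + t by ring]
    refine intervalIntegral.integral_congr fun s hs => ?_
    rw [uIcc_of_le (by linarith [ht.1])] at hs
    exact ke ⟨by linarith [hs.1, ht.2], by linarith [hs.2, ht.2]⟩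
  rw [e2, show π - 2 * (π / 2 - t) = 2 * t by ring]
  ring

/-- Integration by parts against a convolution. -/
lemma IsKer.integral_deriv_mul_conv {S ψ χ H e : ℝ → ℝ} (hS : IsKer S)
    (hd : ∀ x, HasDerivAt ψ (χ x) x) {C : ℝ} (hL : ∀ x y, |χ x - χ y| ≤ C * |x - y|)
    (hp : Function.Periodic ψ (2 * π)) (hH : ∀ x, HasDerivAt H (e x) x) (he : Continuous e)
    (hpH : Function.Periodic H (2 * π)) :
    ∫ x in Ioc 0 (2 * π), e x * conv S ψ x = - ∫ x in Ioc 0 (2 * π), H x * conv S χ x := by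
  have hχ : Continuous χ := continuous_of_lip hL
  obtain ⟨C', -, hL'⟩ := exists_lipschitz_of_periodic hd hχ (periodic_deriv hd hp)
  have hHc : Continuous H :=
    (show Differentiable ℝ H from fun x => (hH x).differentiableAt).continuous
  obtain ⟨M, -, hM⟩ := exists_bound_of_periodic hHc hpH
  obtain ⟨M', -, hM'⟩ := exists_bound_of_periodic he (periodic_deriv hH hpH)
  rw [hS.integral_mul_conv hL' he.measurable hM', hS.integral_mul_conv hL hHc.measurable hM,
    ← integral_neg]
  congr 1; ext t
  rw [← mul_neg]
  congr 1
  have := intervalIntegral.integral_mul_deriv_eq_deriv_mul (a := 0) (b := 2 * π)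
    (u := fun x => ψ (x + t) - ψ (x - t)) (u' := fun x => χ (x + t) - χ (x - t)) (v := H) (v' := e)
    (fun x _ => ((hd (x + t)).comp_add_const x t).sub ((hd (x - t)).comp_sub_const x t))
    (fun x _ => hH x) (Continuous.intervalIntegrable (by fun_prop) _ _)
    (he.intervalIntegrable _ _)
  rw [show 2 * π + t = 0 + t + 2 * π by ring, show 2 * π - t = 0 - t + 2 * π by ring, hp, hp,
    show 2 * π = 0 + 2 * π by ring, hpH, sub_self, zero_sub, zero_add,
    intervalIntegral.integral_of_le two_pi_pos.le, intervalIntegral.integral_of_le two_pi_pos.le]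
    at this
  simpa only [mul_comm] using this

lemma IsKer.integral_abs_conv_primitive_le {S ψ χ φ ω : ℝ → ℝ} (hS : IsKer S)
    (hω : IsConcaveModulus ω) (hd' : ∀ x, HasDerivAt ψ (χ x) x)
    (hd : ∀ x, HasDerivAt χ (φ x) x) (hc : Continuous φ) (hp : Function.Periodic ψ (2 * π))
    (hφ : ∀ x y, |φ x - φ y| ≤ ω |x - y|) :
    (1 / π) * ∫ x in Ioc 0 (2 * π), |conv S ψ x| ≤ (4 / π) * ∫ t in (0:ℝ)..(π / 2),
      ω (2 * t) * ∫ s in (π / 2 - t)..(π / 2 + t), ConjClass.green S s := by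
  have hpχ := periodic_deriv hd' hp
  obtain ⟨C, -, hL⟩ := exists_lipschitz_of_periodic hd hc (periodic_deriv hd hpχ)
  have hχ : Continuous χ := continuous_of_lip hL
  obtain ⟨C', -, hL'⟩ := exists_lipschitz_of_periodic hd' hχ hpχ
  have hgc := hS.continuous_conv hL'
  have hgp := periodic_conv (S := S) hp
  refine le_of_forall_pos_le_add fun ε hε => ?_
  set h : ℝ → ℝ := fun x => conv S ψ x / (|conv S ψ x| + ε / 2) with hh
  have hpos : ∀ x, 0 < |conv S ψ x| + ε / 2 := fun x => by positivity
  have hhc : Continuous h := hgc.div (by fun_prop) fun x => (hpos x).ne'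
  have hhp : Function.Periodic h (2 * π) := fun x => by simp only [hh, hgp x]
  have hh1 : ∀ x, |h x| ≤ 1 := fun x => by
    simp only [hh]
    rw [abs_div, abs_of_pos (hpos x), div_le_one (hpos x)]
    linarith
  set m : ℝ := (1 / (2 * π)) * ∫ x in Ioc 0 (2 * π), h x with hmd
  have hm1 : |m| ≤ 1 := by
    have := norm_setIntegral_le_of_norm_le_const (μ := volume) (s := Ioc 0 (2 * π))
        (C := 1) (f := h) measure_Ioc_lt_top fun x _ => hh1 x
    rw [Real.volume_real_Ioc_of_le two_pi_pos.le, sub_zero, one_mul, Real.norm_eq_abs] at this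
    rw [hmd, abs_mul, abs_of_pos (by positivity), one_div, inv_mul_le_iff₀ two_pi_pos, mul_one]
    exact this
  set H : ℝ → ℝ := fun x => ∫ y in (0:ℝ)..x, (h y - m) with hHd
  have hH : ∀ x, HasDerivAt H (h x - m) x := fun x =>
    intervalIntegral.integral_hasDerivAt_right ((hhc.sub continuous_const).intervalIntegrable _ _)
      ((hhc.sub continuous_const).stronglyMeasurableAtFilter _ _)
      (hhc.sub continuous_const).continuousAt
  have hpH : Function.Periodic H (2 * π) := fun x => by
    have h1 := intervalIntegral.integral_add_adjacent_intervals
      ((hhc.sub (continuous_const (y := m))).intervalIntegrable (μ := volume) 0 x)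
      ((hhc.sub (continuous_const (y := m))).intervalIntegrable (μ := volume) x (x + 2 * π))
    have h2 := integral_period (g := fun y => h y - m) (fun y => by simp only [hhp y]) x
    rw [integral_sub (hhc.integrableOn_Icc.mono_set Ioc_subset_Icc_self)
      (integrableOn_const measure_Ioc_lt_top.ne), setIntegral_const, Real.volume_real_Ioc_of_le two_pi_pos.le,
      smul_eq_mul, sub_zero] at h2
    have h3 : 2 * π * m = ∫ x in Ioc 0 (2 * π), h x := by rw [hmd]; field_simp
    simp only [Pi.sub_apply] at h1
    simp only [hHd]
    rw [← h1, ← h2, h3, sub_self, add_zero]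
  have key := hS.integral_primitive_mul_conv_le (H := fun x => - H x) (h := fun x => - h x)
    (m := -m) hω hd hc hpχ hφ (by rwa [abs_neg]) (fun x => by rw [abs_neg]; exact hh1 x)
    (fun x => by
      have := (hH x).neg
      rwa [show -(h x - m) = -h x - -m by ring] at this) (fun x => by simp only [hpH x])
  have hby := hS.integral_deriv_mul_conv hd' hL hp hH (hhc.sub continuous_const) hpH
  simp only [neg_mul] at key
  rw [integral_neg, ← hby] at key
  have hgi : IntegrableOn (conv S ψ) (Ioc 0 (2 * π)) :=
    hgc.integrableOn_Icc.mono_set Ioc_subset_Icc_self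
  have hhg : IntegrableOn (fun x => h x * conv S ψ x) (Ioc 0 (2 * π)) :=
    (hhc.mul hgc).integrableOn_Icc.mono_set Ioc_subset_Icc_self
  have e1 : ∫ x in Ioc 0 (2 * π), (h x - m) * conv S ψ x =
      ∫ x in Ioc 0 (2 * π), h x * conv S ψ x := by
    simp only [sub_mul]
    rw [integral_sub hhg (hgi.const_mul m), integral_const_mul, integral_conv_eq_zero hS hL' hp, mul_zero, sub_zero]
  rw [e1] at key
  have e2 : ∫ x in Ioc 0 (2 * π), |conv S ψ x| ≤
      ∫ x in Ioc 0 (2 * π), (h x * conv S ψ x + ε / 2) := by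
    refine integral_mono hgi.abs (hhg.add (integrableOn_const measure_Ioc_lt_top.ne)) fun x => ?_
    have : h x * conv S ψ x = |conv S ψ x| ^ 2 / (|conv S ψ x| + ε / 2) := by
      simp only [hh]; rw [sq_abs]; ring
    simp only
    rw [this, ← sub_le_iff_le_add, le_div_iff₀ (hpos x)]
    nlinarith
  rw [integral_add hhg (integrableOn_const measure_Ioc_lt_top.ne), setIntegral_const, Real.volume_real_Ioc_of_le two_pi_pos.le,
    smul_eq_mul, sub_zero] at e2
  have e3 := mul_le_mul_of_nonneg_left e2 (by positivity : 0 ≤ 1 / π)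
  rw [mul_add, show 1 / π * (2 * π * (ε / 2)) = ε by field_simp] at e3
  linarith

lemma arcsin_sin_eq (x : ℝ) :
    arcsin (sin x) = π / 2 - ‖((x - π / 2 : ℝ) : AddCircle (2 * π))‖ := by
  have hp1 : Function.Periodic (fun x => arcsin (sin x)) (2 * π) := fun x => by
    simp only [sin_add_two_pi]
  have hp2 : Function.Periodic (fun x => π / 2 - ‖((x - π / 2 : ℝ) : AddCircle (2 * π))‖)
      (2 * π) := fun x => by
    simp only
    rw [show x + 2 * π - π / 2 = x - π / 2 + 2 * π by ring, AddCircle.coe_add_period]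
  have hp := hp1.sub hp2
  obtain ⟨y, hy, hxy⟩ := hp.exists_mem_Ico two_pi_pos x (-(π / 2))
  simp only [Pi.sub_apply] at hxy
  rw [← sub_eq_zero, hxy, sub_eq_zero]
  have hn : ‖((y - π / 2 : ℝ) : AddCircle (2 * π))‖ = |y - π / 2| := by
    rw [AddCircle.norm_coe_eq_abs_iff _ two_pi_pos.ne', abs_of_pos two_pi_pos, abs_le]
    constructor <;> linarith [hy.1, hy.2]
  rw [hn]
  rcases le_total y (π / 2) with h | h
  · rw [arcsin_sin hy.1 h, abs_of_nonpos (by linarith)]; ring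
  · rw [← sin_pi_sub, arcsin_sin (by linarith [hy.2]) (by linarith), abs_of_nonneg (by linarith)]
    ring

lemma abs_arcsin_sin_sub_le (x y : ℝ) : |arcsin (sin x) - arcsin (sin y)| ≤ |x - y| := by
  rw [arcsin_sin_eq, arcsin_sin_eq, sub_sub_sub_cancel_left, abs_sub_comm]
  refine (abs_norm_sub_norm_le _ _).trans ?_
  rw [← AddCircle.coe_sub, sub_sub_sub_cancel_right]
  exact QuotientAddGroup.norm_mk_le_norm

/-- The odd function equal to `ω (2 u) / 2` for `u ≥ 0`. -/
def oddHalf (ω : ℝ → ℝ) (u : ℝ) : ℝ := (ω (2 * max u 0) - ω (2 * max (-u) 0)) / 2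

lemma oddHalf_of_nonneg {ω : ℝ → ℝ} (h0 : ω 0 = 0) {u : ℝ} (hu : 0 ≤ u) :
    oddHalf ω u = ω (2 * u) / 2 := by
  unfold oddHalf
  rw [max_eq_left hu, max_eq_right (by linarith), mul_zero, h0, sub_zero]

lemma oddHalf_neg (ω : ℝ → ℝ) (u : ℝ) : oddHalf ω (-u) = - oddHalf ω u := by
  unfold oddHalf
  rw [neg_neg]; ring

lemma abs_oddHalf_sub_le {ω : ℝ → ℝ} (hω : IsConcaveModulus ω) (u v : ℝ) :
    |oddHalf ω u - oddHalf ω v| ≤ ω |u - v| := by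
  obtain ⟨-, ωm, ω0, ωs, ωn, ωcc⟩ := hω
  have pos : ∀ u v : ℝ, 0 ≤ v → v ≤ u → |oddHalf ω u - oddHalf ω v| ≤ ω |u - v| := by
    intro u v hv huv
    rw [oddHalf_of_nonneg ω0 hv, oddHalf_of_nonneg ω0 (hv.trans huv), abs_of_nonneg (sub_nonneg.2 huv),
      abs_of_nonneg]
    · have h1 := ωs (2 * v) (2 * (u - v)) (by linarith) (by linarith)
      have h2 := ωs (u - v) (u - v) (by linarith) (by linarith)
      rw [show 2 * v + 2 * (u - v) = 2 * u by ring] at h1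
      rw [show u - v + (u - v) = 2 * (u - v) by ring] at h2
      linarith
    · have := ωm (show 2 * v ∈ Ici (0:ℝ) from by simp only [mem_Ici]; linarith)
        (show 2 * u ∈ Ici (0:ℝ) from by simp only [mem_Ici]; linarith) (by linarith)
      linarith
  wlog huv : v ≤ u generalizing u v
  · rw [abs_sub_comm, abs_sub_comm u]; exact this v u (le_of_not_ge huv)
  rcases le_total 0 v with hv | hv
  · exact pos u v hv huv
  rcases le_total 0 u with hu | hu
  · have e : oddHalf ω v = - (ω (2 * -v) / 2) := by
      rw [← oddHalf_of_nonneg ω0 (by linarith), oddHalf_neg, neg_neg]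
    have n1 := ωn (2 * u) (by linarith)
    have n2 := ωn (2 * -v) (by linarith)
    have := ωcc.2 (show 2 * u ∈ Ici (0:ℝ) from by simp only [mem_Ici]; linarith)
      (show 2 * -v ∈ Ici (0:ℝ) from by simp only [mem_Ici]; linarith)
      (show (0:ℝ) ≤ 1 / 2 by norm_num) (show (0:ℝ) ≤ 1 / 2 by norm_num) (by norm_num)
    simp only [smul_eq_mul] at this
    rw [show 1 / 2 * (2 * u) + 1 / 2 * (2 * -v) = u - v by ring] at this
    rw [e, oddHalf_of_nonneg ω0 hu, abs_of_nonneg (sub_nonneg.2 huv), abs_of_nonneg (by linarith)]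
    linarith
  · have := pos (-v) (-u) (by linarith) (by linarith)
    rwa [oddHalf_neg, oddHalf_neg, neg_sub_neg, neg_sub_neg] at this

/-- The extremal highest derivative. -/
def extremal (ω : ℝ → ℝ) (x : ℝ) : ℝ := oddHalf ω (arcsin (sin x))

lemma abs_extremal_sub_le {ω : ℝ → ℝ} (hω : IsConcaveModulus ω) (x y : ℝ) :
    |extremal ω x - extremal ω y| ≤ ω |x - y| :=
  (abs_oddHalf_sub_le hω _ _).trans
    (hω.2.1 (mem_Ici.2 (abs_nonneg _)) (mem_Ici.2 (abs_nonneg _)) (abs_arcsin_sin_sub_le x y))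

lemma continuous_extremal {ω : ℝ → ℝ} (hω : Continuous ω) : Continuous (extremal ω) := by
  unfold extremal oddHalf
  have := continuous_arcsin
  fun_prop

lemma extremal_neg (ω : ℝ → ℝ) (x : ℝ) : extremal ω (-x) = - extremal ω x := by
  unfold extremal
  rw [sin_neg, arcsin_neg, oddHalf_neg]

lemma extremal_pi_sub (ω : ℝ → ℝ) (x : ℝ) : extremal ω (π - x) = extremal ω x := by
  unfold extremal
  rw [sin_pi_sub]

lemma extremal_antiperiodic (ω : ℝ → ℝ) : Function.Antiperiodic (extremal ω) π := fun x => by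
  unfold extremal
  rw [sin_add_pi, arcsin_neg, oddHalf_neg]

lemma extremal_eq {ω : ℝ → ℝ} (h0 : ω 0 = 0) {x : ℝ} (hx : x ∈ Icc 0 (π / 2)) :
    extremal ω x = ω (2 * x) / 2 := by
  unfold extremal
  rw [arcsin_sin (by linarith [hx.1, pi_pos]) hx.2, oddHalf_of_nonneg h0 hx.1]

/-- The antiperiodic primitive of an antiperiodic function. -/
def prim (ψ : ℝ → ℝ) (x : ℝ) : ℝ := (∫ y in (0:ℝ)..x, ψ y) - (∫ y in (0:ℝ)..π, ψ y) / 2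

lemma hasDerivAt_prim {ψ : ℝ → ℝ} (hψ : Continuous ψ) (x : ℝ) : HasDerivAt (prim ψ) (ψ x) x :=
  (intervalIntegral.integral_hasDerivAt_right (hψ.intervalIntegrable _ _)
    (hψ.stronglyMeasurableAtFilter _ _) hψ.continuousAt).sub_const _

lemma prim_antiperiodic {ψ : ℝ → ℝ} (hψ : Continuous ψ) (ha : Function.Antiperiodic ψ π) :
    Function.Antiperiodic (prim ψ) π := fun x => by
  have h1 := intervalIntegral.integral_add_adjacent_intervals
    (hψ.intervalIntegrable (μ := volume) 0 π) (hψ.intervalIntegrable (μ := volume) π (x + π))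
  have h2 := intervalIntegral.integral_comp_add_right (a := 0) (b := x) ψ π
  simp only [ha _, zero_add] at h2
  rw [intervalIntegral.integral_neg] at h2
  unfold prim
  rw [← h1, ← h2]; ring

lemma prim_iterate {ψ : ℝ → ℝ} (hψ : Continuous ψ) (ha : Function.Antiperiodic ψ π) (r : ℕ) :
    Function.Antiperiodic (prim^[r] ψ) π ∧ ContDiff ℝ r (prim^[r] ψ) ∧
      iteratedDeriv r (prim^[r] ψ) = ψ := by
  induction r with
  | zero => exact ⟨ha, by simpa using hψ, by simp⟩
  | succ r ih =>
    obtain ⟨h1, h2, h3⟩ := ih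
    rw [Function.iterate_succ_apply']
    have hd : deriv (prim (prim^[r] ψ)) = prim^[r] ψ :=
      funext fun x => (hasDerivAt_prim h2.continuous x).deriv
    refine ⟨prim_antiperiodic h2.continuous h1, ?_, ?_⟩
    · rw [Nat.cast_add, Nat.cast_one, contDiff_succ_iff_deriv]
      refine ⟨fun x => (hasDerivAt_prim h2.continuous x).differentiableAt, by simp, ?_⟩
      rwa [hd]
    · rw [iteratedDeriv_succ', hd, h3]

lemma IsKer.le_integral_abs_conv {S ψ χ : ℝ → ℝ} (hS : IsKer S) (hd : ∀ x, HasDerivAt ψ (χ x) x)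
    (hc : Continuous χ) (hp : Function.Periodic ψ (2 * π)) (a : ℝ) :
    2 * |∫ t in Ioo 0 π, ConjClass.green S t * (χ (a + π + t) - χ (a + t) - χ (a + π - t) +
      χ (a - t))| ≤ ∫ x in Ioc 0 (2 * π), |conv S ψ x| := by
  obtain ⟨C, -, hL⟩ := exists_lipschitz_of_periodic hd hc (periodic_deriv hd hp)
  have hψ : Continuous ψ := continuous_of_lip hL
  have hgc := hS.continuous_conv hL
  have hgp := periodic_conv (S := S) hp
  set X : ℝ → ℝ := fun y => ∫ u in (0:ℝ)..y, ψ u with hX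
  have hXd : ∀ x, HasDerivAt X (ψ x) x := fun x =>
    intervalIntegral.integral_hasDerivAt_right (hψ.intervalIntegrable _ _)
      (hψ.stronglyMeasurableAtFilter _ _) hψ.continuousAt
  have plus : ∀ {F F' : ℝ → ℝ}, (∀ x, HasDerivAt F (F' x) x) → ∀ c t,
      HasDerivAt (fun t => F (c + t)) (F' (c + t)) t := fun h c t => (h (c + t)).comp_const_add c t
  have minus : ∀ {F F' : ℝ → ℝ}, (∀ x, HasDerivAt F (F' x) x) → ∀ c t,
      HasDerivAt (fun t => F (c - t)) (-F' (c - t)) t := fun h c t => (h (c - t)).comp_const_sub c t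
  have hP : ∀ t, ∫ x in Ioc a (a + π), (1:ℝ) * (ψ (x + t) - ψ (x - t)) =
      X (a + π + t) - X (a + t) - X (a + π - t) + X (a - t) := fun t => by
    simp only [one_mul]
    rw [← intervalIntegral.integral_of_le (by linarith [pi_pos]), intervalIntegral.integral_sub
      (Continuous.intervalIntegrable (by fun_prop) _ _)
      (Continuous.intervalIntegrable (by fun_prop) _ _),
      intervalIntegral.integral_comp_add_right (f := ψ),
      intervalIntegral.integral_comp_sub_right (f := ψ),
      ← intervalIntegral.integral_interval_sub_left (hψ.intervalIntegrable 0 _)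
        (hψ.intervalIntegrable 0 _),
      ← intervalIntegral.integral_interval_sub_left (a := 0) (b := a + π - t)
        (hψ.intervalIntegrable 0 _) (hψ.intervalIntegrable 0 _)]
    simp only [hX]; ring
  have key := hS.integral_green_mul_deriv2
    (D := fun t => X (a + π + t) - X (a + t) - X (a + π - t) + X (a - t))
    (D' := fun t => ψ (a + π + t) - ψ (a + t) + ψ (a + π - t) - ψ (a - t))
    (D'' := fun t => χ (a + π + t) - χ (a + t) - χ (a + π - t) + χ (a - t))
    (fun t => by
      have := (((plus hXd (a + π) t).sub (plus hXd a t)).sub (minus hXd (a + π) t)).add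
        (minus hXd a t)
      refine this.congr_deriv ?_; ring)
    (fun t => by
      have := (((plus hd (a + π) t).sub (plus hd a t)).add (minus hd (a + π) t)).sub
        (minus hd a t)
      refine this.congr_deriv ?_; ring)
    (by fun_prop) (by simp) (by
      have e : ∀ x, ψ (x + π) - ψ (x - π) = 0 := fun x => by
        rw [show x + π = x - π + 2 * π by ring, hp, sub_self]
      rw [← hP π]
      simp [e])
  have e1 := hS.integral_mul_conv hL (β := fun _ => 1) measurable_const (M := 1) (by simp) a (a + π)
  simp only [hP] at e1
  rw [key, ← e1, abs_neg]
  simp only [one_mul]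
  rw [← intervalIntegral.integral_of_le (by linarith [pi_pos]),
    integral_period (g := fun x => |conv S ψ x|) (fun x => by simp only [hgp x]) a,
    ← intervalIntegral.integral_add_adjacent_intervals (b := a + π)
      (hgc.abs.intervalIntegrable _ _) (hgc.abs.intervalIntegrable _ _)]
  have z := integral_conv_eq_zero hS hL hp
  rw [integral_period hgp a,
    ← intervalIntegral.integral_add_adjacent_intervals (b := a + π)
      (hgc.intervalIntegrable _ _) (hgc.intervalIntegrable _ _)] at z
  have i1 := intervalIntegral.abs_integral_le_integral_abs (f := conv S ψ) (μ := volume)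
    (show a ≤ a + π by linarith [pi_pos])
  have i2 := intervalIntegral.abs_integral_le_integral_abs (f := conv S ψ) (μ := volume)
    (show a + π ≤ a + 2 * π by linarith [pi_pos])
  rw [← neg_eq_of_add_eq_zero_right z, abs_neg] at i2
  linarith

lemma le_odd {S χ ω : ℝ → ℝ} (hS : IsKer S) (hω : IsConcaveModulus ω)
    (hd : ∀ x, HasDerivAt χ (extremal ω x) x) (hp : Function.Periodic χ (2 * π)) :
    (4 / π) * ∫ t in (0:ℝ)..(π / 2), ω (2 * t) * (green S t + green S (π - t)) ≤
      (1 / π) * ∫ x in Ioc 0 (2 * π), |conv S χ x| := by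
  have hc := continuous_extremal hω.1
  have h := hS.le_integral_abs_conv hd hc hp 0
  obtain ⟨k, kc, k0, ke⟩ := exists_continuous_extension hS.continuousOn_green
    fun t ht => hS.green_nonneg ht
  have e1 : ∫ t in Ioo 0 π, green S t * (extremal ω (0 + π + t) - extremal ω (0 + t) -
      extremal ω (0 + π - t) + extremal ω (0 - t)) =
      -(2 * ∫ t in (0:ℝ)..(π / 2), ω (2 * t) * (green S t + green S (π - t))) := by
    have e2 : ∫ t in Ioo 0 π, green S t * (extremal ω (0 + π + t) - extremal ω (0 + t) -
      extremal ω (0 + π - t) + extremal ω (0 - t)) = ∫ t in (0:ℝ)..π, -4 * (k t * extremal ω t) := by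
      rw [intervalIntegral.integral_of_le pi_pos.le, integral_Ioc_eq_integral_Ioo]
      refine setIntegral_congr_fun measurableSet_Ioo fun t ht => ?_
      simp only [zero_add, zero_sub]
      rw [add_comm π t, extremal_antiperiodic, extremal_pi_sub, extremal_neg,
        ke (Ioo_subset_Icc_self ht)]
      ring
    have hke : Continuous fun t => k t * extremal ω t := kc.mul hc
    have e3 := intervalIntegral.integral_comp_sub_left (a := 0) (b := π / 2)
      (fun t => k t * extremal ω t) π
    rw [sub_zero, show π - π / 2 = π / 2 by ring] at e3
    rw [e2, intervalIntegral.integral_const_mul,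
      ← intervalIntegral.integral_add_adjacent_intervals (b := π / 2)
      (hke.intervalIntegrable _ _) (hke.intervalIntegrable _ _), ← e3,
      ← intervalIntegral.integral_add (hke.intervalIntegrable _ _)
        (Continuous.intervalIntegrable (by fun_prop) _ _), ← neg_mul,
      ← intervalIntegral.integral_const_mul, ← intervalIntegral.integral_const_mul]
    refine intervalIntegral.integral_congr fun t ht => ?_
    rw [uIcc_of_le (by positivity)] at ht
    rw [extremal_pi_sub, extremal_eq hω.2.2.1 ht, ke ⟨ht.1, by linarith [ht.2, pi_pos]⟩,
      ke ⟨by linarith [ht.2, pi_pos], by linarith [ht.1]⟩]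
    ring
  rw [e1, abs_neg] at h
  have h2 := mul_le_mul_of_nonneg_left ((mul_le_mul_of_nonneg_left (le_abs_self _)
    two_pos.le).trans h) (by positivity : 0 ≤ 1 / π)
  refine le_trans (le_of_eq ?_) h2
  ring

lemma le_even {S ψ χ ω : ℝ → ℝ} (hS : IsKer S) (hω : IsConcaveModulus ω)
    (hd' : ∀ x, HasDerivAt ψ (χ x) x)
    (hd : ∀ x, HasDerivAt χ (extremal ω x) x) (hp : Function.Periodic ψ (2 * π)) :
    (4 / π) * ∫ t in (0:ℝ)..(π / 2), ω (2 * t) * ∫ s in (π / 2 - t)..(π / 2 + t), green S s ≤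
      (1 / π) * ∫ x in Ioc 0 (2 * π), |conv S ψ x| := by
  have hc := continuous_extremal hω.1
  have hχ : Continuous χ := (show Differentiable ℝ χ from fun x => (hd x).differentiableAt).continuous
  have h := hS.le_integral_abs_conv hd' hχ hp (-(π / 2))
  obtain ⟨k, kc, k0, ke⟩ := exists_continuous_extension hS.continuousOn_green
    fun t ht => hS.green_nonneg ht
  have hE : ∀ a b, ∫ x in a..b, extremal ω x = χ b - χ a := fun a b =>
    intervalIntegral.integral_eq_sub_of_hasDerivAt (fun y _ => hd y) (hc.intervalIntegrable _ _)
  have odd : ∀ a b, ∫ x in (-b)..(-a), extremal ω x = - ∫ x in a..b, extremal ω x := fun a b => by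
    rw [← intervalIntegral.integral_comp_neg]
    simp only [extremal_neg, intervalIntegral.integral_neg]
  have refl : ∀ a b, ∫ x in (π - b)..(π - a), extremal ω x = ∫ x in a..b, extremal ω x :=
    fun a b => by
      rw [← intervalIntegral.integral_comp_sub_left]
      simp only [extremal_pi_sub]
  have hD : ∀ t, χ (-(π / 2) + π + t) - χ (-(π / 2) + t) - χ (-(π / 2) + π - t) +
      χ (-(π / 2) - t) = 4 * ∫ x in (π / 2 - t)..(π / 2), extremal ω x := fun t => by
    have h1 := odd (π / 2 - t) (π / 2 + t)
    have h2 := refl (π / 2 - t) (π / 2)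
    simp only [hE] at h1 h2 ⊢
    rw [show -(π / 2) + π + t = π / 2 + t by ring, show -(π / 2) + π - t = π / 2 - t by ring]
    rw [show -(π / 2 - t) = -(π / 2) + t by ring, show -(π / 2 + t) = -(π / 2) - t by ring] at h1
    rw [show π - (π / 2 - t) = π / 2 + t by ring, show π - π / 2 = π / 2 by ring] at h2
    linarith
  simp only [hD] at h
  set T : Set (ℝ × ℝ) := {p | |π / 2 - p.1| < p.2} with hT
  have hTm : MeasurableSet T := measurableSet_lt (by fun_prop) measurable_snd
  have hki : IntegrableOn k (Ioo 0 π) := kc.integrableOn_Icc.mono_set Ioo_subset_Icc_self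
  have hei : IntegrableOn (extremal ω) (Ioo 0 (π / 2)) :=
    hc.integrableOn_Icc.mono_set Ioo_subset_Icc_self
  have hInt : Integrable (fun p : ℝ × ℝ => T.indicator 1 p * (k p.1 * extremal ω p.2))
      ((volume.restrict (Ioo 0 π)).prod (volume.restrict (Ioo 0 (π / 2)))) := by
    refine ((hki.mul_prod hei).indicator hTm).congr (Eventually.of_forall fun p => ?_)
    by_cases h : p ∈ T <;> simp [h]
  have hs := integral_integral_swap
    (f := fun t u => T.indicator (1 : ℝ × ℝ → ℝ) (t, u) * (k t * extremal ω u)) hInt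
  have e1 : ∫ t in Ioo 0 π, green S t * (4 * ∫ x in (π / 2 - t)..(π / 2), extremal ω x) =
      4 * ∫ t in Ioo 0 π, ∫ u in Ioo 0 (π / 2),
        T.indicator (1 : ℝ × ℝ → ℝ) (t, u) * (k t * extremal ω u) := by
    rw [← integral_const_mul]
    refine setIntegral_congr_fun measurableSet_Ioo fun t ht => ?_
    have e : ∀ u, T.indicator (1 : ℝ × ℝ → ℝ) (t, u) * (k t * extremal ω u) =
        k t * (Ioi |π / 2 - t|).indicator (extremal ω) u := fun u => by
      by_cases h : |π / 2 - t| < u <;> simp [hT, h]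
    have habs : |π / 2 - t| ≤ π / 2 := abs_le.2 ⟨by linarith [ht.2], by linarith [ht.1]⟩
    simp only [e]
    rw [integral_const_mul, setIntegral_indicator measurableSet_Ioi,
      ke (Ioo_subset_Icc_self ht), Ioo_inter_Ioi, sup_eq_right.2 (abs_nonneg _),
      ← integral_Ioc_eq_integral_Ioo, ← intervalIntegral.integral_of_le habs]
    rcases le_total t (π / 2) with h | h
    · rw [abs_of_nonneg (by linarith)]; ring
    · rw [abs_of_nonpos (by linarith)]
      have h1 := odd (π / 2 - t) (-(π / 2 - t))
      rw [neg_neg] at h1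
      have h2 := intervalIntegral.integral_add_adjacent_intervals
        (hc.intervalIntegrable (μ := volume) (π / 2 - t) (-(π / 2 - t)))
        (hc.intervalIntegrable (μ := volume) (-(π / 2 - t)) (π / 2))
      have h3 : ∫ x in (π / 2 - t)..(-(π / 2 - t)), extremal ω x = 0 := by linarith
      rw [← h2, h3]; ring
  have e2 : ∫ u in Ioo 0 (π / 2), ∫ t in Ioo 0 π,
      T.indicator (1 : ℝ × ℝ → ℝ) (t, u) * (k t * extremal ω u) =
      (1 / 2) * ∫ t in (0:ℝ)..(π / 2), ω (2 * t) * ∫ s in (π / 2 - t)..(π / 2 + t), green S s := by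
    rw [intervalIntegral.integral_of_le (by positivity), integral_Ioc_eq_integral_Ioo,
      ← integral_const_mul]
    refine setIntegral_congr_fun measurableSet_Ioo fun u hu => ?_
    have e : ∀ t, T.indicator (1 : ℝ × ℝ → ℝ) (t, u) * (k t * extremal ω u) =
        (Ioo (π / 2 - u) (π / 2 + u)).indicator k t * extremal ω u := fun t => by
      have : |π / 2 - t| < u ↔ π / 2 - u < t ∧ t < π / 2 + u := by
        rw [abs_lt]; constructor <;> rintro ⟨a, b⟩ <;> constructor <;> linarith
      by_cases h : |π / 2 - t| < u
      · simp [hT, h, this.1 h]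
      · have h' : t ∉ Ioo (π / 2 - u) (π / 2 + u) := fun h2 => h (this.2 h2)
        rw [indicator_of_notMem h']
        simp [hT, h]
    simp only [e]
    rw [integral_mul_const, setIntegral_indicator measurableSet_Ioo,
      inter_eq_right.2 (Ioo_subset_Ioo (by linarith [hu.2]) (by linarith [hu.2])),
      extremal_eq hω.2.2.1 (Ioo_subset_Icc_self hu),
      intervalIntegral.integral_of_le (by linarith [hu.1]), integral_Ioc_eq_integral_Ioo,
      setIntegral_congr_fun (g := green S) measurableSet_Ioo fun s hs =>
        ke ⟨by linarith [hs.1, hu.2], by linarith [hs.2, hu.2]⟩]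
    ring
  rw [e1, hs, e2] at h
  have h2 := mul_le_mul_of_nonneg_left ((mul_le_mul_of_nonneg_left (le_abs_self _)
    two_pos.le).trans h) (by positivity : 0 ≤ 1 / π)
  refine le_trans (le_of_eq ?_) h2
  ring

lemma lipschitz_of_contDiff {f : ℝ → ℝ} {r : ℕ} (hr : 1 ≤ r) (hf : ContDiff ℝ r f)
    (hp : Function.Periodic f (2 * π)) : ∃ C, 0 ≤ C ∧ ∀ x y, |f x - f y| ≤ C * |x - y| := by
  have h1 : ContDiff ℝ 1 f := hf.of_le (by exact_mod_cast hr)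
  have hd : ∀ x, HasDerivAt f (deriv f x) x := fun x =>
    (h1.differentiable one_ne_zero x).hasDerivAt
  exact exists_lipschitz_of_periodic hd (h1.continuous_deriv le_rfl) (periodic_deriv hd hp)

lemma integral_abs_conjFn_eq {f g : ℝ → ℝ} {r : ℕ} (hr : 1 ≤ r) (hf : ContDiff ℝ r f)
    (hp : Function.Periodic f (2 * π)) (hg : ConjFn f g) (k : ℕ) (hk : 2 * k ≤ r) :
    ∫ t in (0:ℝ)..(2 * π), |g t| =
      (1 / π) * ∫ x in Ioc 0 (2 * π), |conv (ker k) (iteratedDeriv (2 * k) f) x| := by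
  obtain ⟨C, -, hL⟩ := lipschitz_of_contDiff hr hf hp
  rw [intervalIntegral.integral_of_le two_pi_pos.le, ← integral_const_mul]
  congr 1 with x
  rw [conjFn_eq hL hg x, conv_cotKer_eq hf hp k hk x, abs_mul, abs_mul, abs_neg, abs_pow,
    abs_neg, abs_one, one_pow, one_mul, abs_of_pos (by positivity)]

/-- The sharp constant, expressed through the iterated kernels. -/
lemma exists_sharp_constant {ω : ℝ → ℝ} (hω : IsConcaveModulus ω) {r : ℕ} (hr : 1 ≤ r) :
    ∃ k, 2 * k ≤ r ∧
    (∀ f : ℝ → ℝ, MemWrH r ω f →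
      (1 / π) * ∫ x in Ioc 0 (2 * π), |conv (ker k) (iteratedDeriv (2 * k) f) x| ≤
      4 * ∑' i : ℕ, (-1 : ℝ) ^ (i * (r + 1)) *
        ((2 / π) * ∫ t in (0:ℝ)..(π / 2), ω (2 * t) * Real.sin ((2 * i + 1) * t)) /
          (2 * (i : ℝ) + 1) ^ (r + 1)) ∧
    (∀ f : ℝ → ℝ, MemWrH r ω f → iteratedDeriv r f = extremal ω →
      4 * ∑' i : ℕ, (-1 : ℝ) ^ (i * (r + 1)) *
        ((2 / π) * ∫ t in (0:ℝ)..(π / 2), ω (2 * t) * Real.sin ((2 * i + 1) * t)) /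
          (2 * (i : ℝ) + 1) ^ (r + 1) ≤
      (1 / π) * ∫ x in Ioc 0 (2 * π), |conv (ker k) (iteratedDeriv (2 * k) f) x|) := by
  obtain ⟨k, rfl | rfl⟩ : ∃ k, r = 2 * k + 1 ∨ r = 2 * k + 2 := ⟨(r - 1) / 2, by omega⟩
  · refine ⟨k, by omega, fun f hf => ?_, fun f hf he => ?_⟩ <;> obtain ⟨hp, hc, hm⟩ := hf
    · rw [tsum_odd hω.1, ker_succ]
      exact (isKer_ker k).integral_abs_conv_le hω
        (hasDerivAt_iteratedDeriv hc (Nat.lt_succ_self (2 * k)))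
        (hc.continuous_iteratedDeriv _ le_rfl) (periodic_iteratedDeriv hp _) hm
    · rw [tsum_odd hω.1, ker_succ]
      exact le_odd (isKer_ker k) hω
        (he ▸ hasDerivAt_iteratedDeriv hc (Nat.lt_succ_self (2 * k))) (periodic_iteratedDeriv hp _)
  · refine ⟨k, by omega, fun f hf => ?_, fun f hf he => ?_⟩ <;> obtain ⟨hp, hc, hm⟩ := hf
    · rw [tsum_even hω.1, ker_succ]
      exact (isKer_ker k).integral_abs_conv_primitive_le hω
        (hasDerivAt_iteratedDeriv hc (show 2 * k < 2 * k + 2 by omega))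
        (hasDerivAt_iteratedDeriv hc (show 2 * k + 1 < 2 * k + 2 by omega))
        (hc.continuous_iteratedDeriv _ le_rfl) (periodic_iteratedDeriv hp _) hm
    · rw [tsum_even hω.1, ker_succ]
      exact le_even (isKer_ker k) hω
        (hasDerivAt_iteratedDeriv hc (show 2 * k < 2 * k + 2 by omega))
        (he ▸ hasDerivAt_iteratedDeriv hc (show 2 * k + 1 < 2 * k + 2 by omega))
        (periodic_iteratedDeriv hp _)

end ConjClass

/-- sharp L¹ estimate for the conjugate class W̃^r H_ω. -/
theorem conj_L1_sup (ω : ℝ → ℝ) (hω : IsConcaveModulus ω) (r : ℕ) (hr : 1 ≤ r) :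
    sSup {y : ℝ | ∃ f g : ℝ → ℝ, MemWrH r ω f ∧ ConjFn f g ∧
        y = ∫ t in (0:ℝ)..(2 * π), |g t|} =
      4 * ∑' i : ℕ, (-1 : ℝ) ^ (i * (r + 1)) *
        ((2 / π) * ∫ t in (0:ℝ)..(π / 2), ω (2 * t) * Real.sin ((2 * i + 1) * t)) /
          (2 * (i : ℝ) + 1) ^ (r + 1) := by
  obtain ⟨k, hk, upper, lower⟩ := ConjClass.exists_sharp_constant hω hr
  refine IsGreatest.csSup_eq ⟨?_, ?_⟩
  · obtain ⟨ha, hc, he⟩ := ConjClass.prim_iterate (ConjClass.continuous_extremal hω.1)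
      (ConjClass.extremal_antiperiodic ω) r
    set f := ConjClass.prim^[r] (ConjClass.extremal ω)
    have hp : Function.Periodic f (2 * π) := ha.periodic_two_mul
    have hf : MemWrH r ω f := ⟨hp, hc, he ▸ ConjClass.abs_extremal_sub_le hω⟩
    obtain ⟨C, -, hL⟩ := ConjClass.lipschitz_of_contDiff hr hc hp
    have hg : ConjFn f fun x => -(1 / π) * ConjClass.conv ConjClass.cotKer f x :=
      fun x => ConjClass.conjAt_of_lip hL x
    refine ⟨f, _, hf, hg, ?_⟩
    rw [ConjClass.integral_abs_conjFn_eq hr hc hp hg k hk]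
    exact le_antisymm (lower f hf he) (upper f hf)
  · rintro y ⟨f, g, hf, hg, rfl⟩
    rw [ConjClass.integral_abs_conjFn_eq hr hf.2.1 hf.1 hg k hk]
    exact upper f hf
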